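/- Both Log^=_cd 𝒟 and Log^=_cd 𝒟_fin are decidable, but Log^=_cd(𝒟 ⊗ 𝒟_fin) is undecidable. -/

import Mathlib

namespace OneVarEq

/-- A Kripke `M`-frame. -/
structure KFrame (M : Type) where
  W : Type
  ne : Nonempty W
  R : M → W → W → Prop

/-- the two domain semantics: expanding (`xd`) and constant (`cd`) domains -/
inductive DSem : Type
  | xd | cd
  deriving DecidableEq

/-- disjoint union of a family of frames -/
def KFrame.disjUnion {M ι : Type} (hι : Nonempty ι) (Fs : ι → KFrame M) : KFrame M where
  W := Σ i, (Fs i).W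
  ne := ⟨⟨Classical.choice hι, Classical.choice (Fs (Classical.choice hι)).ne⟩⟩
  R := fun m a b => ∃ (i : ι) (w v : (Fs i).W), (Fs i).R m w v ∧ a = ⟨i, w⟩ ∧ b = ⟨i, v⟩

/-- a class of frames closed under (arbitrary) disjoint unions -/
def ClosedDU {M : Type} (C : Set (KFrame M)) : Prop :=
  ∀ (ι : Type) (hι : Nonempty ι) (Fs : ι → KFrame M),
    (∀ i, Fs i ∈ C) → KFrame.disjUnion hι Fs ∈ C

/-- reduct of a frame along a map of modal signatures -/
def KFrame.reduct {M M' : Type} (f : M' → M) (F : KFrame M) : KFrame M' :=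
  ⟨F.W, F.ne, fun m => F.R (f m)⟩

/-- fusion `𝒞1 ⊗ 𝒞2` of classes of frames: frames over a common set of worlds
whose reducts belong to the respective classes -/
def frameFusion {M1 M2 : Type} (C1 : Set (KFrame M1)) (C2 : Set (KFrame M2)) :
    Set (KFrame (M1 ⊕ M2)) :=
  {F | F.reduct Sum.inl ∈ C1 ∧ F.reduct Sum.inr ∈ C2}

/-- a non-trivial frame: some `R_□` relates two distinct worlds -/
def KFrame.Nontrivial {M : Type} (F : KFrame M) : Prop :=
  ∃ (m : M) (w v : F.W), w ≠ v ∧ F.R m w v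

/-- terms of the one-variable language with constants: the variable `x`,
or a constant `c_k` -/
inductive ETm : Type
  | var : ETm
  | const : ℕ → ETm
  deriving DecidableEq

/-- One-variable modal formulas with equality and (non-rigid) constants. -/
inductive EF (M : Type) : Type
  | pred : ℕ → ETm → EF M
  | eq : ETm → ETm → EF M
  | neg : EF M → EF M
  | and : EF M → EF M → EF M
  | ex : EF M → EF M
  | box : M → EF M → EF M
  deriving DecidableEq

namespace EF

variable {M : Type}

def imp (φ ψ : EF M) : EF M := .neg (.and φ (.neg ψ))

def or (φ ψ : EF M) : EF M := .neg (.and (.neg φ) (.neg ψ))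

def iff (φ ψ : EF M) : EF M := .and (imp φ ψ) (imp ψ φ)

def all (φ : EF M) : EF M := .neg (.ex (.neg φ))

end EF

/-- A Kripke model with equality (expanding domains in general): a family of
normal classical structures over subsets of one big domain, with non-rigid
constants, expanding along all accessibility relations. -/
structure EModel {M : Type} (F : KFrame M) where
  D : Type
  dom : F.W → Set D
  domNe : ∀ w, (dom w).Nonempty
  expand : ∀ (m : M) (w v : F.W), F.R m w v → dom w ⊆ dom v
  I : F.W → ℕ → Set D
  cst : F.W → ℕ → D
  cstMem : ∀ w k, cst w k ∈ dom w

namespace EModel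

variable {M : Type} {F : KFrame M}

/-- a `d`-model: for `cd`, all the domains coincide (with the common domain) -/
def IsD (𝔪 : EModel F) (d : DSem) : Prop :=
  d = DSem.cd → ∀ w, 𝔪.dom w = Set.univ

/-- value of a term at a world under an assignment -/
def tmVal (𝔪 : EModel F) (w : F.W) (a : 𝔪.D) : ETm → 𝔪.D
  | .var => a
  | .const k => 𝔪.cst w k

/-- truth at a world under an assignment; `=` is interpreted as identity -/
def eval (𝔪 : EModel F) : EF M → F.W → 𝔪.D → Prop
  | .pred n t, w, a => 𝔪.tmVal w a t ∈ 𝔪.I w n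
  | .eq t₁ t₂, w, a => 𝔪.tmVal w a t₁ = 𝔪.tmVal w a t₂
  | .neg φ, w, a => ¬ 𝔪.eval φ w a
  | .and φ ψ, w, a => 𝔪.eval φ w a ∧ 𝔪.eval ψ w a
  | .ex φ, w, _ => ∃ b ∈ 𝔪.dom w, 𝔪.eval φ w b
  | .box m φ, w, a => ∀ v, F.R m w v → 𝔪.eval φ v a

def TrueAt (𝔪 : EModel F) (φ : EF M) (w : F.W) : Prop :=
  ∀ a ∈ 𝔪.dom w, 𝔪.eval φ w a

def TrueIn (𝔪 : EModel F) (φ : EF M) : Prop := ∀ w, 𝔪.TrueAt φ w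

end EModel

/-- `Log^=_d 𝒞`: formulas with equality true in every `d`-model with equality
based on a frame from `𝒞` -/
def LogED {M : Type} (d : DSem) (C : Set (KFrame M)) : Set (EF M) :=
  {φ | ∀ F ∈ C, ∀ 𝔪 : EModel F, 𝔪.IsD d → 𝔪.TrueIn φ}

/-- global consequence `φ ⊢*_L ψ` -/
inductive GlobalConseqE {M : Type} (L : Set (EF M)) (φ : EF M) : EF M → Prop
  | ax {ψ} : ψ ∈ L → GlobalConseqE L φ ψ
  | prem : GlobalConseqE L φ φ
  | mp {ψ χ} : GlobalConseqE L φ (EF.imp ψ χ) → GlobalConseqE L φ ψ → GlobalConseqE L φ χ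
  | gen {ψ} : GlobalConseqE L φ ψ → GlobalConseqE L φ (EF.all ψ)
  | nec (m : M) {ψ} : GlobalConseqE L φ ψ → GlobalConseqE L φ (EF.box m ψ)

/-- Gödel numbering of terms -/
def ETm.code : ETm → ℕ
  | .var => 0
  | .const k => k + 1

/-- the fixed Gödel numbering of formulas with equality (relative to a
numbering `eM` of the modal operators) -/
def EF.encode {M : Type} (eM : M → ℕ) : EF M → ℕ
  | .pred n t => Nat.pair 0 (Nat.pair n t.code)
  | .eq t₁ t₂ => Nat.pair 1 (Nat.pair t₁.code t₂.code)
  | .neg φ => Nat.pair 2 (EF.encode eM φ)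
  | .and φ ψ => Nat.pair 3 (Nat.pair (EF.encode eM φ) (EF.encode eM ψ))
  | .ex φ => Nat.pair 4 (EF.encode eM φ)
  | .box m φ => Nat.pair 5 (Nat.pair (eM m) (EF.encode eM φ))

/-- decidability of a set of formulas w.r.t. the fixed Gödel numbering -/
def DecidableELogic {M : Type} (eM : M → ℕ) (L : Set (EF M)) : Prop :=
  ComputablePred (fun n : ℕ => ∃ φ ∈ L, EF.encode eM φ = n)

/-- decidability of the global consequence relation of `L` -/
def GloballyDecidableE {M : Type} (eM : M → ℕ) (L : Set (EF M)) : Prop :=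
  ComputablePred (fun p : ℕ × ℕ =>
    ∃ φ ψ, GlobalConseqE L φ ψ ∧ EF.encode eM φ = p.1 ∧ EF.encode eM ψ = p.2)

/-- recursive enumerability (= recursive axiomatisability) of a set of
formulas w.r.t. the fixed Gödel numbering -/
def REELogic {M : Type} (eM : M → ℕ) (L : Set (EF M)) : Prop :=
  REPred (fun n : ℕ => ∃ φ ∈ L, EF.encode eM φ = n)

/-- the class `𝒟` of all disjoint unions of difference frames -/
def Dclass : Set (KFrame Unit) :=
  {F | ∃ (ι : Type) (f : F.W → ι), ∀ w v, F.R () w v ↔ (f w = f v ∧ w ≠ v)}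

/-- the class `𝒟_fin` of all disjoint unions of finite difference frames -/
def DfinClass : Set (KFrame Unit) :=
  {F | ∃ (ι : Type) (f : F.W → ι),
    (∀ w v, F.R () w v ↔ (f w = f v ∧ w ≠ v)) ∧ ∀ w, {v | f v = f w}.Finite}

/-- numbering of the trivial monomodal signature -/
def eU : Unit → ℕ := fun _ => 0

/-- numbering of the bimodal signature `Unit ⊕ Unit` -/
def eUU : Unit ⊕ Unit → ℕ := Sum.elim (fun _ => 0) (fun _ => 1)

end OneVarEq

namespace OneVarEq

/-! ### Profiles of finite words -/

def Occ {ι L : Type} (s : ι → L) (σ : L) : Prop := ∃ i, s i = σ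
def Two {ι L : Type} (s : ι → L) (σ : L) : Prop := ∃ i j, i ≠ j ∧ s i = σ ∧ s j = σ
def SameProf {ι ι' L : Type} (s : ι → L) (s' : ι' → L) : Prop :=
  ∀ σ, (Occ s σ ↔ Occ s' σ) ∧ (Two s σ ↔ Two s' σ)

theorem Two.occ {ι L : Type} {s : ι → L} {σ : L} (h : Two s σ) : Occ s σ := by
  obtain ⟨i, j, _, h, _⟩ := h; exact ⟨i, h⟩

theorem SameProf.rfl {ι L : Type} {s : ι → L} : SameProf s s := fun _ => ⟨Iff.rfl, Iff.rfl⟩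

theorem SameProf.symm {ι ι' L : Type} {s : ι → L} {s' : ι' → L} (h : SameProf s s') :
    SameProf s' s := fun σ => ⟨(h σ).1.symm, (h σ).2.symm⟩

theorem SameProf.trans {ι ι' ι'' L : Type} {s : ι → L} {s' : ι' → L} {s'' : ι'' → L}
    (h : SameProf s s') (h' : SameProf s' s'') :
    SameProf s s'' := fun σ => ⟨(h σ).1.trans (h' σ).1, (h σ).2.trans (h' σ).2⟩

theorem SameProf.of_equiv {ι ι' L : Type} {s : ι → L} {s' : ι' → L} (e : ι ≃ ι')
    (h : ∀ i, s' (e i) = s i) : SameProf s s' := by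
  intro σ
  refine ⟨⟨?_, ?_⟩, ⟨?_, ?_⟩⟩
  · rintro ⟨i, hi⟩; exact ⟨e i, by rw [h, hi]⟩
  · rintro ⟨i, hi⟩; exact ⟨e.symm i, by rw [← h, e.apply_symm_apply, hi]⟩
  · rintro ⟨i, j, hij, hi, hj⟩
    exact ⟨e i, e j, fun hh => hij (e.injective hh), by rw [h, hi], by rw [h, hj]⟩
  · rintro ⟨i, j, hij, hi, hj⟩
    exact ⟨e.symm i, e.symm j, fun hh => hij (e.symm.injective hh),
      by rw [← h, e.apply_symm_apply, hi], by rw [← h, e.apply_symm_apply, hj]⟩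

/-- the part of a word outside of a set -/
def outp {ι L : Type} (D0 : Set ι) (s : ι → L) : {j // j ∉ D0} → L := fun j => s j

/-- row realisation -/
theorem row_real {V L CO E : Type} (D0 : Set V) (s : V → L) (s' : D0 ⊕ CO → L)
    (ec : E → CO) (lt : E → L) (inj : Function.Injective ec)
    (h0 : ∀ a : D0, s' (.inl a) = s a)
    (h1 : ∀ e, s' (.inr (ec e)) = lt e)
    (h2 : ∀ c, (∀ e, ec e ≠ c) → Two s (s' (.inr c)))
    (hp : SameProf (outp D0 s) lt) : SameProf s s' := by
  classical
  have hocc : ∀ e, ∃ j, j ∉ D0 ∧ s j = lt e := by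
    intro e
    obtain ⟨⟨j, hj⟩, h⟩ := (hp (lt e)).1.2 ⟨e, rfl⟩
    exact ⟨j, hj, h⟩
  intro σ
  refine ⟨⟨?_, ?_⟩, ⟨?_, ?_⟩⟩
  · rintro ⟨i, hi⟩
    by_cases hD : i ∈ D0
    · exact ⟨.inl ⟨i, hD⟩, by rw [h0]; exact hi⟩
    · obtain ⟨e, he⟩ := (hp σ).1.1 ⟨⟨i, hD⟩, hi⟩
      exact ⟨.inr (ec e), by rw [h1, he]⟩
  · rintro ⟨i | c, hi⟩
    · exact ⟨i, by rw [← h0]; exact hi⟩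
    · by_cases hc : ∃ e, ec e = c
      · obtain ⟨e, rfl⟩ := hc
        obtain ⟨j, _, hj⟩ := hocc e
        exact ⟨j, by rw [hj, ← h1, hi]⟩
      · push Not at hc
        have := (h2 c hc).occ
        rwa [hi] at this
  · rintro ⟨i, j, hij, hi, hj⟩
    by_cases hD : i ∈ D0 <;> by_cases hE : j ∈ D0
    · exact ⟨.inl ⟨i, hD⟩, .inl ⟨j, hE⟩, by simpa using hij, by rw [h0]; exact hi,
        by rw [h0]; exact hj⟩
    · obtain ⟨e, he⟩ := (hp σ).1.1 ⟨⟨j, hE⟩, hj⟩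
      exact ⟨.inl ⟨i, hD⟩, .inr (ec e), by simp, by rw [h0]; exact hi, by rw [h1, he]⟩
    · obtain ⟨e, he⟩ := (hp σ).1.1 ⟨⟨i, hD⟩, hi⟩
      exact ⟨.inl ⟨j, hE⟩, .inr (ec e), by simp, by rw [h0]; exact hj, by rw [h1, he]⟩
    · obtain ⟨e, e', hee, he, he'⟩ := (hp σ).2.1 ⟨⟨i, hD⟩, ⟨j, hE⟩, by simpa using hij, hi, hj⟩
      exact ⟨.inr (ec e), .inr (ec e'), by simpa using fun h => hee (inj h),
        by rw [h1, he], by rw [h1, he']⟩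
  · rintro ⟨i, j, hij, hi, hj⟩
    have key : ∀ c, s' (.inr c) = σ → Two s σ ∨ ∃ e, ec e = c ∧ lt e = σ := by
      intro c hc
      by_cases hcc : ∃ e, ec e = c
      · obtain ⟨e, rfl⟩ := hcc
        exact .inr ⟨e, rfl, by rw [← h1, hc]⟩
      · push Not at hcc
        have := h2 c hcc
        rw [hc] at this
        exact .inl this
    have mixed : ∀ (a : D0) c, s' (.inl a) = σ → s' (.inr c) = σ → Two s σ := by
      intro a c ha hc
      rcases key c hc with h | ⟨e, _, he⟩
      · exact h
      · obtain ⟨j, hj, hj'⟩ := hocc e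
        exact ⟨a, j, fun h => hj (h ▸ a.2), by rw [← h0]; exact ha, by rw [hj', he]⟩
    rcases i with a | c <;> rcases j with b | d
    · exact ⟨a, b, fun h => hij (by rw [Subtype.ext h]), by rw [← h0]; exact hi,
        by rw [← h0]; exact hj⟩
    · exact mixed a d hi hj
    · exact mixed b c hj hi
    · rcases key c hi with h | ⟨e, he1, he⟩
      · exact h
      rcases key d hj with h | ⟨e', he1', he'⟩
      · exact h
      have hne : e ≠ e' := by
        rintro rfl
        exact hij (by rw [← he1, ← he1'])
      obtain ⟨i, j, hij, h, h'⟩ := (hp σ).2.2 ⟨e, e', hne, he, he'⟩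
      exact ⟨i, j, fun hh => hij (Subtype.ext hh), h, h'⟩

theorem core_real {V L Y1 Y2 : Type} (D0 : Set V) (s : V → L) (κ1 : Y1 → V) (κ2 : Y2 → V)
    (h1 : SameProf s (Sum.elim (fun a : D0 => s a) (fun y => s (κ1 y))))
    (h2 : ∀ y, Two s (s (κ2 y))) :
    SameProf s (Sum.elim (fun a : D0 => s a)
      (Sum.elim (fun y => s (κ1 y)) (fun y => s (κ2 y)))) := by
  intro σ
  have emb : Function.Injective
      (Sum.elim (fun a : D0 => (Sum.inl a : D0 ⊕ (Y1 ⊕ Y2))) (fun y : Y1 => Sum.inr (Sum.inl y))) := by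
    rintro (a | a) (b | b) <;> simp
  have val : ∀ x, (Sum.elim (fun a : D0 => s a)
      (Sum.elim (fun y => s (κ1 y)) (fun y => s (κ2 y)))) ((Sum.elim (fun a : D0 => (Sum.inl a : D0 ⊕ (Y1 ⊕ Y2))) (fun y : Y1 => Sum.inr (Sum.inl y))) x) = (Sum.elim (fun a : D0 => s a) (fun y => s (κ1 y))) x := by
    rintro (a | a) <;> simp
  refine ⟨⟨?_, ?_⟩, ⟨?_, ?_⟩⟩
  · intro h
    obtain ⟨x, hx⟩ := (h1 σ).1.1 h
    exact ⟨_, (val x).trans hx⟩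
  · rintro ⟨a | y | y, h⟩
    · exact ⟨_, h⟩
    · exact ⟨_, h⟩
    · exact ⟨_, h⟩
  · intro h
    obtain ⟨x, y, hxy, hx, hy⟩ := (h1 σ).2.1 h
    exact ⟨_, _, fun hh => hxy (emb hh), (val x).trans hx, (val y).trans hy⟩
  · rintro ⟨x, y, hxy, hx, hy⟩
    by_cases hx' : ∃ x', x = .inr (.inr x')
    · obtain ⟨x', rfl⟩ := hx'
      have := h2 x'
      simp at hx
      rwa [hx] at this
    by_cases hy' : ∃ x', y = .inr (.inr x')
    · obtain ⟨x', rfl⟩ := hy'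
      have := h2 x'
      simp at hy
      rwa [hy] at this
    apply (h1 σ).2.2
    rcases x with a | x | x
    · rcases y with b | y | y
      · exact ⟨.inl a, .inl b, by simpa using hxy, by simpa using hx, by simpa using hy⟩
      · exact ⟨.inl a, .inr y, by simp, by simpa using hx, by simpa using hy⟩
      · exact absurd ⟨y, rfl⟩ hy'
    · rcases y with b | y | y
      · exact ⟨.inr x, .inl b, by simp, by simpa using hx, by simpa using hy⟩
      · exact ⟨.inr x, .inr y, by simpa using hxy, by simpa using hx, by simpa using hy⟩
      · exact absurd ⟨y, rfl⟩ hy'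
    · exact absurd ⟨x, rfl⟩ hx'

end OneVarEq

namespace OneVarEq

section cover
variable {X1 X2 P E L Z : Type}

def cvEnd (pr : P → X1) (er : E → X2) : (E × P × Z) ⊕ P → X1 ⊕ (X2 × P × Z)
  | .inl (e, p, z) => .inr (er e, p, z)
  | .inr p => .inl (pr p)

def cvLt (pl : P → L) (el : E → L) : (E × P × Z) ⊕ P → L
  | .inl (e, _, _) => el e
  | .inr p => pl p

theorem cv_prof1 (pr : P → X1) (er : E → X2) (pl : P → L) (el : E → L) (x : X1) :
    SameProf (fun p : {p // pr p = x} => pl p)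
      (fun e : {e : (E × P × Z) ⊕ P // cvEnd pr er e = .inl x} => cvLt pl el e.1) := by
  refine SameProf.of_equiv ⟨fun p => ⟨.inr p.1, by simp [cvEnd, p.2]⟩,
    fun e => match e with
      | ⟨.inr p, h⟩ => ⟨p, by simpa [cvEnd] using h⟩
      | ⟨.inl (e, p, z), h⟩ => by simp [cvEnd] at h, ?_, ?_⟩ ?_
  · rintro ⟨p, hp⟩; rfl
  · rintro ⟨⟨e, p, z⟩ | p, h⟩
    · simp [cvEnd] at h
    · rfl
  · rintro ⟨p, hp⟩; rfl

theorem cv_prof2 (pr : P → X1) (er : E → X2) (pl : P → L) (el : E → L) (x : X2 × P × Z) :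
    SameProf (fun p : {p // er p = x.1} => el p)
      (fun e : {e : (E × P × Z) ⊕ P // cvEnd pr er e = .inr x} => cvLt pl el e.1) := by
  refine SameProf.of_equiv ⟨fun p => ⟨.inl (p.1, x.2), by simp [cvEnd, p.2]⟩,
    fun e => match e with
      | ⟨.inr p, h⟩ => by simp [cvEnd] at h
      | ⟨.inl (e, p, z), h⟩ => ⟨e, by
          simp only [cvEnd, Sum.inr.injEq] at h; rw [← h]⟩, ?_, ?_⟩ ?_
  · rintro ⟨p, hp⟩; rfl
  · rintro ⟨⟨e, p, z⟩ | p, h⟩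
    · simp only [cvEnd, Sum.inr.injEq] at h
      subst h
      rfl
    · simp [cvEnd] at h
  · rintro ⟨p, hp⟩; rfl

open Classical in
noncomputable def cvSwapF [Zero Z] (π : P → E) : (E × P × Z) ⊕ P → (E × P × Z) ⊕ P
  | .inl (e, p, z) => if e = π p ∧ z = 0 then .inr p else .inl (e, p, z)
  | .inr p => .inl (π p, p, 0)

theorem cvSwapF_inv [Zero Z] (π : P → E) : Function.Involutive (cvSwapF (Z := Z) π) := by
  rintro (⟨e, p, z⟩ | p)
  · by_cases h : e = π p ∧ z = 0
    · simp only [cvSwapF, h, and_self, if_true]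
    · simp only [cvSwapF, h, if_false]
  · simp [cvSwapF]

noncomputable def cvPhi [AddGroup Z] (π : P → E) (ℓ : E → Z) : (E × P × Z) ⊕ P ≃ (E × P × Z) ⊕ P :=
  (cvSwapF_inv π).toPerm.trans (Equiv.sumCongr
    ⟨fun x => (x.1, x.2.1, x.2.2 + ℓ x.1), fun x => (x.1, x.2.1, x.2.2 - ℓ x.1),
      fun x => by simp, fun x => by simp⟩ (Equiv.refl _))

theorem cvPhi_inr [AddGroup Z] (π : P → E) (ℓ : E → Z) (p : P) :
    cvPhi π ℓ (.inr p) = .inl (π p, p, 0 + ℓ (π p)) := rfl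

theorem cvPhi_inl [AddGroup Z] (π : P → E) (ℓ : E → Z) (e : E) (p : P) (z : Z)
    (h : ¬ (e = π p ∧ z = 0)) :
    cvPhi π ℓ (.inl (e, p, z)) = .inl (e, p, z + ℓ e) := by
  simp [cvPhi, Function.Involutive.toPerm, cvSwapF, h]

theorem cvPhi_inl' [AddGroup Z] (π : P → E) (ℓ : E → Z) (p : P) :
    cvPhi π ℓ (.inl (π p, p, 0)) = .inr p := by
  simp [cvPhi, Function.Involutive.toPerm, cvSwapF]

theorem cvLt_phi [AddGroup Z] (π : P → E) (ℓ : E → Z) (pl : P → L) (el : E → L)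
    (hπ : ∀ p, el (π p) = pl p) (x) : cvLt pl el (cvPhi π ℓ x) = cvLt pl el x := by
  rcases x with ⟨e, p, z⟩ | p
  · by_cases h : e = π p ∧ z = 0
    · obtain ⟨rfl, rfl⟩ := h
      rw [cvPhi_inl']; simp [cvLt, hπ]
    · rw [cvPhi_inl _ _ _ _ _ h]; rfl
  · rw [cvPhi_inr]; simp [cvLt, hπ]

theorem cv_inj {Y1 Y2 : Type} [AddGroup Z] (π : P → E) (ℓ : E → Z) (hℓ : Function.Injective ℓ)
    (pr : P → X1) (er : E → X2) (pc : P → Y1) (ec : E → Y2) (x y : (E × P × Z) ⊕ P)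
    (h1 : cvEnd pr er x = cvEnd pr er y)
    (h2 : cvEnd pc ec (cvPhi π ℓ x) = cvEnd pc ec (cvPhi π ℓ y)) : x = y := by
  rcases x with ⟨e, p, z⟩ | p <;> rcases y with ⟨e', p', z'⟩ | p'
  · simp only [cvEnd, Sum.inr.injEq, Prod.mk.injEq] at h1
    obtain ⟨-, rfl, rfl⟩ := h1
    by_cases h : e = π p ∧ z = 0 <;> by_cases h' : e' = π p ∧ z = 0
    · rw [h.1, h'.1]
    · obtain ⟨rfl, rfl⟩ := h
      rw [cvPhi_inl', cvPhi_inl _ _ _ _ _ h'] at h2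
      simp [cvEnd] at h2
    · obtain ⟨rfl, rfl⟩ := h'
      rw [cvPhi_inl', cvPhi_inl _ _ _ _ _ h] at h2
      simp [cvEnd] at h2
    · rw [cvPhi_inl _ _ _ _ _ h, cvPhi_inl _ _ _ _ _ h'] at h2
      simp only [cvEnd, Sum.inr.injEq, Prod.mk.injEq, add_right_inj, true_and] at h2
      rw [hℓ h2.2]
  · simp [cvEnd] at h1
  · simp [cvEnd] at h1
  · rw [cvPhi_inr, cvPhi_inr] at h2
    simp only [cvEnd, Sum.inr.injEq, Prod.mk.injEq] at h2
    rw [h2.2.1]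

end cover

theorem sameProf_subtype_equiv {A B Y L : Type} (φ : A ≃ B) (f : B → Y) (l : B → L) (y : Y) :
    SameProf (fun b : {b // f b = y} => l b) (fun a : {a // f (φ a) = y} => l (φ a)) := by
  refine SameProf.symm (SameProf.of_equiv ⟨fun a => ⟨φ a.1, a.2⟩,
    fun b => ⟨φ.symm b.1, by simp [b.2]⟩, fun a => by simp, fun b => by simp⟩ ?_)
  intro a; rfl

theorem cover {U V L X1 X2 Y1 Y2 P E : Type} (t : U → V → L) (W0 : Set U) (D0 : Set V)
    (ρ1 : X1 → U) (ρ2 : X2 → U) (κ1 : Y1 → V) (κ2 : Y2 → V)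
    (pr : P → X1) (pc : P → Y1) (pl : P → L) (er : E → X2) (ec : E → Y2) (el : E → L)
    (π : P → E) (hπ : ∀ p, el (π p) = pl p)
    (hPr : ∀ x, SameProf (outp D0 (t (ρ1 x))) (fun p : {p // pr p = x} => pl p))
    (hPc : ∀ y, SameProf (outp W0 (fun u => t u (κ1 y))) (fun p : {p // pc p = y} => pl p))
    (hEr : ∀ x, SameProf (outp D0 (t (ρ2 x))) (fun p : {p // er p = x} => el p))
    (hEc : ∀ y, SameProf (outp W0 (fun u => t u (κ2 y))) (fun p : {p // ec p = y} => el p))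
    (fill : ∀ x y, ∃ σ, Two (t (Sum.elim ρ1 ρ2 x)) σ ∧
      Two (fun u => t u (Sum.elim κ1 κ2 y)) σ)
    (cr1 : ∀ w ∈ W0, SameProf (t w) (Sum.elim (fun a : D0 => t w a) (fun y => t w (κ1 y))))
    (cr2 : ∀ w ∈ W0, ∀ y, Two (t w) (t w (κ2 y)))
    (cc1 : ∀ a ∈ D0, SameProf (fun u => t u a)
      (Sum.elim (fun w : W0 => t w a) (fun x => t (ρ1 x) a)))
    (cc2 : ∀ a ∈ D0, ∀ x, Two (fun u => t u a) (t (ρ2 x) a)) :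
    ∃ T : (W0 ⊕ (X1 ⊕ X2 × P × (E → ZMod 2))) → (D0 ⊕ (Y1 ⊕ Y2 × P × (E → ZMod 2))) → L,
      (∀ w : W0, SameProf (t w) (T (.inl w))) ∧
      (∀ x, SameProf (t (ρ1 x)) (T (.inr (.inl x)))) ∧
      (∀ x, SameProf (t (ρ2 x.1)) (T (.inr (.inr x)))) ∧
      (∀ a : D0, SameProf (fun u => t u a) (fun u => T u (.inl a))) ∧
      (∀ y, SameProf (fun u => t u (κ1 y)) (fun u => T u (.inr (.inl y)))) ∧
      (∀ y, SameProf (fun u => t u (κ2 y.1)) (fun u => T u (.inr (.inr y)))) ∧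
      (∀ (w : W0) (a : D0), T (.inl w) (.inl a) = t w a) := by
  classical
  let Z := E → ZMod 2
  let ℓ : E → Z := fun e => Pi.single e 1
  have hℓ : Function.Injective ℓ := by
    intro e e' h
    by_contra hne
    have := congrFun h e
    simp [ℓ, hne] at this
  let φ := cvPhi (Z := Z) π ℓ
  let R := cvEnd (Z := Z) pr er
  let C := fun x => cvEnd (Z := Z) pc ec (φ x)
  let lt := cvLt (Z := Z) pl el
  let ρ : X1 ⊕ X2 × P × Z → U := Sum.elim ρ1 (fun x => ρ2 x.1)
  let κ : Y1 ⊕ Y2 × P × Z → V := Sum.elim κ1 (fun x => κ2 x.1)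
  have fill' : ∀ x y, ∃ σ, Two (t (ρ x)) σ ∧ Two (fun u => t u (κ y)) σ := by
    intro x y
    have := fill (x.map id Prod.fst) (y.map id Prod.fst)
    rcases x with x | x <;> rcases y with y | y <;> exact this
  choose fl hfl1 hfl2 using fill'
  have inj : ∀ x y, R x = R y → C x = C y → x = y := fun x y => cv_inj π ℓ hℓ pr er pc ec x y
  have hR : ∀ x, SameProf (outp D0 (t (ρ x))) (fun e : {e // R e = x} => lt e) := by
    rintro (x | x)
    · exact (hPr x).trans (cv_prof1 pr er pl el x)
    · exact (hEr x.1).trans (cv_prof2 pr er pl el x)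
  have hC : ∀ y, SameProf (outp W0 (fun u => t u (κ y))) (fun e : {e // C e = y} => lt e) := by
    intro y
    have h1 : SameProf (outp W0 (fun u => t u (κ y)))
        (fun e : {e // cvEnd (Z := Z) pc ec e = y} => lt e) := by
      rcases y with y | y
      · exact (hPc y).trans (cv_prof1 pc ec pl el y)
      · exact (hEc y.1).trans (cv_prof2 pc ec pl el y)
    refine h1.trans ((sameProf_subtype_equiv φ (cvEnd pc ec) lt y).trans ?_)
    have : ∀ a, lt (φ a) = lt a := cvLt_phi π ℓ pl el hπ
    simp only [this]
    exact SameProf.rfl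
  let T : (W0 ⊕ (X1 ⊕ X2 × P × Z)) → (D0 ⊕ (Y1 ⊕ Y2 × P × Z)) → L := fun r c =>
    match r, c with
    | .inl w, .inl a => t w a
    | .inl w, .inr c => t w (κ c)
    | .inr r, .inl a => t (ρ r) a
    | .inr r, .inr c => if h : ∃ e, R e = r ∧ C e = c then lt h.choose else fl r c
  have hTe : ∀ e, T (.inr (R e)) (.inr (C e)) = lt e := by
    intro e
    have h : ∃ e', R e' = R e ∧ C e' = C e := ⟨e, rfl, rfl⟩
    have : T (.inr (R e)) (.inr (C e)) = lt h.choose := dif_pos h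
    rw [this, inj _ _ h.choose_spec.1 h.choose_spec.2]
  have hTf : ∀ r c, (¬ ∃ e, R e = r ∧ C e = c) → T (.inr r) (.inr c) = fl r c := by
    intro r c h
    exact dif_neg h
  have rowO : ∀ r, SameProf (t (ρ r)) (T (.inr r)) := by
    intro r
    refine row_real D0 _ _ (fun e : {e // R e = r} => C e.1) (fun e => lt e.1) ?_ ?_ ?_ ?_ (hR r)
    · intro e e' h
      exact Subtype.ext (inj _ _ (e.2.trans e'.2.symm) h)
    · intro a; rfl
    · rintro ⟨e, rfl⟩; exact hTe e
    · intro c hc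
      rw [hTf]
      · exact hfl1 r c
      · rintro ⟨e, h1, h2⟩; exact hc ⟨e, h1⟩ h2
  have colO : ∀ c, SameProf (fun u => t u (κ c)) (fun u => T u (.inr c)) := by
    intro c
    refine row_real W0 _ _ (fun e : {e // C e = c} => R e.1) (fun e => lt e.1) ?_ ?_ ?_ ?_ (hC c)
    · intro e e' h
      exact Subtype.ext (inj _ _ h (e.2.trans e'.2.symm))
    · intro a; rfl
    · rintro ⟨e, rfl⟩; exact hTe e
    · intro r hr
      rw [hTf]
      · exact hfl2 r c
      · rintro ⟨e, h1, h2⟩; exact hr ⟨e, h2⟩ h1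
  refine ⟨T, ?_, fun x => rowO (.inl x), fun x => rowO (.inr x), ?_, fun x => colO (.inl x),
    fun x => colO (.inr x), fun w a => rfl⟩
  · intro w
    have := core_real D0 (t w) κ1 (fun y : Y2 × P × Z => κ2 y.1) (cr1 w w.2)
      (fun y => cr2 w w.2 y.1)
    convert this using 1
    funext x
    rcases x with x | x | x <;> rfl
  · intro a
    have := core_real W0 (fun u => t u a) ρ1 (fun y : X2 × P × Z => ρ2 y.1) (cc1 a a.2)
      (fun y => cc2 a a.2 y.1)
    convert this using 1
    funext x
    rcases x with x | x | x <;> rfl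

/-! edge systems from tokens -/

def Tok {X V L : Type} (D0 : Set V) (s : X → V → L) (σ : L) : Type :=
  {x : X × Bool // if x.2 then Two (outp D0 (s x.1)) σ else Occ (outp D0 (s x.1)) σ}

theorem tok_prof {X V L S : Type} (D0 : Set V) (s : X → V → L) (sl : S → L) (at' : S → X)
    (hat : ∀ z, Two (outp D0 (s (at' z))) (sl z)) (x : X) :
    SameProf (outp D0 (s x))
      (fun e : {e : (Σ σ, Tok D0 s σ) ⊕ S //
        (Sum.elim (fun e => e.2.1.1) at' e : X) = x} =>
        (Sum.elim (fun e => e.1) sl e.1 : L)) := by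
  intro σ
  refine ⟨⟨?_, ?_⟩, ⟨?_, ?_⟩⟩
  · intro h
    exact ⟨⟨.inl ⟨σ, ⟨(x, false), by simpa using h⟩⟩, rfl⟩, rfl⟩
  · rintro ⟨⟨⟨σ', ⟨⟨x', b⟩, h⟩⟩ | z, hx⟩, hs⟩
    · dsimp at hx hs
      subst hx hs
      cases b
      · simpa using h
      · exact Two.occ (by simpa using h)
    · dsimp at hx hs
      subst hx hs
      exact (hat z).occ
  · intro h
    refine ⟨⟨.inl ⟨σ, ⟨(x, false), by simpa using h.occ⟩⟩, rfl⟩,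
      ⟨.inl ⟨σ, ⟨(x, true), by simpa using h⟩⟩, rfl⟩, ?_, rfl, rfl⟩
    intro hh
    have h2 := Sum.inl.inj (Subtype.mk.inj hh)
    have := congrArg (fun z : (Σ σ, Tok D0 s σ) => z.2.1.2) h2
    simp at this
  · rintro ⟨⟨⟨σ', ⟨⟨x', b⟩, h⟩⟩ | z, hx⟩, ⟨⟨σ'', ⟨⟨x'', b'⟩, h'⟩⟩ | z', hx'⟩, hne, hs, hs'⟩
    · dsimp at hx hs hx' hs'
      subst hx hs hs'
      subst hx'
      cases b
      · cases b'
        · exact absurd rfl hne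
        · simpa using h'
      · simpa using h
    · dsimp at hx' hs'
      subst hx' hs'
      exact hat z'
    · dsimp at hx hs
      subst hx hs
      exact hat z
    · dsimp at hx hs
      subst hx hs
      exact hat z

end OneVarEq

namespace OneVarEq

abbrev RTok {X V L : Type} (D0 : Set V) (s : X → V → L) (S : Type) : Type :=
  (Σ σ, Tok D0 s σ) ⊕ S

def rtEnd {X V L S : Type} {D0 : Set V} {s : X → V → L} (at' : S → X) : RTok D0 s S → X :=
  Sum.elim (fun e => e.2.1.1) at'

def rtLet {X V L S : Type} {D0 : Set V} {s : X → V → L} (sl : S → L) : RTok D0 s S → L :=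
  Sum.elim (fun e => e.1) sl

theorem edge_sys {X Y U V L SR SC : Type} (D0 : Set V) (W0 : Set U) (sX : X → V → L)
    (sY : Y → U → L) (slR : SR → L) (slC : SC → L) (atC : SC → Y)
    (hC : ∀ z, Two (outp W0 (sY (atC z))) (slC z))
    (heq : ∀ σ, Nonempty ({a : RTok D0 sX SR // rtLet slR a = σ} ≃
      {a : RTok W0 sY SC // rtLet slC a = σ})) :
    ∃ ec : RTok D0 sX SR → Y, ∀ y, SameProf (outp W0 (sY y))
      (fun e : {e // ec e = y} => rtLet slR e.1) := by
  let Φ := Equiv.ofFiberEquiv (fun σ => (heq σ).some)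
  have hΦ : ∀ a, rtLet slC (Φ a) = rtLet slR a := fun a => Equiv.ofFiberEquiv_map _ a
  refine ⟨fun e => rtEnd atC (Φ e), fun y => ?_⟩
  refine (tok_prof W0 sY slC atC hC y).trans
    ((sameProf_subtype_equiv Φ (rtEnd atC) (rtLet slC) y).trans ?_)
  simp only [hΦ]
  exact SameProf.rfl

open Classical in
noncomputable def kout {ι L : Type} (D0 : Set ι) (s : ι → L) (σ : L) : ℕ :=
  if Two (outp D0 s) σ then 2 else if Occ (outp D0 s) σ then 1 else 0

def rtFiberEquiv {X V L S : Type} (D0 : Set V) (s : X → V → L) (sl : S → L) (σ : L) :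
    {a : RTok D0 s S // rtLet sl a = σ} ≃ (Tok D0 s σ ⊕ {z : S // sl z = σ}) where
  toFun a := match a with
    | ⟨.inl ⟨σ', x⟩, h⟩ => .inl (h ▸ x)
    | ⟨.inr z, h⟩ => .inr ⟨z, h⟩
  invFun b := match b with
    | .inl x => ⟨.inl ⟨σ, x⟩, rfl⟩
    | .inr z => ⟨.inr z.1, z.2⟩
  left_inv := by
    rintro ⟨⟨σ', x⟩ | z, h⟩
    · cases h; rfl
    · rfl
  right_inv := by
    rintro (x | z)
    · rfl
    · rfl

theorem card_tok {X V L : Type} [Fintype X] (D0 : Set V) (s : X → V → L) (σ : L) :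
    Nat.card (Tok D0 s σ) = ∑ x, kout D0 (s x) σ := by
  classical
  unfold Tok
  rw [Nat.card_eq_fintype_card, Fintype.card_subtype, Finset.card_filter,
    Fintype.sum_prod_type]
  refine Finset.sum_congr rfl fun x _ => ?_
  rw [Fintype.sum_bool]
  unfold kout
  by_cases h : Two (outp D0 (s x)) σ
  · simp [h, h.occ]
  · simp [h]

instance {X V L : Type} [Finite X] (D0 : Set V) (s : X → V → L) (σ : L) :
    Finite (Tok D0 s σ) := by unfold Tok; infer_instance

theorem kout_le {ι L : Type} (D0 : Set ι) (s : ι → L) (σ : L) : kout D0 s σ ≤ 2 := by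
  unfold kout; split_ifs <;> omega

theorem card_rtok_le {X V L S : Type} [Fintype X] [Fintype L] [Finite S] (D0 : Set V)
    (s : X → V → L) :
    Nat.card (RTok D0 s S) ≤ 2 * Fintype.card L * Fintype.card X + Nat.card S := by
  rw [Nat.card_sum, Nat.card_sigma]
  have : ∑ σ, Nat.card (Tok D0 s σ) ≤ ∑ σ : L, 2 * Fintype.card X := by
    refine Finset.sum_le_sum fun σ _ => ?_
    rw [card_tok]
    refine (Finset.sum_le_sum (fun x _ => kout_le D0 (s x) σ)).trans ?_
    simp [mul_comm]
  have h2 : ∑ σ : L, 2 * Fintype.card X = 2 * Fintype.card L * Fintype.card X := by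
    simp; ring
  omega

theorem kout_le_count {ι L : Type} [Fintype ι] [DecidableEq L] (D0 : Set ι) [DecidablePred (· ∈ D0)]
    (s : ι → L) (σ : L) :
    kout D0 s σ ≤ (Finset.univ.filter (fun j => j ∉ D0 ∧ s j = σ)).card := by
  unfold kout
  split_ifs with h h
  · obtain ⟨⟨i, hi⟩, ⟨j, hj⟩, hij, h1, h2⟩ := h
    have : ({i, j} : Set ι).ncard ≤ _ := Set.ncard_le_ncard (t := {j | j ∉ D0 ∧ s j = σ}) (by
      rintro x (rfl | rfl)
      · exact ⟨hi, h1⟩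
      · exact ⟨hj, h2⟩)
    rw [Set.ncard_pair (by simpa using hij)] at this
    rwa [← Set.ncard_coe_finset, Finset.coe_filter_univ]
  · obtain ⟨⟨i, hi⟩, h1⟩ := h
    exact Finset.card_pos.2 ⟨i, by simpa using ⟨hi, h1⟩⟩
  · omega

theorem kout_eq_count {ι L : Type} [Fintype ι] [DecidableEq L] (D0 : Set ι) [DecidablePred (· ∈ D0)]
    (s : ι → L) (σ : L) (h : ¬ Two (outp D0 s) σ) :
    (Finset.univ.filter (fun j => j ∉ D0 ∧ s j = σ)).card ≤ kout D0 s σ := by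
  unfold kout
  rw [if_neg h]
  split_ifs with h'
  · rw [Finset.card_le_one]
    intro a ha b hb
    simp only [Finset.mem_filter, Finset.mem_univ, true_and] at ha hb
    by_contra hab
    exact h ⟨⟨a, ha.1⟩, ⟨b, hb.1⟩, by simpa using hab, ha.2, hb.2⟩
  · simp only [nonpos_iff_eq_zero, Finset.card_eq_zero]
    ext j
    simp only [Finset.mem_filter, Finset.mem_univ, true_and, Finset.notMem_empty, iff_false]
    intro hj
    exact h' ⟨⟨j, hj.1⟩, hj.2⟩

/-! ### Zero-sum subfamilies -/

theorem zs1_aux {ι : Type} [DecidableEq ι] (b : ℕ) (S : Finset ι) (x : ι → ℤ)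
    (hb : ∀ i ∈ S, |x i| ≤ b) (h0 : ∑ i ∈ S, x i = 0) (hS : S.Nonempty) :
    ∃ T ⊆ S, T.Nonempty ∧ T.card ≤ 4 * b ^ 3 + 2 * b + 1 ∧ ∑ i ∈ T, x i = 0 := by
  classical
  by_cases hz : ∃ i ∈ S, x i = 0
  · obtain ⟨i, hi, h⟩ := hz
    exact ⟨{i}, by simpa using hi, by simp, by simp, by simpa using h⟩
  push Not at hz
  by_cases hc : S.card ≤ 4 * b ^ 3 + 2 * b + 1
  · exact ⟨S, subset_rfl, hS, hc, h0⟩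
  push Not at hc
  set A := S.filter (fun i => 0 < x i) with hA
  set B := S.filter (fun i => ¬ 0 < x i) with hB
  have hAB : A.card + B.card = S.card := Finset.card_filter_add_card_filter_not _
  have hsum : ∑ i ∈ A, x i + ∑ i ∈ B, x i = 0 := by
    rw [← h0]; exact Finset.sum_filter_add_sum_filter_not S _ _
  have hAx : ∀ i ∈ A, 1 ≤ x i ∧ x i ≤ b := by
    intro i hi
    rw [hA, Finset.mem_filter] at hi
    have := abs_le.1 (hb i hi.1)
    omega
  have hBx : ∀ i ∈ B, -(b : ℤ) ≤ x i ∧ x i ≤ -1 := by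
    intro i hi
    rw [hB, Finset.mem_filter] at hi
    have := abs_le.1 (hb i hi.1)
    have := hz i hi.1
    omega
  have hA1 : (A.card : ℤ) ≤ ∑ i ∈ A, x i := by
    have := Finset.sum_le_sum (fun i hi => (hAx i hi).1)
    simpa using this
  have hA2 : ∑ i ∈ A, x i ≤ (A.card : ℤ) * b := by
    have := Finset.sum_le_sum (fun i hi => (hAx i hi).2)
    simpa using this
  have hB1 : ∑ i ∈ B, x i ≤ -(B.card : ℤ) := by
    have := Finset.sum_le_sum (fun i hi => (hBx i hi).2)
    simpa using this
  have hB2 : -((B.card : ℤ) * b) ≤ ∑ i ∈ B, x i := by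
    have := Finset.sum_le_sum (fun i hi => (hBx i hi).1)
    simpa using this
  have hBA : B.card ≤ A.card * b := by zify; linarith
  have hAB' : A.card ≤ B.card * b := by zify; linarith
  have hbpos : 0 < b := by
    rcases Nat.eq_zero_or_pos b with rfl | h
    · simp at hBA hAB'; simp [hBA, hAB'] at hAB; omega
    · exact h
  have hAbig : b * b < A.card := by
    by_contra hh
    push Not at hh
    have h1 : B.card ≤ b * b * b := hBA.trans (Nat.mul_le_mul_right _ hh)
    have h2 : b * b ≤ b * b * b := Nat.le_mul_of_pos_right _ hbpos
    have : b ^ 3 = b * b * b := by ring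
    omega
  have hBbig : b * b < B.card := by
    by_contra hh
    push Not at hh
    have h1 : A.card ≤ b * b * b := hAB'.trans (Nat.mul_le_mul_right _ hh)
    have h2 : b * b ≤ b * b * b := Nat.le_mul_of_pos_right _ hbpos
    have : b ^ 3 = b * b * b := by ring
    omega
  obtain ⟨u, hu, hu'⟩ := Finset.exists_lt_card_fiber_of_mul_lt_card_of_maps_to
    (s := A) (t := Finset.Icc (1 : ℤ) b) (f := x) (n := b)
    (fun i hi => Finset.mem_Icc.2 (hAx i hi)) (by simpa using hAbig)
  obtain ⟨v, hv, hv'⟩ := Finset.exists_lt_card_fiber_of_mul_lt_card_of_maps_to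
    (s := B) (t := Finset.Icc (-(b : ℤ)) (-1)) (f := x) (n := b)
    (fun i hi => Finset.mem_Icc.2 (hBx i hi)) (by simpa using hBbig)
  rw [Finset.mem_Icc] at hu hv
  obtain ⟨T1, hT1, hT1c⟩ := Finset.exists_subset_card_eq (s := A.filter (fun i => x i = u))
    (n := (-v).toNat) (by omega)
  obtain ⟨T2, hT2, hT2c⟩ := Finset.exists_subset_card_eq (s := B.filter (fun i => x i = v))
    (n := u.toNat) (by omega)
  have m1 : ∀ i ∈ T1, i ∈ S ∧ x i = u := by
    intro i hi
    have := hT1 hi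
    simp only [hA, Finset.mem_filter] at this
    exact ⟨this.1.1, this.2⟩
  have m2 : ∀ i ∈ T2, i ∈ S ∧ x i = v := by
    intro i hi
    have := hT2 hi
    simp only [hB, Finset.mem_filter] at this
    exact ⟨this.1.1, this.2⟩
  have hd : Disjoint T1 T2 := by
    rw [Finset.disjoint_left]
    intro i h1 h2
    have := (m1 i h1).2
    have := (m2 i h2).2
    omega
  refine ⟨T1 ∪ T2, ?_, ?_, ?_, ?_⟩
  · intro i hi
    rcases Finset.mem_union.1 hi with h | h
    · exact (m1 i h).1
    · exact (m2 i h).1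
  · have : T1.Nonempty := Finset.card_pos.1 (by omega)
    exact this.mono Finset.subset_union_left
  · rw [Finset.card_union_of_disjoint hd]
    omega
  · rw [Finset.sum_union hd, Finset.sum_congr rfl (fun i hi => (m1 i hi).2),
      Finset.sum_congr rfl (fun i hi => (m2 i hi).2)]
    simp only [Finset.sum_const, hT1c, hT2c, nsmul_eq_mul]
    rw [Int.toNat_of_nonneg (by omega), Int.toNat_of_nonneg (by omega)]
    ring

def zM (b : ℕ) : ℕ := 4 * b ^ 3 + 2 * b + 1

theorem zs1 {ι : Type} [DecidableEq ι] (b : ℕ) (x : ι → ℤ) (S : Finset ι)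
    (hb : ∀ i ∈ S, |x i| ≤ b) (h0 : ∑ i ∈ S, x i = 0) :
    ∃ G : Finset (Finset ι), (∀ g ∈ G, g ⊆ S ∧ g.card ≤ zM b ∧ ∑ i ∈ g, x i = 0) ∧
      (G : Set (Finset ι)).PairwiseDisjoint id ∧ (∀ i ∈ S, ∃ g ∈ G, i ∈ g) := by
  classical
  induction' hn : S.card using Nat.strong_induction_on with n ih generalizing S
  rcases S.eq_empty_or_nonempty with rfl | hS
  · exact ⟨∅, by simp, by simp, by simp⟩
  obtain ⟨T, hTS, hT, hTc, hT0⟩ := zs1_aux b S x hb h0 hS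
  have hc : (S \ T).card < n := by
    rw [Finset.card_sdiff_of_subset hTS]
    have := hT.card_pos
    have := Finset.card_le_card hTS
    omega
  obtain ⟨G, hG1, hG2, hG3⟩ := ih _ hc (S \ T) (fun i hi => hb i (Finset.mem_sdiff.1 hi).1) (by
    have := Finset.sum_sdiff hTS (f := x)
    rw [hT0, h0] at this
    simpa using this) rfl
  refine ⟨insert T G, ?_, ?_, ?_⟩
  · intro g hg
    rcases Finset.mem_insert.1 hg with rfl | hg
    · exact ⟨hTS, hTc, hT0⟩
    · exact ⟨(hG1 g hg).1.trans Finset.sdiff_subset, (hG1 g hg).2⟩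
  · rw [Finset.coe_insert]
    refine hG2.insert ?_
    intro g hg _
    have := (hG1 g hg).1
    exact Finset.disjoint_of_subset_right this Finset.disjoint_sdiff
  · intro i hi
    by_cases h : i ∈ T
    · exact ⟨T, by simp, h⟩
    · obtain ⟨g, hg, hig⟩ := hG3 i (Finset.mem_sdiff.2 ⟨hi, h⟩)
      exact ⟨g, Finset.mem_insert_of_mem hg, hig⟩

def zN : ℕ → ℕ → ℕ
  | 0, _ => 1
  | k + 1, b => zM b * zN k (zM b * b)

theorem zs {κ : Type} [DecidableEq κ] (K : Finset κ) : ∀ {ι : Type} [DecidableEq ι] (b : ℕ)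
    (x : ι → κ → ℤ) (S : Finset ι) (_ : ∀ i ∈ S, ∀ c ∈ K, |x i c| ≤ b)
    (_ : ∀ c ∈ K, ∑ i ∈ S, x i c = 0) (i0 : ι) (_ : i0 ∈ S),
    ∃ T ⊆ S, i0 ∈ T ∧ T.card ≤ zN K.card b ∧ ∀ c ∈ K, ∑ i ∈ T, x i c = 0 := by
  induction K using Finset.induction_on with
  | empty =>
    intro ι _ b x S _ _ i0 h
    exact ⟨{i0}, by simpa using h, by simp, by simp [zN], by simp⟩
  | insert k K hk ih =>
    intro ι _ b x S hb h0 i0 hi0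
    obtain ⟨G, hG1, hG2, hG3⟩ := zs1 b (fun i => x i k) S (fun i hi => hb i hi k (by simp))
      (h0 k (by simp))
    obtain ⟨g0, hg0, hig0⟩ := hG3 i0 hi0
    have hSG : S = G.biUnion id := by
      ext i
      simp only [Finset.mem_biUnion, id]
      exact ⟨fun hi => hG3 i hi, fun ⟨g, hg, hi⟩ => (hG1 g hg).1 hi⟩
    obtain ⟨T, hTG, hgT, hTc, hT0⟩ := ih (zM b * b) (fun g c => ∑ i ∈ g, x i c) G (by
      intro g hg c hc
      refine (Finset.abs_sum_le_sum_abs _ _).trans ?_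
      refine (Finset.sum_le_sum (fun i hi => hb i ((hG1 g hg).1 hi) c
        (Finset.mem_insert_of_mem hc))).trans ?_
      rw [Finset.sum_const, nsmul_eq_mul]
      have := (hG1 g hg).2.1
      push_cast
      have h : (g.card : ℤ) ≤ zM b := by exact_mod_cast this
      exact mul_le_mul_of_nonneg_right h (by positivity)) (by
      intro c hc
      rw [← h0 c (Finset.mem_insert_of_mem hc), hSG, Finset.sum_biUnion hG2]
      rfl) g0 hg0
    have hdis : (T : Set (Finset ι)).PairwiseDisjoint id := hG2.subset (by simpa using hTG)
    refine ⟨T.biUnion id, ?_, ?_, ?_, ?_⟩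
    · rw [hSG]; exact Finset.biUnion_subset_biUnion_of_subset_left _ hTG
    · exact Finset.mem_biUnion.2 ⟨g0, hgT, hig0⟩
    · rw [Finset.card_insert_of_notMem hk, zN]
      refine (Finset.card_biUnion_le_card_mul _ _ _
        (fun g hg => (hG1 g (hTG hg)).2.1)).trans ?_
      rw [mul_comm]
      exact Nat.mul_le_mul_left _ hTc
    · intro c hc
      rw [Finset.sum_biUnion hdis]
      rcases Finset.mem_insert.1 hc with rfl | hc
      · exact Finset.sum_eq_zero (fun g hg => (hG1 g (hTG hg)).2.2)
      · exact hT0 c hc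

/-- many elements at once -/
theorem zsQ {κ ι : Type} [DecidableEq κ] [DecidableEq ι] (K : Finset κ) (b : ℕ)
    (x : ι → κ → ℤ) (S : Finset ι) (hb : ∀ i ∈ S, ∀ c ∈ K, |x i c| ≤ b)
    (h0 : ∀ c ∈ K, ∑ i ∈ S, x i c = 0) (Q : Finset ι) (hQ : Q ⊆ S) :
    ∃ T ⊆ S, Q ⊆ T ∧ T.card ≤ Q.card * zN K.card b ∧ ∀ c ∈ K, ∑ i ∈ T, x i c = 0 := by
  induction Q using Finset.induction_on with
  | empty => exact ⟨∅, by simp, by simp, by simp, by simp⟩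
  | insert q Q hq ih =>
    obtain ⟨T, h1, h2, h3, h4⟩ := ih ((Finset.subset_insert _ _).trans hQ)
    rw [Finset.card_insert_of_notMem hq, Nat.succ_mul]
    by_cases hqT : q ∈ T
    · exact ⟨T, h1, Finset.insert_subset hqT h2, by omega, h4⟩
    obtain ⟨T', h1', h2', h3', h4'⟩ := zs K b x (S \ T)
      (fun i hi => hb i (Finset.mem_sdiff.1 hi).1) (by
        intro c hc
        have := Finset.sum_sdiff h1 (f := fun i => x i c)
        rw [h4 c hc, h0 c hc] at this
        simpa using this) q (Finset.mem_sdiff.2 ⟨hQ (by simp), hqT⟩)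
    have hd : Disjoint T T' := Finset.disjoint_of_subset_right h1' Finset.disjoint_sdiff
    refine ⟨T ∪ T', Finset.union_subset h1 (h1'.trans Finset.sdiff_subset), ?_, ?_, ?_⟩
    · exact Finset.insert_subset (Finset.mem_union_right _ h2')
        (h2.trans Finset.subset_union_left)
    · rw [Finset.card_union_of_disjoint hd]; omega
    · intro c hc
      rw [Finset.sum_union hd, h4 c hc, h4' c hc, add_zero]

end OneVarEq

namespace OneVarEq

theorem core_loop {X K : Type} [Fintype K] (M : K → Finset X → Set X)
    (anti : ∀ κ C C', C ⊆ C' → M κ C' ⊆ M κ C) (disj : ∀ κ C x, x ∈ M κ C → x ∉ C)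
    (f : ℕ → ℕ) (hf : Monotone f) (C0 : Finset X) :
    ∃ C, C0 ⊆ C ∧ C.card ≤ (fun x => x + f x)^[Fintype.card K] C0.card ∧
      ∀ κ, (M κ C).Nonempty → ∀ F : Finset X, F.card ≤ f C.card → ∃ x ∈ M κ C, x ∉ F := by
  classical
  set g : ℕ → ℕ := fun x => x + f x with hg
  have gm : Monotone g := fun a b h => Nat.add_le_add h (hf h)
  have gi : ∀ x, x ≤ g x := fun x => Nat.le_add_right _ _
  have key : ∀ n C, (Finset.univ.filter (fun κ => (M κ C).Nonempty)).card ≤ n →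
      ∃ C', C ⊆ C' ∧ C'.card ≤ g^[n] C.card ∧
      ∀ κ, (M κ C').Nonempty → ∀ F : Finset X, F.card ≤ f C'.card → ∃ x ∈ M κ C', x ∉ F := by
    intro n
    induction n with
    | zero =>
      intro C hC
      refine ⟨C, subset_rfl, le_rfl, ?_⟩
      intro κ hκ
      have : κ ∈ Finset.univ.filter (fun κ => (M κ C).Nonempty) := by simpa using hκ
      have := Finset.card_pos.2 ⟨κ, this⟩
      omega
    | succ n ih =>
      intro C hC
      by_cases hh : ∀ κ, (M κ C).Nonempty → ∀ F : Finset X, F.card ≤ f C.card → ∃ x ∈ M κ C, x ∉ F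
      · refine ⟨C, subset_rfl, ?_, hh⟩
        exact Function.id_le_iterate_of_id_le gi (n + 1) C.card
      · push Not at hh
        obtain ⟨κ, hκ, F, hF, hsub⟩ := hh
        obtain ⟨C', h1, h2, h3⟩ := ih (C ∪ F) (by
          have : (Finset.univ.filter (fun κ => (M κ (C ∪ F)).Nonempty)) ⊂
              (Finset.univ.filter (fun κ => (M κ C).Nonempty)) := by
            rw [Finset.ssubset_iff_of_subset]
            · refine ⟨κ, by simpa using hκ, ?_⟩
              simp only [Finset.mem_filter, Finset.mem_univ, true_and]
              rintro ⟨x, hx⟩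
              have hx1 := anti κ C (C ∪ F) Finset.subset_union_left hx
              exact disj _ _ _ hx (Finset.mem_union_right _ (hsub x hx1))
            · intro κ'
              simp only [Finset.mem_filter, Finset.mem_univ, true_and]
              exact fun h => h.mono (anti κ' C (C ∪ F) Finset.subset_union_left)
          have := Finset.card_lt_card this
          omega)
        refine ⟨C', Finset.subset_union_left.trans h1, h2.trans ?_, h3⟩
        rw [Function.iterate_succ_apply]
        apply gm.iterate n
        exact (Finset.card_union_le _ _).trans (Nat.add_le_add_left hF _)
  obtain ⟨C, h⟩ := key (Fintype.card K) C0 (Finset.card_le_univ _)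
  exact ⟨C, h⟩

/-- `F` is a witness set for `s` -/
def IsWit {ι L : Type} (s : ι → L) (F : Finset ι) : Prop :=
  ∀ i, i ∉ F → ∃ a ∈ F, ∃ b ∈ F, a ≠ b ∧ s a = s i ∧ s b = s i

theorem exists_wit {ι L : Type} [Fintype L] (s : ι → L) :
    ∃ F : Finset ι, F.card ≤ 2 * Fintype.card L ∧ IsWit s F := by
  classical
  have : ∀ σ, ∃ F : Finset ι, F.card ≤ 2 ∧
      ∀ i, s i = σ → i ∉ F → ∃ a ∈ F, ∃ b ∈ F, a ≠ b ∧ s a = σ ∧ s b = σ := by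
    intro σ
    by_cases h2 : Two s σ
    · obtain ⟨a, b, hab, ha, hb⟩ := h2
      exact ⟨{a, b}, Finset.card_le_two, fun i _ _ => ⟨a, by simp, b, by simp, hab, ha, hb⟩⟩
    by_cases h1 : Occ s σ
    · obtain ⟨a, ha⟩ := h1
      refine ⟨{a}, by simp, fun i hi hia => absurd ⟨i, a, by simpa using hia, hi, ha⟩ h2⟩
    · exact ⟨∅, by simp, fun i hi _ => absurd ⟨i, hi⟩ h1⟩
  choose F hF1 hF2 using this
  refine ⟨Finset.univ.biUnion F, ?_, ?_⟩
  · refine (Finset.card_biUnion_le_card_mul _ _ 2 (fun σ _ => hF1 σ)).trans ?_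
    simp [mul_comm]
  · intro i hi
    simp only [Finset.mem_biUnion, Finset.mem_univ, true_and, not_exists] at hi
    obtain ⟨a, ha, b, hb, h⟩ := hF2 (s i) i rfl (hi _)
    exact ⟨a, Finset.mem_biUnion.2 ⟨_, by simp, ha⟩, b, Finset.mem_biUnion.2 ⟨_, by simp, hb⟩, h⟩

theorem IsWit.two {ι L : Type} {s : ι → L} {F : Finset ι} (h : IsWit s F) {i : ι} (hi : i ∉ F) :
    Two s (s i) := by
  obtain ⟨a, _, b, _, h⟩ := h i hi
  exact ⟨a, b, h⟩

theorem IsWit.mono {ι L : Type} {s : ι → L} {F F' : Finset ι} (h : IsWit s F) (hF : F ⊆ F') :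
    IsWit s F' := by
  intro i hi
  obtain ⟨a, ha, b, hb, h⟩ := h i (fun h => hi (hF h))
  exact ⟨a, hF ha, b, hF hb, h⟩

theorem IsWit.sameProf {ι A L : Type} {s : ι → L} {F : Finset ι} (h : IsWit s F) (e : A → ι)
    (inj : Function.Injective e) (hF : ∀ i ∈ F, ∃ a, e a = i) : SameProf s (fun a => s (e a)) := by
  have h2 : ∀ i, i ∉ F → Two (fun a => s (e a)) (s i) := by
    intro i hi
    obtain ⟨a, ha, b, hb, hab, h1, h2⟩ := h i hi
    obtain ⟨a, rfl⟩ := hF a ha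
    obtain ⟨b, rfl⟩ := hF b hb
    exact ⟨a, b, fun hh => hab (by rw [hh]), h1, h2⟩
  intro σ
  refine ⟨⟨?_, fun ⟨a, ha⟩ => ⟨e a, ha⟩⟩, ⟨?_, fun ⟨a, b, hab, h⟩ => ⟨e a, e b, fun hh => hab (inj hh), h⟩⟩⟩
  · rintro ⟨i, hi⟩
    by_cases hiF : i ∈ F
    · obtain ⟨a, rfl⟩ := hF i hiF
      exact ⟨a, hi⟩
    · have := (h2 i hiF).occ
      rwa [hi] at this
  · rintro ⟨i, j, hij, hi, hj⟩
    by_cases hiF : i ∈ F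
    · by_cases hjF : j ∈ F
      · obtain ⟨a, rfl⟩ := hF i hiF
        obtain ⟨b, rfl⟩ := hF j hjF
        exact ⟨a, b, fun hh => hij (by rw [hh]), hi, hj⟩
      · have := h2 j hjF
        rwa [hj] at this
    · have := h2 i hiF
      rwa [hi] at this

theorem filler_count {U V L : Type} [Fintype L] (t : U → V → L) (A : Finset U) (B : Finset V)
    (hA : 2 * Fintype.card L < A.card) (hB : A.card = B.card) :
    ∃ i ∈ A, ∃ j ∈ B, Two (t i) (t i j) ∧ Two (fun u => t u j) (t i j) := by
  classical
  by_contra hcon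
  push Not at hcon
  have h1 : ∀ i ∈ A, (B.filter (fun j => ¬ Two (t i) (t i j))).card ≤ Fintype.card L := by
    intro i _
    rw [← Finset.card_univ]
    refine Finset.card_le_card_of_injOn (t i) (fun _ _ => by simp) ?_
    intro j hj j' hj' h
    simp only [Finset.coe_filter, Set.mem_ofPred_eq] at hj hj'
    by_contra hne
    exact hj.2 ⟨j, j', hne, rfl, h.symm⟩
  have h2 : ∀ j ∈ B, (A.filter (fun i => ¬ Two (fun u => t u j) (t i j))).card ≤ Fintype.card L := by
    intro j _
    rw [← Finset.card_univ]
    refine Finset.card_le_card_of_injOn (fun u => t u j) (fun _ _ => by simp) ?_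
    intro i hi i' hi' h
    simp only [Finset.coe_filter, Set.mem_ofPred_eq] at hi hi'
    by_contra hne
    exact hi.2 ⟨i, i', hne, rfl, h.symm⟩
  have hsub : ∑ i ∈ A, B.card ≤ ∑ i ∈ A, (B.filter (fun j => ¬ Two (t i) (t i j))).card +
      ∑ j ∈ B, (A.filter (fun i => ¬ Two (fun u => t u j) (t i j))).card := by
    have e : ∑ j ∈ B, (A.filter (fun i => ¬ Two (fun u => t u j) (t i j))).card =
        ∑ i ∈ A, (B.filter (fun j => ¬ Two (fun u => t u j) (t i j))).card := by
      simp only [Finset.card_filter]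
      rw [Finset.sum_comm]
    rw [e, ← Finset.sum_add_distrib]
    refine Finset.sum_le_sum fun i hi => ?_
    rw [← Finset.card_filter_add_card_filter_not (s := B) (fun j => ¬ Two (t i) (t i j))]
    apply Nat.add_le_add_left
    apply Finset.card_le_card
    intro j hj
    simp only [Finset.mem_filter, not_not] at hj ⊢
    exact ⟨hj.1, hcon i hi j hj.1 hj.2⟩
  have b1 := Finset.sum_le_sum h1
  have b2 := Finset.sum_le_sum h2
  simp only [Finset.sum_const, smul_eq_mul] at b1 b2 hsub
  rw [← hB] at *
  have : A.card * A.card ≤ A.card * (2 * Fintype.card L) := by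
    calc _ ≤ _ := hsub
      _ ≤ _ := Nat.add_le_add b1 b2
      _ = _ := by ring
  have := Nat.le_of_mul_le_mul_left this (by omega)
  omega

def prof {ι L : Type} (s : ι → L) : Set L × Set L := ({σ | Occ s σ}, {σ | Two s σ})

theorem prof_eq {ι ι' L : Type} {s : ι → L} {s' : ι' → L} (h : prof s = prof s') :
    SameProf s s' := by
  intro σ
  have h1 := congrArg Prod.fst h
  have h2 := congrArg Prod.snd h
  exact ⟨Set.ext_iff.1 h1 σ, Set.ext_iff.1 h2 σ⟩

abbrev CK (L : Type) := Bool × ((L × Bool) ⊕ (Set L × Set L))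

def corePred {U V L : Type} (t : U → V → L) (D0 : Set V) (i : U) :
    ((L × Bool) ⊕ (Set L × Set L)) → Prop
  | .inl (σ, false) => Occ (outp D0 (t i)) σ
  | .inl (σ, true) => Two (outp D0 (t i)) σ
  | .inr p => prof (t i) = p

theorem corePred_anti {U V L : Type} (t : U → V → L) {D0 D0' : Set V} (h : D0 ⊆ D0') (i : U) (k)
    (hk : corePred t D0' i k) : corePred t D0 i k := by
  rcases k with ⟨σ, _ | _⟩ | p
  · obtain ⟨⟨j, hj⟩, h'⟩ := hk
    exact ⟨⟨j, fun hh => hj (h hh)⟩, h'⟩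
  · obtain ⟨⟨j, hj⟩, ⟨j', hj'⟩, hne, h', h''⟩ := hk
    exact ⟨⟨j, fun hh => hj (h hh)⟩, ⟨j', fun hh => hj' (h hh)⟩, by simpa using hne, h', h''⟩
  · exact hk

/-- a row class is large -/
def RowsBig {U V L : Type} (t : U → V → L) (W0 : Set U) (D0 : Set V) (n : ℕ) : Prop :=
  ∀ i, i ∉ W0 → ∀ k, corePred t D0 i k → ∀ F : Finset U, F.card ≤ n →
    ∃ i', i' ∉ W0 ∧ i' ∉ F ∧ corePred t D0 i' k

noncomputable def coreBd (f : ℕ → ℕ) (ℓ : ℕ) : ℕ :=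
  (fun x => x + f x)^[2 * (ℓ * 2 + 2 ^ ℓ * 2 ^ ℓ)] 2

theorem core_exists {U V L : Type} [Fintype L] (t : U → V → L) (u0 : U) (v0 : V)
    (f : ℕ → ℕ) (hf : Monotone f) :
    ∃ (W0 : Finset U) (D0 : Finset V), u0 ∈ W0 ∧ v0 ∈ D0 ∧
      W0.card + D0.card ≤ coreBd f (Fintype.card L) ∧
      RowsBig t W0 D0 (f (W0.card + D0.card)) ∧
      RowsBig (fun v u => t u v) D0 W0 (f (W0.card + D0.card)) := by
  classical
  let M : CK L → Finset (U ⊕ V) → Set (U ⊕ V) := fun κ C =>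
    match κ with
    | (false, k) => {x | x ∉ C ∧ ∃ i, x = .inl i ∧ corePred t {j | Sum.inr j ∈ C} i k}
    | (true, k) => {x | x ∉ C ∧ ∃ j, x = .inr j ∧
        corePred (fun v u => t u v) {i | Sum.inl i ∈ C} j k}
  obtain ⟨C, hC0, hCc, hC⟩ := core_loop M (by
      rintro ⟨_ | _, k⟩ C C' hCC x ⟨hx, i, rfl, hi⟩
      · exact ⟨fun h => hx (hCC h), i, rfl, corePred_anti t (D0 := {j | Sum.inr j ∈ C}) (D0' := {j | Sum.inr j ∈ C'}) (fun j hj => hCC hj) _ _ hi⟩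
      · exact ⟨fun h => hx (hCC h), i, rfl, corePred_anti _ (D0 := {j | Sum.inl j ∈ C}) (D0' := {j | Sum.inl j ∈ C'}) (fun j hj => hCC hj) _ _ hi⟩) (by
      rintro ⟨_ | _, k⟩ C x hx
      · exact hx.1
      · exact hx.1) f hf {.inl u0, .inr v0}
  let W0 := C.toLeft
  let D0 := C.toRight
  have hcard : W0.card + D0.card = C.card := Finset.card_toLeft_add_card_toRight
  have hcardK : Fintype.card (CK L) = 2 * (Fintype.card L * 2 +
      2 ^ Fintype.card L * 2 ^ Fintype.card L) := by
    simp [CK]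
  have eD : (D0 : Set V) = {j | Sum.inr j ∈ C} := by ext j; simp [D0]
  have eW : (W0 : Set U) = {j | Sum.inl j ∈ C} := by ext j; simp [W0]
  refine ⟨W0, D0, ?_, ?_, ?_, ?_, ?_⟩
  · exact Finset.mem_toLeft.2 (hC0 (by simp))
  · exact Finset.mem_toRight.2 (hC0 (by simp))
  · rw [hcard, coreBd, ← hcardK]
    convert hCc using 2
    simp
  · intro i hi k hk F hF
    rw [eD] at hk ⊢
    rw [eW] at hi ⊢
    obtain ⟨x, ⟨hx1, i', rfl, hi'⟩, hxF⟩ := hC (false, k) ⟨.inl i, hi, i, rfl, hk⟩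
      (F.map Function.Embedding.inl) (by rw [Finset.card_map, ← hcard]; exact hF)
    exact ⟨i', hx1, by simpa using hxF, hi'⟩
  · intro i hi k hk F hF
    rw [eD] at hi ⊢
    rw [eW] at hk ⊢
    obtain ⟨x, ⟨hx1, i', rfl, hi'⟩, hxF⟩ := hC (true, k) ⟨.inr i, hi, i, rfl, hk⟩
      (F.map Function.Embedding.inr) (by rw [Finset.card_map, ← hcard]; exact hF)
    exact ⟨i', hx1, by simpa using hxF, hi'⟩

theorem RowsBig.many {U V L : Type} {t : U → V → L} {W0 : Set U} {D0 : Set V} {n : ℕ}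
    (h : RowsBig t W0 D0 n) {i : U} (hi : i ∉ W0) (m : ℕ) (hm : m ≤ n + 1) :
    ∃ F : Finset U, F.card = m ∧ ∀ i' ∈ F, i' ∉ W0 ∧ SameProf (t i) (t i') := by
  classical
  induction m with
  | zero => exact ⟨∅, rfl, by simp⟩
  | succ m ih =>
    obtain ⟨F, hF, hF'⟩ := ih (by omega)
    obtain ⟨i', h1, h2, h3⟩ := h i hi (.inr (prof (t i))) rfl F (by omega)
    refine ⟨insert i' F, by rw [Finset.card_insert_of_notMem h2, hF], ?_⟩
    intro x hx
    rcases Finset.mem_insert.1 hx with rfl | hx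
    · exact ⟨h1, prof_eq h3.symm⟩
    · exact hF' x hx

theorem filler_exists {U V L : Type} [Fintype L] {t : U → V → L} {W0 : Set U} {D0 : Set V} {n : ℕ}
    (h : RowsBig t W0 D0 n) (h' : RowsBig (fun v u => t u v) D0 W0 n)
    (hn : 2 * Fintype.card L ≤ n) {i : U} (hi : i ∉ W0) {j : V} (hj : j ∉ D0) :
    ∃ σ, Two (t i) σ ∧ Two (fun u => t u j) σ := by
  obtain ⟨A, hA, hA'⟩ := h.many hi (2 * Fintype.card L + 1) (by omega)
  obtain ⟨B, hB, hB'⟩ := h'.many hj (2 * Fintype.card L + 1) (by omega)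
  obtain ⟨i', hi', j', hj', h1, h2⟩ := filler_count t A B (by omega) (by omega)
  exact ⟨_, ((hA' i' hi').2 _).2.2 h1, ((hB' j' hj').2 _).2.2 h2⟩

end OneVarEq

namespace OneVarEq

open Classical in
theorem zero_card {A B ZR ZC : Type} [Fintype A] [Fintype B] [Fintype ZR] [Fintype ZC]
    (S : Finset ((A ⊕ B) ⊕ (ZR ⊕ ZC))) (kA : A → ℕ) (kB : B → ℕ) (pR : ZR → Prop) (pC : ZC → Prop)
    (hz : ∑ e ∈ S, (Sum.elim (Sum.elim (fun a => (kA a : ℤ)) (fun b => -(kB b : ℤ)))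
      (Sum.elim (fun z => if pR z then 1 else 0) (fun z => -(if pC z then 1 else 0)))) e = 0) :
    ∑ x : {a // Sum.inl (Sum.inl a) ∈ S}, kA x +
      Nat.card {z : {z // Sum.inr (Sum.inl z) ∈ S} // pR z} =
    ∑ x : {a // Sum.inl (Sum.inr a) ∈ S}, kB x +
      Nat.card {z : {z // Sum.inr (Sum.inr z) ∈ S} // pC z} := by
  have hsub : ∀ {A : Type} [Fintype A] (p : A → Prop) [Fintype {a // p a}] (f : A → ℕ),
      ∑ x : {a // p a}, f x = ∑ a, if p a then f a else 0 := by
    intro A _ p _ f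
    rw [← Finset.sum_filter]
    exact (Finset.sum_subtype (Finset.univ.filter p) (by simp) f).symm
  have hcard : ∀ {A : Type} [Fintype A] (p q : A → Prop),
      Nat.card {z : {z // p z} // q z} = ∑ a, if p a then (if q a then 1 else 0) else 0 := by
    intro A _ p q
    rw [Nat.card_eq_fintype_card, Fintype.card_subtype, Finset.card_filter,
      hsub p (fun a => if q a then 1 else 0)]
  rw [hsub (fun a => Sum.inl (Sum.inl a) ∈ S), hsub (fun a => Sum.inl (Sum.inr a) ∈ S),
    hcard (fun a => Sum.inr (Sum.inl a) ∈ S), hcard (fun a => Sum.inr (Sum.inr a) ∈ S)]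
  rw [← Finset.sum_ite_mem_eq] at hz
  simp only [Fintype.sum_sum_type, Sum.elim_inl, Sum.elim_inr] at hz
  apply Nat.cast_injective (R := ℤ)
  have hneg : ∀ (p : Prop) [Decidable p] (x : ℤ), (if p then -x else 0) = -(if p then x else 0) := by
    intro p _ x; split_ifs <;> simp
  simp only [hneg, Finset.sum_neg_distrib] at hz
  push_cast
  linarith

open Classical in
noncomputable def evec {U V L ZR ZC : Type} (t : U → V → L) (W0 : Set U) (D0 : Set V)
    (zr : ZR → L) (zc : ZC → L) (e : ({u // u ∉ W0} ⊕ {v // v ∉ D0}) ⊕ (ZR ⊕ ZC)) (σ : L) : ℤ :=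
  (Sum.elim (Sum.elim (fun a => (kout D0 (t a.1) σ : ℤ)) (fun b => -(kout W0 (fun u => t u b.1) σ : ℤ)))
      (Sum.elim (fun z => if zr z = σ then 1 else 0) (fun z => -(if zc z = σ then 1 else 0)))) e

theorem evec_abs {U V L ZR ZC : Type} (t : U → V → L) (W0 : Set U) (D0 : Set V)
    (zr : ZR → L) (zc : ZC → L) (e : ({u // u ∉ W0} ⊕ {v // v ∉ D0}) ⊕ (ZR ⊕ ZC)) (σ : L) :
    |evec t W0 D0 zr zc e σ| ≤ ((2 : ℕ) : ℤ) := by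
  rcases e with (e | e) | (e | e)
  · have := kout_le D0 (t e.1) σ
    simp only [evec, Sum.elim_inl]
    rw [abs_of_nonneg (by positivity)]
    exact_mod_cast this
  · have := kout_le W0 (fun u => t u e.1) σ
    simp only [evec, Sum.elim_inl, Sum.elim_inr]
    rw [abs_neg, abs_of_nonneg (by positivity)]
    exact_mod_cast this
  · simp only [evec, Sum.elim_inl, Sum.elim_inr]
    split_ifs <;> simp
  · simp only [evec, Sum.elim_inr]
    split_ifs <;> simp

theorem edges_of_zero {U V L ZR ZC : Type} [Fintype U] [Fintype V] [Fintype L] [Fintype ZR]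
    [Fintype ZC] (t : U → V → L) (W0 : Set U) (D0 : Set V)
    (zr : ZR → L) (zc : ZC → L) (S : Finset (({u // u ∉ W0} ⊕ {v // v ∉ D0}) ⊕ (ZR ⊕ ZC)))
    (hz : ∀ σ, ∑ e ∈ S, evec t W0 D0 zr zc e σ = 0)
    (hR : ∀ z, Sum.inr (Sum.inl z) ∈ S → ∃ u : {u : {u // u ∉ W0} // Sum.inl (Sum.inl u) ∈ S},
      Two (outp D0 (t u.1.1)) (zr z))
    (hC : ∀ z, Sum.inr (Sum.inr z) ∈ S → ∃ v : {v : {v // v ∉ D0} // Sum.inl (Sum.inr v) ∈ S},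
      Two (outp W0 (fun u => t u v.1.1)) (zc z)) :
    ∃ (E : Type) (_ : Fintype E) (er : E → {u : {u // u ∉ W0} // Sum.inl (Sum.inl u) ∈ S})
      (ec : E → {v : {v // v ∉ D0} // Sum.inl (Sum.inr v) ∈ S}) (el : E → L),
      Fintype.card E ≤ (2 * Fintype.card L + 1) * S.card ∧
      (∀ x, SameProf (outp D0 (t x.1.1)) (fun e : {e // er e = x} => el e)) ∧
      (∀ y, SameProf (outp W0 (fun u => t u y.1.1)) (fun e : {e // ec e = y} => el e)) := by
  classical
  choose aR haR using hR
  choose aC haC using hC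
  obtain ⟨ec, hec⟩ := edge_sys D0 W0
    (fun x : {u : {u // u ∉ W0} // Sum.inl (Sum.inl u) ∈ S} => t x.1.1)
    (fun y : {v : {v // v ∉ D0} // Sum.inl (Sum.inr v) ∈ S} => fun u => t u y.1.1)
    (fun z : {z // Sum.inr (Sum.inl z) ∈ S} => zr z.1)
    (fun z : {z // Sum.inr (Sum.inr z) ∈ S} => zc z.1)
    (fun z => aC z.1 z.2) (fun z => haC z.1 z.2) (by
      intro σ
      refine ⟨((rtFiberEquiv _ _ _ _).trans (Finite.card_eq.1 ?_).some).trans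
        (rtFiberEquiv _ _ _ _).symm⟩
      rw [Nat.card_sum, Nat.card_sum, card_tok, card_tok]
      convert zero_card S (fun a => kout D0 (t a.1) σ) (fun b => kout W0 (fun u => t u b.1) σ)
        (fun z => zr z = σ) (fun z => zc z = σ) (hz σ))
  have hfin : Finite (RTok D0 (fun x : {u : {u // u ∉ W0} // Sum.inl (Sum.inl u) ∈ S} => t x.1.1)
    {z // Sum.inr (Sum.inl z) ∈ S}) := inferInstance
  refine ⟨_, Fintype.ofFinite (RTok D0 (fun x : {u : {u // u ∉ W0} // Sum.inl (Sum.inl u) ∈ S} =>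
    t x.1.1) {z // Sum.inr (Sum.inl z) ∈ S}), rtEnd (fun z => aR z.1 z.2), ec,
    rtLet (fun z => zr z.1), ?_, ?_, hec⟩
  · have h1 := card_rtok_le (S := {z // Sum.inr (Sum.inl z) ∈ S}) D0
      (fun x : {u : {u // u ∉ W0} // Sum.inl (Sum.inl u) ∈ S} => t x.1.1)
    have h2 : Fintype.card {u : {u // u ∉ W0} // Sum.inl (Sum.inl u) ∈ S} ≤ S.card := by
      rw [← Fintype.card_coe S]
      refine Fintype.card_le_of_injective (fun x => ⟨.inl (.inl x.1), x.2⟩) ?_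
      intro x y h
      simpa [Subtype.ext_iff] using h
    have h3 : Nat.card {z // Sum.inr (Sum.inl z) ∈ S} ≤ S.card := by
      rw [Nat.card_eq_fintype_card, ← Fintype.card_coe S]
      refine Fintype.card_le_of_injective (fun x => ⟨.inr (.inl x.1), x.2⟩) ?_
      intro x y h
      simpa [Subtype.ext_iff] using h
    rw [Fintype.card_eq_nat_card]
    refine h1.trans ?_
    have := Nat.mul_le_mul_left (2 * Fintype.card L) h2
    rw [Nat.add_mul, Nat.one_mul]
    omega
  · exact tok_prof D0 _ _ _ (fun z => haR z.1 z.2)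

end OneVarEq

namespace OneVarEq

theorem pick_fin {A L : Type} [Fintype L] (p : A → L → Prop) :
    ∃ F : Finset A, F.card ≤ Fintype.card L ∧ ∀ σ, (∃ a, p a σ) → ∃ a ∈ F, p a σ := by
  classical
  have : ∀ σ, ∃ F : Finset A, F.card ≤ 1 ∧ ((∃ a, p a σ) → ∃ a ∈ F, p a σ) := by
    intro σ
    by_cases h : ∃ a, p a σ
    · obtain ⟨a, ha⟩ := h
      exact ⟨{a}, by simp, fun _ => ⟨a, by simp, ha⟩⟩
    · exact ⟨∅, by simp, fun h' => absurd h' h⟩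
  choose F h1 h2 using this
  refine ⟨Finset.univ.biUnion F, ?_, ?_⟩
  · refine (Finset.card_biUnion_le_card_mul _ _ 1 (fun σ _ => h1 σ)).trans ?_
    simp
  · intro σ h
    obtain ⟨a, ha, hp⟩ := h2 σ h
    exact ⟨a, Finset.mem_biUnion.2 ⟨σ, by simp, ha⟩, hp⟩

def finN1 (ℓ c : ℕ) : ℕ := (2 * ℓ * c + 2 * ℓ) * zN ℓ 2
def finN2 (ℓ : ℕ) : ℕ := 3 * ℓ * zN ℓ 2
def finF (ℓ c : ℕ) : ℕ := finN1 ℓ c + 2 * ℓ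

theorem finN1_mono (ℓ : ℕ) : Monotone (finN1 ℓ) := by
  intro a b h
  unfold finN1
  gcongr

theorem finF_mono (ℓ : ℕ) : Monotone (finF ℓ) := by
  intro a b h
  unfold finF
  have := finN1_mono ℓ h
  omega

noncomputable def finBd (ℓ : ℕ) : ℕ :=
  coreBd (finF ℓ) ℓ + (finN1 ℓ (coreBd (finF ℓ) ℓ) +
    finN2 ℓ * (((2 * ℓ + 1) * finN1 ℓ (coreBd (finF ℓ) ℓ)) * 2 ^ ((2 * ℓ + 1) * finN2 ℓ)))

open Classical in
theorem slack_exists {U V L : Type} [Fintype U] [Fintype V] (t : U → V → L)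
    (W0 : Set U) (D0 : Set V) (σ : L) :
    ∃ sR sC : ℕ, (∑ u : {u // u ∉ W0}, kout D0 (t u.1) σ) + sR =
        (∑ v : {v // v ∉ D0}, kout W0 (fun u => t u v.1) σ) + sC ∧
      (0 < sR → ∃ u : {u // u ∉ W0}, Two (outp D0 (t u.1)) σ) ∧
      (0 < sC → ∃ v : {v // v ∉ D0}, Two (outp W0 (fun u => t u v.1)) σ) := by
  classical
  let cR : {u // u ∉ W0} → ℕ := fun u => (Finset.univ.filter (fun j => j ∉ D0 ∧ t u.1 j = σ)).card
  let cC : {v // v ∉ D0} → ℕ := fun v => (Finset.univ.filter (fun i => i ∉ W0 ∧ t i v.1 = σ)).card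
  have e : ∑ u, cR u = ∑ v, cC v := by
    have h1 : ∀ u, cR u = ∑ v : {v // v ∉ D0}, if t u.1 v.1 = σ then 1 else 0 := by
      intro u
      rw [← Finset.card_filter]
      refine (Finset.card_nbij (fun v : {v // v ∉ D0} => v.1) ?_ ?_ ?_).symm
      · intro v hv
        simpa using ⟨v.2, by simpa using hv⟩
      · intro a _ b _ h; exact Subtype.ext h
      · intro v hv
        simp only [Finset.coe_filter, Finset.mem_univ, true_and, Set.mem_ofPred_eq] at hv
        exact ⟨⟨v, hv.1⟩, by simpa using hv.2, rfl⟩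
    have h2 : ∀ v, cC v = ∑ u : {u // u ∉ W0}, if t u.1 v.1 = σ then 1 else 0 := by
      intro u
      rw [← Finset.card_filter]
      refine (Finset.card_nbij (fun v : {v // v ∉ W0} => v.1) ?_ ?_ ?_).symm
      · intro v hv
        simpa using ⟨v.2, by simpa using hv⟩
      · intro a _ b _ h; exact Subtype.ext h
      · intro v hv
        simp only [Finset.coe_filter, Finset.mem_univ, true_and, Set.mem_ofPred_eq] at hv
        exact ⟨⟨v, hv.1⟩, by simpa using hv.2, rfl⟩
    simp only [h1, h2]
    exact Finset.sum_comm
  have l1 : ∑ u : {u // u ∉ W0}, kout D0 (t u.1) σ ≤ ∑ u, cR u :=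
    Finset.sum_le_sum fun u _ => kout_le_count _ _ _
  have l2 : ∑ v : {v // v ∉ D0}, kout W0 (fun u => t u v.1) σ ≤ ∑ v, cC v :=
    Finset.sum_le_sum fun u _ => kout_le_count W0 _ _
  refine ⟨∑ u, cR u - ∑ u : {u // u ∉ W0}, kout D0 (t u.1) σ,
    ∑ v, cC v - ∑ v : {v // v ∉ D0}, kout W0 (fun u => t u v.1) σ, by omega, ?_, ?_⟩
  · intro h
    by_contra hh
    push Not at hh
    have : ∑ u, cR u ≤ ∑ u : {u // u ∉ W0}, kout D0 (t u.1) σ :=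
      Finset.sum_le_sum fun u _ => kout_eq_count _ _ _ (hh u)
    omega
  · intro h
    by_contra hh
    push Not at hh
    have : ∑ v, cC v ≤ ∑ v : {v // v ∉ D0}, kout W0 (fun u => t u v.1) σ :=
      Finset.sum_le_sum fun v _ => kout_eq_count W0 _ _ (hh v)
    omega

theorem card_sub_le {A B : Type} [Fintype A] (S : Finset B) (g : A → B) (hg : Function.Injective g)
    [Fintype {a // g a ∈ S}] : Fintype.card {a // g a ∈ S} ≤ S.card := by
  rw [← Fintype.card_coe S]
  refine Fintype.card_le_of_injective (fun x => ⟨g x.1, x.2⟩) ?_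
  intro x y h
  exact Subtype.ext (hg (by simpa [Subtype.ext_iff] using h))

theorem fin_bound {U V L : Type} [Fintype U] [Fintype V] [Fintype L] (t : U → V → L)
    (u0 : U) (v0 : V) :
    ∃ (U' V' : Type) (_ : Fintype U') (_ : Fintype V') (T : U' → V' → L),
      Fintype.card U' ≤ finBd (Fintype.card L) ∧ Fintype.card V' ≤ finBd (Fintype.card L) ∧
      (∀ u', ∃ u, SameProf (t u) (T u')) ∧
      (∀ v', ∃ v, SameProf (fun u => t u v) (fun u' => T u' v')) ∧
      ∃ u' v', T u' v' = t u0 v0 := by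
  classical
  set ℓ := Fintype.card L with hℓ
  obtain ⟨W0f, D0f, hu0, hv0, hc, bigR, bigC⟩ := core_exists t u0 v0 (finF ℓ) (finF_mono ℓ)
  set c := W0f.card + D0f.card with hcdef
  rw [← hℓ] at hc
  obtain ⟨W0, hW0⟩ : ∃ W0 : Set U, W0 = W0f := ⟨_, rfl⟩
  obtain ⟨D0, hD0⟩ : ∃ D0 : Set V, D0 = D0f := ⟨_, rfl⟩
  rw [← hW0, ← hD0] at bigR bigC
  choose wr hwr1 hwr2 using fun u => exists_wit (t u)
  choose wc hwc1 hwc2 using fun v => exists_wit (fun u => t u v)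
  have hSA : (D0f.biUnion wc).card ≤ D0f.card * (2 * ℓ) :=
    Finset.card_biUnion_le_card_mul _ _ _ (fun v _ => hwc1 v)
  have hSC : (W0f.biUnion wr).card ≤ W0f.card * (2 * ℓ) :=
    Finset.card_biUnion_le_card_mul _ _ _ (fun v _ => hwr1 v)
  set SA := D0f.biUnion wc
  set SC := W0f.biUnion wr
  choose sR sC hs hsR hsC using slack_exists t W0 D0
  let ZR := Σ σ, Fin (sR σ)
  let ZC := Σ σ, Fin (sC σ)
  let zr : ZR → L := fun z => z.1
  let zc : ZC → L := fun z => z.1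
  let El := ({u // u ∉ W0} ⊕ {v // v ∉ D0}) ⊕ (ZR ⊕ ZC)
  have htot : ∀ σ, ∑ e : El, evec t W0 D0 zr zc e σ = 0 := by
    intro σ
    have hh := hs σ
    zify at hh
    simp only [El, Fintype.sum_sum_type, evec, Sum.elim_inl, Sum.elim_inr, Finset.sum_neg_distrib]
    have h0 : ∀ s : L → ℕ, ∑ z : (Σ σ, Fin (s σ)), (if z.1 = σ then (1 : ℤ) else 0) = s σ := by
      intro s
      rw [Fintype.sum_sigma]
      have : ∀ x, ∑ _y : Fin (s x), (if x = σ then (1 : ℤ) else 0) =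
          if x = σ then (s x : ℤ) else 0 := by
        intro x; split_ifs <;> simp
      simp only [this]
      simp
    have h1 : ∑ z : ZR, (if zr z = σ then (1 : ℤ) else 0) = sR σ := h0 sR
    have h2 : ∑ z : ZC, (if zc z = σ then (1 : ℤ) else 0) = sC σ := h0 sC
    rw [h1, h2]
    linarith
  -- first set
  obtain ⟨pR, hpR, hpR'⟩ := pick_fin (fun (u : {u // u ∉ W0}) σ => Two (outp D0 (t u.1)) σ)
  obtain ⟨pC, hpC, hpC'⟩ := pick_fin
    (fun (v : {v // v ∉ D0}) σ => Two (outp W0 (fun u => t u v.1)) σ)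
  let iR : {u // u ∉ W0} → El := fun u => .inl (.inl u)
  let iC : {v // v ∉ D0} → El := fun v => .inl (.inr v)
  have iRi : Function.Injective iR := fun a b h => Sum.inl.inj (Sum.inl.inj h)
  have iCi : Function.Injective iC := fun a b h => Sum.inr.inj (Sum.inl.inj h)
  let Q1 : Finset El := ((SA.subtype (· ∉ W0)).image iR ∪ (SC.subtype (· ∉ D0)).image iC) ∪
    (pR.image iR ∪ pC.image iC)
  have hQ1 : Q1.card ≤ 2 * ℓ * c + 2 * ℓ := by
    refine (Finset.card_union_le _ _).trans ?_
    have a1 : ((SA.subtype (· ∉ W0)).image iR).card ≤ D0f.card * (2 * ℓ) :=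
      Finset.card_image_le.trans (((Finset.card_subtype _ _).le.trans
        (Finset.card_filter_le _ _)).trans hSA)
    have a2 : ((SC.subtype (· ∉ D0)).image iC).card ≤ W0f.card * (2 * ℓ) :=
      Finset.card_image_le.trans (((Finset.card_subtype _ _).le.trans
        (Finset.card_filter_le _ _)).trans hSC)
    have a3 : (pR.image iR).card ≤ ℓ := Finset.card_image_le.trans hpR
    have a4 : (pC.image iC).card ≤ ℓ := Finset.card_image_le.trans hpC
    have b1 := Finset.card_union_le ((SA.subtype (· ∉ W0)).image iR) ((SC.subtype (· ∉ D0)).image iC)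
    have b2 := Finset.card_union_le (pR.image iR) (pC.image iC)
    have : 2 * ℓ * c = D0f.card * (2 * ℓ) + W0f.card * (2 * ℓ) := by rw [hcdef]; ring
    omega
  obtain ⟨S1, -, hQS1, hS1c, hS1z⟩ := zsQ Finset.univ 2 (fun e : El => evec t W0 D0 zr zc e)
    Finset.univ (fun e _ σ _ => evec_abs _ _ _ _ _ _ _) (fun σ _ => htot σ) Q1
    (Finset.subset_univ _)
  rw [Finset.card_univ, ← hℓ] at hS1c
  have hS1 : S1.card ≤ finN1 ℓ c := hS1c.trans (Nat.mul_le_mul_right _ hQ1)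
  have hn : finN1 ℓ c ≤ finF ℓ c := Nat.le_add_right _ _
  have avR : ∀ u, u ∉ W0 → ∀ k, corePred t D0 u k →
      ∃ u' : {u // u ∉ W0}, iR u' ∉ S1 ∧ corePred t D0 u'.1 k := by
    intro u hu k hk
    let F : Finset U := (Finset.univ.filter (fun u : {u // u ∉ W0} => iR u ∈ S1)).image Subtype.val
    have hF : F.card ≤ finF ℓ c := by
      refine (Finset.card_image_le.trans ?_).trans (hS1.trans hn)
      exact Finset.card_le_card_of_injOn iR (fun x hx => by simpa using hx) iRi.injOn
    obtain ⟨u', h1, h2, h3⟩ := bigR u hu k hk F hF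
    refine ⟨⟨u', h1⟩, fun h => h2 ?_, h3⟩
    exact Finset.mem_image.2 ⟨⟨u', h1⟩, by simpa using h, rfl⟩
  have avC : ∀ u, u ∉ D0 → ∀ k, corePred (fun v u => t u v) W0 u k →
      ∃ u' : {u // u ∉ D0}, iC u' ∉ S1 ∧ corePred (fun v u => t u v) W0 u'.1 k := by
    intro u hu k hk
    let F : Finset V := (Finset.univ.filter (fun u : {u // u ∉ D0} => iC u ∈ S1)).image Subtype.val
    have hF : F.card ≤ finF ℓ c := by
      refine (Finset.card_image_le.trans ?_).trans (hS1.trans hn)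
      exact Finset.card_le_card_of_injOn iC (fun x hx => by simpa using hx) iCi.injOn
    obtain ⟨u', h1, h2, h3⟩ := bigC u hu k hk F hF
    refine ⟨⟨u', h1⟩, fun h => h2 ?_, h3⟩
    exact Finset.mem_image.2 ⟨⟨u', h1⟩, by simpa using h, rfl⟩
  -- second set
  obtain ⟨qO, hqO, hqO'⟩ := pick_fin
    (fun (u : {u // u ∉ W0}) σ => iR u ∉ S1 ∧ Occ (outp D0 (t u.1)) σ)
  obtain ⟨qR, hqR, hqR'⟩ := pick_fin
    (fun (u : {u // u ∉ W0}) σ => iR u ∉ S1 ∧ Two (outp D0 (t u.1)) σ)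
  obtain ⟨qC, hqC, hqC'⟩ := pick_fin
    (fun (v : {v // v ∉ D0}) σ => iC v ∉ S1 ∧ Two (outp W0 (fun u => t u v.1)) σ)
  let Q2 : Finset El := ((qO.image iR ∪ qR.image iR) ∪ qC.image iC) \ S1
  have hQ2 : Q2.card ≤ 3 * ℓ := by
    refine (Finset.card_le_card Finset.sdiff_subset).trans ((Finset.card_union_le _ _).trans ?_)
    have a1 : (qO.image iR).card ≤ ℓ := Finset.card_image_le.trans hqO
    have a3 : (qR.image iR).card ≤ ℓ := Finset.card_image_le.trans hqR
    have a4 : (qC.image iC).card ≤ ℓ := Finset.card_image_le.trans hqC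
    have b2 := Finset.card_union_le (qO.image iR) (qR.image iR)
    omega
  obtain ⟨S2, hS2S, hQS2, hS2c, hS2z⟩ := zsQ Finset.univ 2 (fun e : El => evec t W0 D0 zr zc e)
    (Finset.univ \ S1) (fun e _ σ _ => evec_abs _ _ _ _ _ _ _) (fun σ hσ => by
      have := Finset.sum_sdiff (Finset.subset_univ S1) (f := fun e : El => evec t W0 D0 zr zc e σ)
      rw [hS1z σ hσ, htot σ] at this
      simpa using this) Q2 (Finset.sdiff_subset_sdiff (Finset.subset_univ _) subset_rfl)
  rw [Finset.card_univ, ← hℓ] at hS2c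
  have hS2 : S2.card ≤ finN2 ℓ := hS2c.trans (Nat.mul_le_mul_right _ hQ2)
  have hdis : ∀ e, e ∈ S2 → e ∉ S1 := fun e he => (Finset.mem_sdiff.1 (hS2S he)).2
  -- edges
  obtain ⟨P, _, pr, pc, pl, hPc, hPr, hPcol⟩ := edges_of_zero t W0 D0 zr zc S1
    (fun σ => hS1z σ (by simp)) (by
      rintro ⟨σ, k⟩ hz
      obtain ⟨u, hu, h⟩ := hpR' σ (hsR σ (lt_of_le_of_lt (Nat.zero_le _) k.2))
      refine ⟨⟨u, hQS1 ?_⟩, h⟩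
      exact Finset.mem_union_right _ (Finset.mem_union_left _ (Finset.mem_image_of_mem iR hu))) (by
      rintro ⟨σ, k⟩ hz
      obtain ⟨u, hu, h⟩ := hpC' σ (hsC σ (lt_of_le_of_lt (Nat.zero_le _) k.2))
      refine ⟨⟨u, hQS1 ?_⟩, h⟩
      exact Finset.mem_union_right _ (Finset.mem_union_right _ (Finset.mem_image_of_mem iC hu)))
  obtain ⟨E, _, er, ec, el, hEc, hEr, hEcol⟩ := edges_of_zero t W0 D0 zr zc S2
    (fun σ => hS2z σ (by simp)) (by
      rintro ⟨σ, k⟩ hz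
      obtain ⟨u, hu⟩ := hsR σ (lt_of_le_of_lt (Nat.zero_le _) k.2)
      obtain ⟨u', hu', hu''⟩ := avR u.1 u.2 (.inl (σ, true)) hu
      obtain ⟨u, hu, h⟩ := hqR' σ ⟨u', hu', hu''⟩
      refine ⟨⟨u, hQS2 (Finset.mem_sdiff.2 ⟨?_, h.1⟩)⟩, h.2⟩
      exact Finset.mem_union_left _ (Finset.mem_union_right _ (Finset.mem_image_of_mem iR hu))) (by
      rintro ⟨σ, k⟩ hz
      obtain ⟨u, hu⟩ := hsC σ (lt_of_le_of_lt (Nat.zero_le _) k.2)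
      obtain ⟨u', hu', hu''⟩ := avC u.1 u.2 (.inl (σ, true)) hu
      obtain ⟨u, hu, h⟩ := hqC' σ ⟨u', hu', hu''⟩
      refine ⟨⟨u, hQS2 (Finset.mem_sdiff.2 ⟨?_, h.1⟩)⟩, h.2⟩
      exact Finset.mem_union_right _ (Finset.mem_image_of_mem iC hu))
  rw [← hℓ] at hPc hEc
  have hπ : ∀ p, ∃ e, el e = pl p := by
    intro p
    have h1 : Occ (outp D0 (t (pr p).1.1)) (pl p) := (hPr (pr p) (pl p)).1.2 ⟨⟨p, rfl⟩, rfl⟩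
    obtain ⟨u', hu', hu''⟩ := avR _ (pr p).1.2 (.inl (pl p, false)) h1
    obtain ⟨u, hu, h⟩ := hqO' (pl p) ⟨u', hu', hu''⟩
    have hm : iR u ∈ S2 := hQS2 (Finset.mem_sdiff.2 ⟨Finset.mem_union_left _
      (Finset.mem_union_left _ (Finset.mem_image_of_mem iR hu)), h.1⟩)
    obtain ⟨⟨e, he⟩, h'⟩ := (hEr ⟨u, hm⟩ (pl p)).1.1 h.2
    exact ⟨e, h'⟩
  choose π hπ using hπ
  have filR := fun i (hi : i ∉ W0) j (hj : j ∉ D0) =>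
    filler_exists bigR bigC (by rw [← hℓ]; exact Nat.le_add_left _ _) hi hj
  obtain ⟨T, T1, T2, T3, T4, T5, T6, T7⟩ := cover t W0 D0
    (fun x : {u : {u // u ∉ W0} // Sum.inl (Sum.inl u) ∈ S1} => x.1.1)
    (fun x : {u : {u // u ∉ W0} // Sum.inl (Sum.inl u) ∈ S2} => x.1.1)
    (fun y : {v : {v // v ∉ D0} // Sum.inl (Sum.inr v) ∈ S1} => y.1.1)
    (fun y : {v : {v // v ∉ D0} // Sum.inl (Sum.inr v) ∈ S2} => y.1.1)
    pr pc pl er ec el π hπ hPr hPcol hEr hEcol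
    (by
      intro x y
      refine filR _ ?_ _ ?_
      · rcases x with x | x <;> exact x.1.2
      · rcases y with x | x <;> exact x.1.2)
    (by
      intro w hw
      have := (hwr2 w).sameProf (Sum.elim (fun a : D0 => a.1)
        (fun y : {v : {v // v ∉ D0} // Sum.inl (Sum.inr v) ∈ S1} => y.1.1)) (by
          rintro (a | a) (b | b) h
          · simpa [Subtype.ext_iff] using h
          · exact absurd a.2 (by simp at h; rw [h]; exact b.1.2)
          · exact absurd b.2 (by simp at h; rw [← h]; exact a.1.2)
          · simpa [Subtype.ext_iff] using h) (by
          intro j hj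
          by_cases hjD : j ∈ D0
          · exact ⟨.inl ⟨j, hjD⟩, rfl⟩
          · refine ⟨.inr ⟨⟨j, hjD⟩, hQS1 ?_⟩, rfl⟩
            refine Finset.mem_union_left _ (Finset.mem_union_right _
              (Finset.mem_image_of_mem iC ?_))
            rw [Finset.mem_subtype]
            exact Finset.mem_biUnion.2 ⟨w, by rw [hW0] at hw; exact hw, hj⟩)
      convert this using 1
      funext x
      rcases x with x | x <;> rfl)
    (by
      intro w hw y
      refine (hwr2 w).two (fun hj => hdis _ y.2 (hQS1 ?_))
      refine Finset.mem_union_left _ (Finset.mem_union_right _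
              (Finset.mem_image_of_mem iC ?_))
      rw [Finset.mem_subtype]
      exact Finset.mem_biUnion.2 ⟨w, by rw [hW0] at hw; exact hw, hj⟩)
    (by
      intro w hw
      have := (hwc2 w).sameProf (Sum.elim (fun a : W0 => a.1)
        (fun y : {v : {v // v ∉ W0} // Sum.inl (Sum.inl v) ∈ S1} => y.1.1)) (by
          rintro (a | a) (b | b) h
          · simpa [Subtype.ext_iff] using h
          · exact absurd a.2 (by simp at h; rw [h]; exact b.1.2)
          · exact absurd b.2 (by simp at h; rw [← h]; exact a.1.2)
          · simpa [Subtype.ext_iff] using h) (by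
          intro j hj
          by_cases hjD : j ∈ W0
          · exact ⟨.inl ⟨j, hjD⟩, rfl⟩
          · refine ⟨.inr ⟨⟨j, hjD⟩, hQS1 ?_⟩, rfl⟩
            refine Finset.mem_union_left _ (Finset.mem_union_left _
              (Finset.mem_image_of_mem iR ?_))
            rw [Finset.mem_subtype]
            exact Finset.mem_biUnion.2 ⟨w, by rw [hD0] at hw; exact hw, hj⟩)
      convert this using 1
      funext x
      rcases x with x | x <;> rfl)
    (by
      intro w hw y
      refine (hwc2 w).two (fun hj => hdis _ y.2 (hQS1 ?_))
      refine Finset.mem_union_left _ (Finset.mem_union_left _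
              (Finset.mem_image_of_mem iR ?_))
      rw [Finset.mem_subtype]
      exact Finset.mem_biUnion.2 ⟨w, by rw [hD0] at hw; exact hw, hj⟩)
  have hn1 : finN1 ℓ c ≤ finN1 ℓ (coreBd (finF ℓ) ℓ) := finN1_mono ℓ hc
  have hPc' : Fintype.card P ≤ (2 * ℓ + 1) * finN1 ℓ (coreBd (finF ℓ) ℓ) :=
    hPc.trans (Nat.mul_le_mul_left _ (hS1.trans hn1))
  have hEc' : Fintype.card E ≤ (2 * ℓ + 1) * finN2 ℓ := hEc.trans (Nat.mul_le_mul_left _ hS2)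
  have hcs : ∀ (a b d : ℕ), a ≤ c → b ≤ S1.card → d ≤ S2.card →
      a + (b + d * (Fintype.card P * 2 ^ Fintype.card E)) ≤ finBd ℓ := by
    intro a b d ha hb hd
    unfold finBd
    refine Nat.add_le_add (ha.trans hc) (Nat.add_le_add (hb.trans (hS1.trans hn1)) ?_)
    refine Nat.mul_le_mul (hd.trans hS2) (Nat.mul_le_mul hPc' ?_)
    exact Nat.pow_le_pow_right (by norm_num) hEc'
  have hcW : Fintype.card W0 = W0f.card := by
    subst hW0; simp
  have hcD : Fintype.card D0 = D0f.card := by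
    subst hD0; simp
  refine ⟨_, _, Fintype.ofFinite _, Fintype.ofFinite _, T, ?_, ?_, ?_, ?_, ?_⟩
  · rw [Fintype.card_eq_nat_card]
    simp only [Nat.card_sum, Nat.card_prod, Nat.card_fun, Nat.card_zmod]
    rw [Nat.card_eq_fintype_card (α := P), Nat.card_eq_fintype_card (α := E)]
    refine hcs _ _ _ (by rw [Nat.card_eq_fintype_card, hcW]; omega) ?_ ?_
    · rw [Nat.card_eq_fintype_card]; exact card_sub_le S1 iR iRi
    · rw [Nat.card_eq_fintype_card]; exact card_sub_le S2 iR iRi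
  · rw [Fintype.card_eq_nat_card]
    simp only [Nat.card_sum, Nat.card_prod, Nat.card_fun, Nat.card_zmod]
    rw [Nat.card_eq_fintype_card (α := P), Nat.card_eq_fintype_card (α := E)]
    refine hcs _ _ _ (by rw [Nat.card_eq_fintype_card, hcD]; omega) ?_ ?_
    · rw [Nat.card_eq_fintype_card]; exact card_sub_le S1 iC iCi
    · rw [Nat.card_eq_fintype_card]; exact card_sub_le S2 iC iCi
  · rintro (w | x | x)
    · exact ⟨_, T1 w⟩
    · exact ⟨_, T2 x⟩
    · exact ⟨_, T3 x⟩
  · rintro (w | x | x)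
    · exact ⟨_, T4 w⟩
    · exact ⟨_, T5 x⟩
    · exact ⟨_, T6 x⟩
  · exact ⟨.inl ⟨u0, by rw [hW0]; exact hu0⟩, .inl ⟨v0, by rw [hD0]; exact hv0⟩, T7 _ _⟩

end OneVarEq

namespace OneVarEq

/-- one half of the conditions on a finite certificate for arbitrary matrices -/
structure DHalf {U V L : Type} (q : U → V → L) (W0 A G : Set U) (D0 C H : Set V) : Prop where
  h1 : ∀ w ∈ W0, SameProf (q w) (fun j : {j // j ∈ D0 ∨ j ∈ C} => q w j)
  h0 : ∀ j ∈ C, j ∉ D0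
  h2 : ∀ w ∈ W0, ∀ h ∈ H, Two (q w) (q w h)
  h3 : ∀ i, i ∈ A ∨ i ∈ G → ∀ j, j ∉ D0 → ∃ h ∈ H, ∃ i', i' ∉ W0 ∧ q i' h = q i j

structure DCert {U V L : Type} (q : U → V → L) (W0 A G : Set U) (D0 C H : Set V) : Prop where
  hR : DHalf q W0 A G D0 C H
  hC : DHalf (fun v u => q u v) D0 C H W0 A G
  fill : ∀ i, i ∈ A ∨ i ∈ G → ∀ j, j ∈ C ∨ j ∈ H → ∃ σ, Two (q i) σ ∧ Two (fun u => q u j) σ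

theorem DHalf.core1 {U V L : Type} {q : U → V → L} {W0 A G : Set U} {D0 C H : Set V}
    (h : DHalf q W0 A G D0 C H) (w : U) (hw : w ∈ W0) :
    SameProf (q w) (Sum.elim (fun a : D0 => q w a)
      (fun y : C ⊕ (H × ℕ) => q w (Sum.elim (fun c => c.1) (fun h => h.1.1) y))) := by
  classical
  have := core_real D0 (q w) (fun c : C => c.1) (fun h : H × ℕ => h.1.1) (by
    refine (h.h1 w hw).trans (SameProf.of_equiv
      { toFun := fun j => if hj : j.1 ∈ D0 then .inl ⟨j.1, hj⟩ else
          .inr ⟨j.1, j.2.resolve_left hj⟩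
        invFun := Sum.elim (fun a => ⟨a.1, .inl a.2⟩) (fun a => ⟨a.1, .inr a.2⟩)
        left_inv := ?_
        right_inv := ?_ } ?_)
    · rintro ⟨j, hj⟩
      by_cases hjD : j ∈ D0 <;> simp [hjD]
    · rintro (a | a)
      · simp
      · simp [h.h0 a.1 a.2]
    · rintro ⟨j, hj⟩
      by_cases hjD : j ∈ D0 <;> simp [hjD]) (fun y => h.h2 w hw _ y.1.2)
  convert this using 1
  funext x
  rcases x with x | x | x <;> rfl

def grow {A G U : Type} (a : A → U) (g : G → U) : A ⊕ (G × ℕ) → U :=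
  Sum.elim a (fun x => g x.1)

theorem tok_countable {X V L : Type} [Countable X] (D0 : Set V) (s : X → V → L) (σ : L) :
    Countable (Tok D0 s σ) := by
  unfold Tok; infer_instance

theorem tok_infinite {X V L : Type} (D0 : Set V) (s : X → V → L) (σ : L) (f : ℕ → X)
    (hf : Function.Injective f) (h : ∀ n, Occ (outp D0 (s (f n))) σ) :
    Infinite (Tok D0 s σ) := by
  refine Infinite.of_injective (fun n => (⟨(f n, false), by simpa using h n⟩ : Tok D0 s σ)) ?_
  intro a b hab
  exact hf (congrArg (fun x => x.1.1) hab)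

theorem tok_equiv {X Y V U L : Type} [Countable X] [Countable Y] (D0 : Set V) (W0 : Set U)
    (s : X → V → L) (s' : Y → U → L) (σ : L)
    (h : ∀ x, Occ (outp D0 (s x)) σ → ∃ f : ℕ → Y, Function.Injective f ∧
      ∀ n, Occ (outp W0 (s' (f n))) σ)
    (h' : ∀ x, Occ (outp W0 (s' x)) σ → ∃ f : ℕ → X, Function.Injective f ∧
      ∀ n, Occ (outp D0 (s (f n))) σ) :
    Nonempty ({a : RTok D0 s Empty // rtLet Empty.elim a = σ} ≃
      {a : RTok W0 s' Empty // rtLet Empty.elim a = σ}) := by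
  have key : Nonempty (Tok D0 s σ ≃ Tok W0 s' σ) := by
    have c1 := tok_countable D0 s σ
    have c2 := tok_countable W0 s' σ
    have occ1 : ∀ x : Tok D0 s σ, Occ (outp D0 (s x.1.1)) σ := by
      rintro ⟨⟨x, b⟩, hx⟩
      cases b
      · simpa using hx
      · exact Two.occ (by simpa using hx)
    have occ2 : ∀ x : Tok W0 s' σ, Occ (outp W0 (s' x.1.1)) σ := by
      rintro ⟨⟨x, b⟩, hx⟩
      cases b
      · simpa using hx
      · exact Two.occ (by simpa using hx)
    by_cases hx : ∃ x, Occ (outp D0 (s x)) σ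
    · obtain ⟨x, hx⟩ := hx
      obtain ⟨f, hf, hf'⟩ := h x hx
      obtain ⟨g, hg, hg'⟩ := h' _ (hf' 0)
      have i1 := tok_infinite D0 s σ g hg hg'
      have i2 := tok_infinite W0 s' σ f hf hf'
      exact nonempty_equiv_of_countable
    · have e1 : IsEmpty (Tok D0 s σ) := ⟨fun x => hx ⟨_, occ1 x⟩⟩
      have e2 : IsEmpty (Tok W0 s' σ) := ⟨fun x => by
        obtain ⟨g, hg, hg'⟩ := h' _ (occ2 x)
        exact hx ⟨_, hg' 0⟩⟩
      exact ⟨Equiv.equivOfIsEmpty _ _⟩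
  obtain ⟨k⟩ := key
  exact ⟨(rtFiberEquiv D0 s _ σ).trans ((Equiv.sumCongr k (Equiv.refl _)).trans
    (rtFiberEquiv W0 s' _ σ).symm)⟩

theorem d_sound {U V L : Type} [Countable U] [Countable V] (q : U → V → L) (W0 A G : Set U)
    (D0 C H : Set V) (hc : DCert q W0 A G D0 C H) :
    ∃ (U' V' : Type) (T : U' → V' → L),
      (∀ u', ∃ u, (u ∈ W0 ∨ u ∈ A ∨ u ∈ G) ∧ SameProf (q u) (T u')) ∧
      (∀ v', ∃ v, (v ∈ D0 ∨ v ∈ C ∨ v ∈ H) ∧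
        SameProf (fun u => q u v) (fun u' => T u' v')) ∧
      ∀ w ∈ W0, ∀ a ∈ D0, ∃ u' v', T u' v' = q w a := by
  classical
  obtain ⟨hR, hC, fill⟩ := hc
  let ρ1 : A ⊕ (G × ℕ) → U := Sum.elim (fun a => a.1) (fun x => x.1.1)
  let ρ2 : G × ℕ → U := fun x => x.1.1
  let κ1 : C ⊕ (H × ℕ) → V := Sum.elim (fun a => a.1) (fun x => x.1.1)
  let κ2 : H × ℕ → V := fun x => x.1.1
  have mρ1 : ∀ x, ρ1 x ∈ A ∨ ρ1 x ∈ G := by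
    rintro (x | x)
    · exact .inl x.2
    · exact .inr x.1.2
  have mκ1 : ∀ x, κ1 x ∈ C ∨ κ1 x ∈ H := by
    rintro (x | x)
    · exact .inl x.2
    · exact .inr x.1.2
  have aR : ∀ i, i ∈ A ∨ i ∈ G → ∀ σ, Occ (outp D0 (q i)) σ →
      ∃ h ∈ H, Occ (outp W0 (fun u => q u h)) σ := by
    rintro i hi σ ⟨⟨j, hj⟩, rfl⟩
    obtain ⟨h, hh, i', hi', e⟩ := hR.h3 i hi j hj
    exact ⟨h, hh, ⟨i', hi'⟩, e⟩
  have aC : ∀ j, j ∈ C ∨ j ∈ H → ∀ σ, Occ (outp W0 (fun u => q u j)) σ →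
      ∃ g ∈ G, Occ (outp D0 (q g)) σ := by
    rintro i hi σ ⟨⟨j, hj⟩, rfl⟩
    obtain ⟨h, hh, i', hi', e⟩ := hC.h3 i hi j hj
    exact ⟨h, hh, ⟨i', hi'⟩, e⟩
  obtain ⟨pc, hpc⟩ := edge_sys D0 W0 (fun x => q (ρ1 x)) (fun y u => q u (κ1 y))
    (Empty.elim : Empty → L) (Empty.elim : Empty → L) Empty.elim (fun z => z.elim) (by
      intro σ
      apply tok_equiv
      · intro x hx
        obtain ⟨h, hh, e⟩ := aR _ (mρ1 x) σ hx
        exact ⟨fun n => .inr (⟨h, hh⟩, n), fun a b hab => by simpa using hab, fun n => e⟩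
      · intro x hx
        obtain ⟨h, hh, e⟩ := aC _ (mκ1 x) σ hx
        exact ⟨fun n => .inr (⟨h, hh⟩, n), fun a b hab => by simpa using hab, fun n => e⟩)
  obtain ⟨ec, hec⟩ := edge_sys D0 W0 (fun x => q (ρ2 x)) (fun y u => q u (κ2 y))
    (Empty.elim : Empty → L) (Empty.elim : Empty → L) Empty.elim (fun z => z.elim) (by
      intro σ
      apply tok_equiv
      · intro x hx
        obtain ⟨h, hh, e⟩ := aR _ (.inr x.1.2) σ hx
        exact ⟨fun n => (⟨h, hh⟩, n), fun a b hab => by simpa using hab, fun n => e⟩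
      · intro x hx
        obtain ⟨h, hh, e⟩ := aC _ (.inr x.1.2) σ hx
        exact ⟨fun n => (⟨h, hh⟩, n), fun a b hab => by simpa using hab, fun n => e⟩)
  have hπ : ∀ p : RTok D0 (fun x => q (ρ1 x)) Empty, ∃ e : RTok D0 (fun x => q (ρ2 x)) Empty,
      rtLet Empty.elim e = rtLet Empty.elim p := by
    rintro (⟨σ, ⟨⟨x, b⟩, hx⟩⟩ | z)
    · have hocc : Occ (outp D0 (q (ρ1 x))) σ := by
        cases b
        · simpa using hx
        · exact Two.occ (by simpa using hx)
      obtain ⟨h, hh, e⟩ := aR _ (mρ1 x) σ hocc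
      obtain ⟨g, hg, e⟩ := aC _ (.inr hh) σ e
      exact ⟨.inl ⟨σ, ⟨((⟨g, hg⟩, 0), false), by simpa using e⟩⟩, rfl⟩
    · exact z.elim
  choose π hπ using hπ
  obtain ⟨T, T1, T2, T3, T4, T5, T6, T7⟩ := cover q W0 D0 ρ1 ρ2 κ1 κ2
    (rtEnd Empty.elim) pc (rtLet Empty.elim) (rtEnd Empty.elim) ec (rtLet Empty.elim) π hπ
    (fun x => tok_prof D0 (fun x => q (ρ1 x)) Empty.elim Empty.elim (fun z => z.elim) x) hpc
    (fun x => tok_prof D0 (fun x => q (ρ2 x)) Empty.elim Empty.elim (fun z => z.elim) x) hec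
    (by
      intro x y
      refine fill _ ?_ _ ?_
      · rcases x with x | x
        · exact mρ1 x
        · exact .inr x.1.2
      · rcases y with x | x
        · exact mκ1 x
        · exact .inr x.1.2)
    (fun w hw => hR.core1 w hw) (fun w hw y => hR.h2 w hw _ y.1.2)
    (fun w hw => hC.core1 w hw) (fun w hw y => hC.h2 w hw _ y.1.2)
  refine ⟨_, _, T, ?_, ?_, fun w hw a ha => ⟨.inl ⟨w, hw⟩, .inl ⟨a, ha⟩, T7 _ _⟩⟩
  · rintro (w | x | x)
    · exact ⟨_, .inl w.2, T1 w⟩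
    · exact ⟨_, .inr (mρ1 x), T2 x⟩
    · exact ⟨_, .inr (.inr x.1.1.2), T3 x⟩
  · rintro (w | x | x)
    · exact ⟨_, .inl w.2, T4 w⟩
    · exact ⟨_, .inr (mκ1 x), T5 x⟩
    · exact ⟨_, .inr (.inr x.1.1.2), T6 x⟩

def dF (ℓ c : ℕ) : ℕ := 2 * ℓ * c + 2 * ℓ

theorem dF_mono (ℓ : ℕ) : Monotone (dF ℓ) := by
  intro a b h
  unfold dF
  gcongr

def dR (ℓ c : ℕ) : ℕ := c + 2 * ℓ * c + ℓ

noncomputable def dBd (ℓ : ℕ) : ℕ :=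
  dR ℓ (coreBd (dF ℓ) ℓ) + dR ℓ (coreBd (dF ℓ) ℓ) * (2 * ℓ) + ℓ * ℓ

/-- one side of the selection -/
theorem d_side {U V L : Type} [Fintype L] (t : U → V → L) (W0 : Finset U) (D0 : Finset V) (n : ℕ)
    (hn : 2 * Fintype.card L * (W0.card + D0.card) ≤ n)
    (wc : V → Finset U) (hwc : ∀ v, (wc v).card ≤ 2 * Fintype.card L)
    (big : RowsBig t W0 D0 n) :
    ∃ A G : Finset U, (∀ a ∈ A, a ∉ W0) ∧ A.card ≤ 2 * Fintype.card L * (W0.card + D0.card) ∧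
      G.card ≤ Fintype.card L ∧ (∀ v ∈ D0, ∀ u ∈ wc v, u ∈ W0 ∨ u ∈ A) ∧
      (∀ g ∈ G, g ∉ W0 ∧ g ∉ A) ∧
      (∀ i, i ∉ W0 → ∀ σ, Occ (outp (D0 : Set V) (t i)) σ →
        ∃ g ∈ G, Occ (outp (D0 : Set V) (t g)) σ) := by
  classical
  let S := D0.biUnion wc
  have hS : S.card ≤ 2 * Fintype.card L * (W0.card + D0.card) := by
    refine (Finset.card_biUnion_le_card_mul _ _ _ (fun v _ => hwc v)).trans ?_
    rw [mul_comm]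
    exact Nat.mul_le_mul_left _ (by omega)
  let A := S \ W0
  have hA : A.card ≤ 2 * Fintype.card L * (W0.card + D0.card) :=
    (Finset.card_le_card Finset.sdiff_subset).trans hS
  obtain ⟨G0, hG1, hG2⟩ := pick_fin
    (fun i σ => i ∉ W0 ∧ i ∉ A ∧ Occ (outp (D0 : Set V) (t i)) σ)
  refine ⟨A, G0.filter (fun i => i ∉ W0 ∧ i ∉ A), ?_, hA,
    (Finset.card_filter_le _ _).trans hG1, ?_, ?_, ?_⟩
  · intro a ha; exact (Finset.mem_sdiff.1 ha).2
  · intro v hv u hu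
    by_cases h : u ∈ W0
    · exact .inl h
    · exact .inr (Finset.mem_sdiff.2 ⟨Finset.mem_biUnion.2 ⟨v, hv, hu⟩, h⟩)
  · intro g hg
    exact (Finset.mem_filter.1 hg).2
  · intro i hi σ h
    obtain ⟨i', h1, h2, h3⟩ := big i (by simpa using hi) (.inl (σ, false)) h A (hA.trans hn)
    obtain ⟨g, hg, h4, h5, h6⟩ := hG2 σ ⟨i', by simpa using h1, h2, h3⟩
    exact ⟨g, Finset.mem_filter.2 ⟨hg, h4, h5⟩, h6⟩

theorem d_half {U V L : Type} (t : U → V → L) (W0 A G Uf : Finset U) (D0 C H Vf : Finset V)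
    (wr : U → Finset V) (hwr : ∀ u, IsWit (t u) (wr u))
    (hC0 : ∀ c ∈ C, c ∉ D0) (hA0 : ∀ a ∈ A, a ∉ W0) (hG0 : ∀ g ∈ G, g ∉ W0 ∧ g ∉ A)
    (hW : ∀ w ∈ W0, ∀ v ∈ wr w, v ∈ D0 ∨ v ∈ C) (hH : ∀ h ∈ H, h ∉ D0 ∧ h ∉ C)
    (hsub : ∀ v, v ∈ D0 ∨ v ∈ C ∨ v ∈ H → v ∈ Vf)
    (hpick : ∀ j, j ∉ D0 → ∀ σ, Occ (outp (W0 : Set U) (fun u => t u j)) σ →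
        ∃ h ∈ H, Occ (outp (W0 : Set U) (fun u => t u h)) σ)
    (hoc : ∀ h ∈ H, ∀ σ, Occ (outp (W0 : Set U) (fun u => t u h)) σ →
      ∃ i ∈ Uf, i ∉ W0 ∧ t i h = σ)
    (hrow : ∀ u, u ∈ W0 ∨ u ∈ A ∨ u ∈ G → SameProf (t u) (fun v : Vf => t u v)) :
    DHalf (fun (u : Uf) (v : Vf) => t u v) {u | u.1 ∈ W0} {u | u.1 ∈ A} {u | u.1 ∈ G}
      {v | v.1 ∈ D0} {v | v.1 ∈ C} {v | v.1 ∈ H} where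
  h1 := by
    intro w hw
    refine (hrow w (.inl hw)).symm.trans ?_
    exact (hwr w).sameProf (fun j : {j : Vf // j.1 ∈ D0 ∨ j.1 ∈ C} => j.1.1)
      (fun a b h => Subtype.ext (Subtype.ext h)) (fun i hi =>
        ⟨⟨⟨i, hsub i ((hW w hw i hi).imp_right .inl)⟩, hW w hw i hi⟩, rfl⟩)
  h0 := fun j hj => hC0 j.1 hj
  h2 := by
    intro w hw h hh
    have : h.1 ∉ wr w := fun hm => (hW w hw _ hm).elim (hH _ hh).1 (hH _ hh).2
    exact (hrow w (.inl hw) _).2.1 ((hwr w).two this)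
  h3 := by
    intro i hi j hj
    have hi0 : i.1 ∉ W0 := hi.elim (hA0 _) (fun h => (hG0 _ h).1)
    obtain ⟨h, hh, hh'⟩ := hpick j.1 hj (t i j) ⟨⟨i.1, by simpa using hi0⟩, rfl⟩
    obtain ⟨i', h1, h2, h3⟩ := hoc h hh _ hh'
    exact ⟨⟨h, hsub h (.inr (.inr hh))⟩, hh, ⟨i', h1⟩, h2, h3⟩

theorem d_oc {U V L : Type} [Fintype L] (t : U → V → L) (W0 : Finset U) (H : Finset V)
    (hH : H.card ≤ Fintype.card L) :
    ∃ F : Finset U, F.card ≤ Fintype.card L * Fintype.card L ∧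
      ∀ h ∈ H, ∀ σ, Occ (outp (W0 : Set U) (fun u => t u h)) σ → ∃ i ∈ F, i ∉ W0 ∧ t i h = σ := by
  classical
  choose F hF1 hF2 using fun h => pick_fin (fun i σ => i ∉ W0 ∧ t i h = σ)
  refine ⟨H.biUnion F, ?_, ?_⟩
  · exact (Finset.card_biUnion_le_card_mul _ _ _ (fun v _ => hF1 v)).trans
      (Nat.mul_le_mul_right _ hH)
  · rintro h hh σ ⟨⟨i, hi⟩, e⟩
    obtain ⟨a, ha, h'⟩ := hF2 h σ ⟨i, by simpa using hi, e⟩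
    exact ⟨a, Finset.mem_biUnion.2 ⟨h, hh, ha⟩, h'⟩

theorem d_complete {U V L : Type} [Fintype L] (t : U → V → L) (u0 : U) (v0 : V) :
    ∃ (U' V' : Type) (_ : Fintype U') (_ : Fintype V') (q : U' → V' → L)
      (W0 A G : Set U') (D0 C H : Set V'),
      Fintype.card U' ≤ dBd (Fintype.card L) ∧ Fintype.card V' ≤ dBd (Fintype.card L) ∧
      DCert q W0 A G D0 C H ∧
      (∀ u', (u' ∈ W0 ∨ u' ∈ A ∨ u' ∈ G) → ∃ u, SameProf (t u) (q u')) ∧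
      (∀ v', (v' ∈ D0 ∨ v' ∈ C ∨ v' ∈ H) →
        ∃ v, SameProf (fun u => t u v) (fun u' => q u' v')) ∧
      ∃ u' ∈ W0, ∃ v' ∈ D0, q u' v' = t u0 v0 := by
  classical
  set ℓ := Fintype.card L with hℓ
  obtain ⟨W0, D0, hu0, hv0, hc, bigR, bigC⟩ := core_exists t u0 v0 (dF ℓ) (dF_mono ℓ)
  rw [← hℓ] at hc
  choose wr hwr1 hwr2 using fun u => exists_wit (t u)
  choose wc hwc1 hwc2 using fun v => exists_wit (fun u => t u v)
  obtain ⟨A, G, hA0, hAc, hGc, hAw, hG0, hGp⟩ := d_side t W0 D0 _ (by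
    rw [← hℓ]; exact Nat.le_add_right _ _) wc hwc1 bigR
  obtain ⟨C, H, hC0, hCc, hHc, hCw, hH0, hHp⟩ := d_side (fun v u => t u v) D0 W0 _ (by
    rw [← hℓ, add_comm D0.card]; exact Nat.le_add_right _ _) wr hwr1 bigC
  obtain ⟨FR, hFRc, hFR⟩ := d_oc t W0 H hHc
  obtain ⟨FC, hFCc, hFC⟩ := d_oc (fun v u => t u v) D0 G hGc
  rw [← hℓ] at hAc hGc hCc hHc hFRc hFCc
  let RU := W0 ∪ A ∪ G
  let RV := D0 ∪ C ∪ H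
  have hRU : RU.card ≤ dR ℓ (coreBd (dF ℓ) ℓ) := by
    have h1 := Finset.card_union_le (W0 ∪ A) G
    have h2 := Finset.card_union_le W0 A
    have h3 : 2 * ℓ * (W0.card + D0.card) ≤ 2 * ℓ * coreBd (dF ℓ) ℓ := Nat.mul_le_mul_left _ hc
    unfold dR
    show (W0 ∪ A ∪ G).card ≤ _
    omega
  have hRV : RV.card ≤ dR ℓ (coreBd (dF ℓ) ℓ) := by
    have h1 := Finset.card_union_le (D0 ∪ C) H
    have h2 := Finset.card_union_le D0 C
    have h3 : 2 * ℓ * (W0.card + D0.card) ≤ 2 * ℓ * coreBd (dF ℓ) ℓ := Nat.mul_le_mul_left _ hc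
    rw [add_comm D0.card] at hCc
    unfold dR
    show (D0 ∪ C ∪ H).card ≤ _
    omega
  let Uf := RU ∪ RV.biUnion wc ∪ FR
  let Vf := RV ∪ RU.biUnion wr ∪ FC
  have hUf : Uf.card ≤ dBd ℓ := by
    refine (Finset.card_union_le _ _).trans (Nat.add_le_add ((Finset.card_union_le _ _).trans
      (Nat.add_le_add hRU ?_)) hFRc)
    exact (Finset.card_biUnion_le_card_mul _ _ _ (fun v _ => hwc1 v)).trans
      (Nat.mul_le_mul_right _ hRV)
  have hVf : Vf.card ≤ dBd ℓ := by
    refine (Finset.card_union_le _ _).trans (Nat.add_le_add ((Finset.card_union_le _ _).trans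
      (Nat.add_le_add hRV ?_)) hFCc)
    exact (Finset.card_biUnion_le_card_mul _ _ _ (fun v _ => hwr1 v)).trans
      (Nat.mul_le_mul_right _ hRU)
  have mRU : ∀ u, u ∈ W0 ∨ u ∈ A ∨ u ∈ G → u ∈ RU := by
    intro u hu; simp only [RU, Finset.mem_union]; tauto
  have mRV : ∀ u, u ∈ D0 ∨ u ∈ C ∨ u ∈ H → u ∈ RV := by
    intro u hu; simp only [RV, Finset.mem_union]; tauto
  have sU : ∀ u ∈ RU, u ∈ Uf := fun u hu => Finset.mem_union_left _ (Finset.mem_union_left _ hu)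
  have sV : ∀ u ∈ RV, u ∈ Vf := fun u hu => Finset.mem_union_left _ (Finset.mem_union_left _ hu)
  have rowP : ∀ u ∈ RU, SameProf (t u) (fun v : Vf => t u v) := by
    intro u hu
    exact (hwr2 u).sameProf (fun v : Vf => v.1) Subtype.val_injective (fun i hi =>
      ⟨⟨i, Finset.mem_union_left _ (Finset.mem_union_right _ (Finset.mem_biUnion.2 ⟨u, hu, hi⟩))⟩,
        rfl⟩)
  have colP : ∀ v ∈ RV, SameProf (fun u => t u v) (fun u : Uf => t u v) := by
    intro u hu
    exact (hwc2 u).sameProf (fun v : Uf => v.1) Subtype.val_injective (fun i hi =>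
      ⟨⟨i, Finset.mem_union_left _ (Finset.mem_union_right _ (Finset.mem_biUnion.2 ⟨u, hu, hi⟩))⟩,
        rfl⟩)
  refine ⟨Uf, Vf, inferInstance, inferInstance, fun u v => t u v, {u | u.1 ∈ W0}, {u | u.1 ∈ A},
    {u | u.1 ∈ G}, {v | v.1 ∈ D0}, {v | v.1 ∈ C}, {v | v.1 ∈ H}, ?_, ?_, ⟨?_, ?_, ?_⟩, ?_, ?_, ?_⟩
  · simpa using hUf
  · simpa using hVf
  · exact d_half t W0 A G Uf D0 C H Vf wr hwr2 hC0 hA0 hG0 hCw hH0 (fun v hv => sV v (mRV v hv))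
      hHp (fun h hh σ ho => by
        obtain ⟨i, hi, hi'⟩ := hFR h hh σ ho
        exact ⟨i, Finset.mem_union_right _ hi, hi'⟩) (fun u hu => rowP u (mRU u hu))
  · exact d_half (fun v u => t u v) D0 C H Vf W0 A G Uf wc hwc2 hA0 hC0 hH0 hAw hG0
      (fun v hv => sU v (mRU v hv))
      hGp (fun h hh σ ho => by
        obtain ⟨i, hi, hi'⟩ := hFC h hh σ ho
        exact ⟨i, Finset.mem_union_right _ hi, hi'⟩) (fun u hu => colP u (mRV u hu))
  · intro i hi j hj
    have hi0 : i.1 ∉ W0 := hi.elim (hA0 _) (fun h => (hG0 _ h).1)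
    have hj0 : j.1 ∉ D0 := hj.elim (hC0 _) (fun h => (hH0 _ h).1)
    obtain ⟨σ, h1, h2⟩ := filler_exists bigR bigC (by
      rw [← hℓ]; exact Nat.le_add_left _ _) (i := i.1) (by simpa using hi0) (j := j.1)
      (by simpa using hj0)
    exact ⟨σ, (rowP i.1 (mRU _ (.inr hi)) σ).2.1 h1, (colP j.1 (mRV _ (.inr hj)) σ).2.1 h2⟩
  · intro u' hu'
    exact ⟨u'.1, rowP _ (mRU _ hu')⟩
  · intro u' hu'
    exact ⟨u'.1, colP _ (mRV _ hu')⟩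
  · exact ⟨⟨u0, sU _ (mRU _ (.inl hu0))⟩, hu0, ⟨v0, sV _ (mRV _ (.inl hv0))⟩, hv0, rfl⟩

end OneVarEq

namespace OneVarEq

theorem lt_pair_right {a b : ℕ} (h : 1 ≤ a) : b < Nat.pair a b := by
  have := Nat.add_le_pair a b
  omega

theorem le_unpair_lt {n : ℕ} (h : 1 ≤ n.unpair.1) : n.unpair.2 < n := by
  have := lt_pair_right (b := n.unpair.2) h
  rwa [Nat.pair_unpair] at this

def tmDec : ℕ → ETm
  | 0 => .var
  | k + 1 => .const k

theorem tmDec_code (t : ETm) : tmDec t.code = t := by cases t <;> rfl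
theorem code_tmDec (n : ℕ) : (tmDec n).code = n := by cases n <;> rfl

/-- total decoder of formulas -/
def dec (n : ℕ) : EF Unit :=
  if n.unpair.1 = 0 then .pred n.unpair.2.unpair.1 (tmDec n.unpair.2.unpair.2)
  else if n.unpair.1 = 1 then .eq (tmDec n.unpair.2.unpair.1) (tmDec n.unpair.2.unpair.2)
  else if h : n.unpair.1 = 2 then .neg (dec n.unpair.2)
  else if h : n.unpair.1 = 3 then .and (dec n.unpair.2.unpair.1) (dec n.unpair.2.unpair.2)
  else if h : n.unpair.1 = 4 then .ex (dec n.unpair.2)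
  else if h : n.unpair.1 = 5 then .box () (dec n.unpair.2.unpair.2)
  else .pred 0 .var
termination_by n
decreasing_by
  · exact le_unpair_lt (by omega)
  · exact lt_of_le_of_lt (Nat.unpair_left_le _) (le_unpair_lt (by omega))
  · exact lt_of_le_of_lt (Nat.unpair_right_le _) (le_unpair_lt (by omega))
  · exact le_unpair_lt (by omega)
  · exact lt_of_le_of_lt (Nat.unpair_right_le _) (le_unpair_lt (by omega))

theorem dec_encode (φ : EF Unit) : dec (EF.encode eU φ) = φ := by
  induction φ with
  | pred n t => rw [EF.encode, dec]; simp [tmDec_code]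
  | eq t t' => rw [EF.encode, dec]; simp [tmDec_code]
  | neg φ ih => rw [EF.encode, dec]; simp [ih]
  | and φ ψ ih ih' => rw [EF.encode, dec]; simp [ih, ih']
  | ex φ ih => rw [EF.encode, dec]; simp [ih]
  | box m φ ih => rw [EF.encode, dec]; simp [ih]

/-- code of the formula `x = c` for the term code `r ≠ 0` -/
def eqc (r : ℕ) : ℕ := Nat.pair 1 (Nat.pair 0 r)

/-- local conditions on a row -/
structure LocN {V : Type} (b : ℕ → V → Prop) (n tg r r1 r2 : ℕ) (j : V) : Prop where
  t0 : tg = 0 → r2 ≠ 0 → (b n j ↔ ∃ j', b (eqc r2) j' ∧ b (Nat.pair 0 (Nat.pair r1 0)) j')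
  t1 : tg = 1 → r1 = 0 → r2 = 0 → b n j
  t1' : tg = 1 → r1 ≠ 0 → r2 = 0 → (b n j ↔ b (eqc r1) j)
  t1'' : tg = 1 → r1 ≠ 0 → r2 ≠ 0 → (b n j ↔ ∃ j', b (eqc r1) j' ∧ b (eqc r2) j')
  t2 : tg = 2 → (b n j ↔ ¬ b r j)
  t3 : tg = 3 → (b n j ↔ b r1 j ∧ b r2 j)
  t4 : tg = 4 → (b n j ↔ ∃ j', b r j')
  t6 : 6 ≤ tg → (b n j ↔ b 0 j)

def LocC {V : Type} (b : ℕ → V → Prop) (n : ℕ) (j : V) : Prop :=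
  LocN b n n.unpair.1 n.unpair.2 n.unpair.2.unpair.1 n.unpair.2.unpair.2 j

def RowB {V : Type} (φ : ℕ) (b : ℕ → V → Prop) : Prop :=
  (∀ n ≤ φ, ∀ j, LocC b n j) ∧
  ∀ k ≤ φ, ∃ j, b (eqc (k + 1)) j ∧ ∀ j', b (eqc (k + 1)) j' → j' = j

def ColB {U : Type} (φ : ℕ) (b : ℕ → U → Prop) : Prop :=
  ∀ n ≤ φ, n.unpair.1 = 5 → ∀ i, (b n i ↔ ∀ i', i' ≠ i → b n.unpair.2.unpair.2 i')

theorem occ_ex {ι ι' L : Type} {s : ι → L} {s' : ι' → L} (h : SameProf s s') (p : L → Prop) :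
    (∃ j, p (s j)) ↔ ∃ j, p (s' j) := by
  constructor
  · rintro ⟨j, hj⟩
    obtain ⟨j', e⟩ := (h (s j)).1.1 ⟨j, rfl⟩
    exact ⟨j', by rwa [e]⟩
  · rintro ⟨j, hj⟩
    obtain ⟨j', e⟩ := (h (s' j)).1.2 ⟨j, rfl⟩
    exact ⟨j', by rwa [e]⟩

theorem RowB.inv {ι ι' L : Type} {s : ι → L} {s' : ι' → L} (h : SameProf s s')
    (β : ℕ → L → Prop) (φ : ℕ) (hs : RowB φ (fun n j => β n (s j))) :
    RowB φ (fun n j => β n (s' j)) := by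
  refine ⟨fun n hn j => ?_, fun k hk => ?_⟩
  · obtain ⟨j0, e⟩ := (h (s' j)).1.2 ⟨j, rfl⟩
    have := hs.1 n hn j0
    obtain ⟨a0, a1, a2, a3, a4, a5, a6, a7⟩ := this
    rw [e] at a0 a1 a2 a3 a4 a5 a6 a7
    refine ⟨?_, a1, a2, ?_, a4, a5, ?_, a7⟩
    · intro h1 h2
      rw [a0 h1 h2]
      exact occ_ex h (fun σ => _ ∧ _)
    · intro h1 h2 h3
      rw [a3 h1 h2 h3]
      exact occ_ex h (fun σ => _ ∧ _)
    · intro h1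
      rw [a6 h1]
      exact occ_ex h (fun σ => _)
  · obtain ⟨j, hj, hu⟩ := hs.2 k hk
    obtain ⟨j', e⟩ := (h (s j)).1.1 ⟨j, rfl⟩
    refine ⟨j', by simpa only [e] using hj, fun j1 hj1 => ?_⟩
    obtain ⟨i1, e1⟩ := (h (s' j1)).1.2 ⟨j1, rfl⟩
    have := hu i1 (by simpa only [e1] using hj1)
    subst this
    by_contra hne
    obtain ⟨a, b, hab, ha, hb⟩ := (h (s i1)).2.2 ⟨j1, j', hne, e1.symm, e⟩
    exact hab ((hu a (by simpa only [ha] using hj)).trans (hu b (by simpa only [hb] using hj)).symm)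

theorem ColB.inv {ι ι' L : Type} {s : ι → L} {s' : ι' → L} (h : SameProf s s')
    (β : ℕ → L → Prop) (φ : ℕ) (hs : ColB φ (fun n j => β n (s j))) :
    ColB φ (fun n j => β n (s' j)) := by
  intro n hn h5 i
  obtain ⟨i0, e0⟩ := (h (s' i)).1.2 ⟨i, rfl⟩
  have h1 := hs n hn h5 i0
  simp only [e0] at h1 ⊢
  rw [h1]
  constructor
  · intro hh i' hne
    by_cases hc : s' i' = s' i
    · obtain ⟨a, b, hab, ha, hb⟩ := (h (s' i)).2.2 ⟨i', i, hne, hc, rfl⟩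
      rw [hc]
      by_cases hai : a = i0
      · have := hh b (fun h => hab (by rw [hai, h]))
        rwa [hb] at this
      · have := hh a hai
        rwa [ha] at this
    · obtain ⟨a, ha⟩ := (h (s' i')).1.2 ⟨i', rfl⟩
      have := hh a (fun h => hc (by rw [← ha, h, e0]))
      rwa [ha] at this
  · intro hh i' hne
    by_cases hc : s i' = s i0
    · obtain ⟨a, b, hab, ha, hb⟩ := (h (s i0)).2.1 ⟨i', i0, hne, hc, rfl⟩
      rw [hc]
      by_cases hai : a = i
      · have := hh b (fun h => hab (by rw [hai, h]))
        rwa [hb] at this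
      · have := hh a hai
        rwa [ha] at this
    · obtain ⟨a, ha⟩ := (h (s i')).1.1 ⟨i', rfl⟩
      have := hh a (fun h => hc (by rw [← ha, h, e0]))
      rwa [ha] at this

/-- size of the bit vectors -/
def BB (φ : ℕ) : ℕ := Nat.pair 1 (Nat.pair 0 (φ + 2)) + φ + 1

abbrev LL (φ : ℕ) := Fin (BB φ) → Bool

def bitL {B : ℕ} (n : ℕ) (σ : Fin B → Bool) : Prop := ∃ h : n < B, σ ⟨n, h⟩ = true

theorem lt_BB {φ n : ℕ} (h : n ≤ φ) : n < BB φ := by unfold BB; omega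

theorem eqc_lt_BB {φ r : ℕ} (h : r ≤ φ + 1) : eqc r < BB φ := by
  have : eqc r < eqc (φ + 2) := Nat.pair_lt_pair_right _ (Nat.pair_lt_pair_right _ (by omega))
  unfold eqc at *
  unfold BB; omega

def MatOK (φ : ℕ) {U V : Type} (t : U → V → LL φ) : Prop :=
  (∀ u, RowB φ (fun n v => bitL n (t u v))) ∧ (∀ v, ColB φ (fun n u => bitL n (t u v)))

theorem r1_le (n : ℕ) : n.unpair.2.unpair.1 ≤ n :=
  (Nat.unpair_left_le _).trans (Nat.unpair_right_le _)
theorem r2_le (n : ℕ) : n.unpair.2.unpair.2 ≤ n :=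
  (Nat.unpair_right_le _).trans (Nat.unpair_right_le _)

theorem pair_p0_le (n : ℕ) (h : n.unpair.1 = 0) :
    Nat.pair 0 (Nat.pair n.unpair.2.unpair.1 0) ≤ n := by
  conv_rhs => rw [← Nat.pair_unpair n, h, ← Nat.pair_unpair n.unpair.2]
  rcases Nat.eq_zero_or_pos n.unpair.2.unpair.2 with h0 | h0
  · rw [h0]
  · exact (Nat.pair_lt_pair_right _ (Nat.pair_lt_pair_right _ h0)).le

theorem eval_pred_var {F : KFrame Unit} (𝔪 : EModel F) (p : ℕ) (w a) :
    𝔪.eval (dec (Nat.pair 0 (Nat.pair p 0))) w a ↔ a ∈ 𝔪.I w p := by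
  rw [dec]; simp [tmDec, EModel.eval, EModel.tmVal]

theorem eval_eqc {F : KFrame Unit} (𝔪 : EModel F) (r : ℕ) (w a) :
    𝔪.eval (dec (eqc (r + 1))) w a ↔ a = 𝔪.cst w r := by
  rw [eqc, dec]; simp [tmDec, EModel.eval, EModel.tmVal]

/-- from models to matrices -/
theorem mat_of_model (φ : ℕ) {F : KFrame Unit} (𝔪 : EModel F) (hD : 𝔪.IsD .cd) {U : Type}
    (ι : U → F.W)
    (hR : ∀ u w, F.R () (ι u) w ↔ ∃ u', u' ≠ u ∧ ι u' = w) (u0 : U) (a0 : 𝔪.D)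
    (h0 : 𝔪.eval (dec φ) (ι u0) a0) :
    ∃ t : U → 𝔪.D → LL φ, MatOK φ t ∧ bitL φ (t u0 a0) := by
  classical
  let t : U → 𝔪.D → LL φ := fun u a k => decide (𝔪.eval (dec k.1) (ι u) a)
  have hb : ∀ n, n < BB φ → ∀ u a, bitL n (t u a) ↔ 𝔪.eval (dec n) (ι u) a := by
    intro n hn u a
    constructor
    · rintro ⟨h, h'⟩; simpa [t] using h'
    · intro h; exact ⟨hn, by simpa [t] using h⟩
  have hdom : ∀ w a, a ∈ 𝔪.dom w := fun w a => by rw [hD rfl w]; trivial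
  refine ⟨t, ⟨fun u => ⟨fun n hn j => ?_, fun k hk => ?_⟩, fun v n hn h5 i => ?_⟩,
    (hb φ (lt_BB le_rfl) _ _).2 h0⟩
  · have c1 : ∀ m ≤ n, ∀ a, bitL m (t u a) ↔ 𝔪.eval (dec m) (ι u) a :=
      fun m hm a => hb m (lt_BB (hm.trans hn)) u a
    have c2 : ∀ r ≤ n, ∀ a, bitL (eqc r) (t u a) ↔ 𝔪.eval (dec (eqc r)) (ι u) a :=
      fun m hm a => hb _ (eqc_lt_BB (by omega)) u a
    have q1 := r1_le n
    have q2 := r2_le n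
    have q0 := Nat.unpair_right_le n
    refine ⟨?_, ?_, ?_, ?_, ?_, ?_, ?_, ?_⟩
    · intro ht hr
      simp only [c1 n le_rfl, c2 _ q2, c1 _ (pair_p0_le n ht), eval_pred_var]
      obtain ⟨r, e⟩ := Nat.exists_eq_succ_of_ne_zero hr
      rw [e, dec]
      simp [ht, e, eval_eqc, tmDec, EModel.eval, EModel.tmVal]
    · intro ht h1 h2
      simp only [c1 n le_rfl]
      rw [dec]
      simp [ht, h1, h2, tmDec, EModel.eval]
    · intro ht h1 h2
      simp only [c1 n le_rfl, c2 _ q1]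
      obtain ⟨r, e⟩ := Nat.exists_eq_succ_of_ne_zero h1
      rw [e, Nat.succ_eq_add_one, eval_eqc, dec]
      simp [ht, e, h2, tmDec, EModel.eval, EModel.tmVal, eq_comm]
    · intro ht h1 h2
      simp only [c1 n le_rfl, c2 _ q1, c2 _ q2]
      obtain ⟨r, e⟩ := Nat.exists_eq_succ_of_ne_zero h1
      obtain ⟨r', e'⟩ := Nat.exists_eq_succ_of_ne_zero h2
      rw [e, e', dec]
      simp [ht, e, e', eval_eqc, tmDec, EModel.eval, EModel.tmVal]
    · intro ht
      simp only [c1 n le_rfl, c1 _ q0]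
      conv_lhs => rw [dec]
      simp [ht, EModel.eval]
    · intro ht
      simp only [c1 n le_rfl, c1 _ q1, c1 _ q2]
      conv_lhs => rw [dec]
      simp [ht, EModel.eval]
    · intro ht
      simp only [c1 n le_rfl, c1 _ q0]
      conv_lhs => rw [dec]
      simp [ht, EModel.eval, hdom]
    · intro ht
      simp only [c1 n le_rfl, c1 0 (Nat.zero_le _)]
      have := eval_pred_var 𝔪 0 (ι u) j
      simp only [show Nat.pair 0 (Nat.pair 0 0) = 0 from rfl] at this
      rw [this, dec]
      simp [show n.unpair.1 ≠ 0 by omega, show n.unpair.1 ≠ 1 by omega,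
        show n.unpair.1 ≠ 2 by omega, show n.unpair.1 ≠ 3 by omega,
        show n.unpair.1 ≠ 4 by omega, show n.unpair.1 ≠ 5 by omega, EModel.eval, EModel.tmVal]
  · simp only [hb _ (eqc_lt_BB (show k + 1 ≤ φ + 1 by omega)), eval_eqc]
    exact ⟨𝔪.cst (ι u) k, rfl, fun j' h => h⟩
  · have q2 := r2_le n
    simp only [hb n (lt_BB hn), hb _ (lt_BB (q2.trans hn))]
    conv_lhs => rw [dec]
    simp only [h5, EModel.eval]
    simp only [show (5:ℕ) ≠ 0 by omega, show (5:ℕ) ≠ 1 by omega, show (5:ℕ) ≠ 2 by omega,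
      show (5:ℕ) ≠ 3 by omega, show (5:ℕ) ≠ 4 by omega, if_false, dite_false, dite_true,
      EModel.eval]
    constructor
    · intro h i' hi'
      exact h _ ((hR _ _).2 ⟨i', hi', rfl⟩)
    · intro h w hw
      obtain ⟨i', hi', rfl⟩ := (hR _ _).1 hw
      exact h i' hi'

theorem model_of_mat (φ : ℕ) {U V : Type} (t : U → V → LL φ) (ht : MatOK φ t) (u0 : U) (v0 : V) :
    ∃ (𝔪 : EModel (⟨U, ⟨u0⟩, fun _ a b => a ≠ b⟩ : KFrame Unit)) (a : 𝔪.D), 𝔪.IsD .cd ∧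
      (bitL φ (t u0 v0) → 𝔪.eval (dec φ) u0 a) := by
  classical
  obtain ⟨hr, hc⟩ := ht
  have hk : ∀ u k, ∃ v, k ≤ φ → ∀ j, bitL (eqc (k + 1)) (t u j) ↔ j = v := by
    intro u k
    by_cases h : k ≤ φ
    · obtain ⟨j, hj, hu⟩ := (hr u).2 k h
      exact ⟨j, fun _ j' => ⟨hu j', fun e => e ▸ hj⟩⟩
    · exact ⟨v0, fun h' => absurd h' h⟩
  choose cs hcs using hk
  let 𝔪 : EModel (⟨U, ⟨u0⟩, fun _ a b => a ≠ b⟩ : KFrame Unit) :=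
    { D := V
      dom := fun _ => Set.univ
      domNe := fun _ => ⟨v0, trivial⟩
      expand := fun _ _ _ _ => subset_rfl
      I := fun u p => {v | bitL (Nat.pair 0 (Nat.pair p 0)) (t u v)}
      cst := cs
      cstMem := fun _ _ => trivial }
  have key : ∀ n, n ≤ φ → ∀ u v, bitL n (t u v) ↔ 𝔪.eval (dec n) u v := by
    intro n
    induction n using Nat.strong_induction_on with
    | _ n ih =>
    intro hn u v
    have hl := (hr u).1 n hn v
    have q1 := r1_le n
    have q2 := r2_le n
    have q0 := Nat.unpair_right_le n
    have ec : ∀ r, r ≠ 0 → r ≤ n → ∀ j, bitL (eqc r) (t u j) ↔ j = 𝔪.tmVal u v (tmDec r) := by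
      intro r h1 h2 j
      obtain ⟨r, rfl⟩ := Nat.exists_eq_succ_of_ne_zero h1
      exact hcs u r (by omega) j
    rw [dec]
    by_cases g0 : n.unpair.1 = 0
    · simp only [g0, if_true, EModel.eval]
      by_cases h2 : n.unpair.2.unpair.2 = 0
      · have e : n = Nat.pair 0 (Nat.pair n.unpair.2.unpair.1 0) := by
          conv_lhs => rw [← Nat.pair_unpair n, g0, ← Nat.pair_unpair n.unpair.2, h2]
        rw [h2]
        conv_lhs => rw [e]
        rfl
      · rw [hl.t0 g0 h2]
        simp only [ec _ h2 q2]
        constructor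
        · rintro ⟨j, rfl, h⟩; exact h
        · intro h; exact ⟨_, rfl, h⟩
    by_cases g1 : n.unpair.1 = 1
    · simp only [g1, if_true, EModel.eval]
      rw [if_neg (by omega)]
      simp only [EModel.eval]
      by_cases h1 : n.unpair.2.unpair.1 = 0
      · by_cases h2 : n.unpair.2.unpair.2 = 0
        · simp [hl.t1 g1 h1 h2, h1, h2]
        · have e : n = eqc n.unpair.2.unpair.2 := by
            unfold eqc
            conv_lhs => rw [← Nat.pair_unpair n, g1, ← Nat.pair_unpair n.unpair.2, h1]
          conv_lhs => rw [e]
          rw [ec _ h2 q2, h1]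
          rfl
      · by_cases h2 : n.unpair.2.unpair.2 = 0
        · rw [hl.t1' g1 h1 h2, ec _ h1 q1, h2]
          exact eq_comm
        · rw [hl.t1'' g1 h1 h2]
          simp only [ec _ h1 q1, ec _ h2 q2]
          simp
    by_cases g2 : n.unpair.1 = 2
    · have l := le_unpair_lt (n := n) (by omega)
      rw [hl.t2 g2, ih _ l (by omega)]
      simp [g2, EModel.eval]
    by_cases g3 : n.unpair.1 = 3
    · have l := le_unpair_lt (n := n) (by omega)
      have l1 := Nat.unpair_left_le n.unpair.2
      have l2 := Nat.unpair_right_le n.unpair.2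
      rw [hl.t3 g3, ih _ (l1.trans_lt l) (by omega), ih _ (l2.trans_lt l) (by omega)]
      simp [g3, EModel.eval]
    by_cases g4 : n.unpair.1 = 4
    · have l := le_unpair_lt (n := n) (by omega)
      rw [hl.t4 g4]
      simp only [ih _ l (by omega)]
      simp [g4, EModel.eval, 𝔪]
    by_cases g5 : n.unpair.1 = 5
    · have l := le_unpair_lt (n := n) (by omega)
      have l2 := Nat.unpair_right_le n.unpair.2
      refine (hc v n hn g5 u).trans ?_
      simp only [ih _ (l2.trans_lt l) (by omega)]
      simp [g5, EModel.eval]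
      exact ⟨fun h i hi => h i (Ne.symm hi), fun h i hi => h i (Ne.symm hi)⟩
    · rw [hl.t6 (by omega)]
      simp [g0, g1, g2, g3, g4, g5, EModel.eval]
      rfl
  exact ⟨𝔪, v0, fun _ _ => rfl, (key φ le_rfl u0 v0).1⟩

def SatD (φ : ℕ) : Prop := ∃ (U V : Type) (t : U → V → LL φ), MatOK φ t ∧
  ∃ u v, bitL φ (t u v)

def SatF (φ : ℕ) : Prop := ∃ (U V : Type) (_ : Finite U) (t : U → V → LL φ), MatOK φ t ∧
  ∃ u v, bitL φ (t u v)

theorem dec_neg (n : ℕ) : dec (Nat.pair 2 n) = .neg (dec n) := by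
  rw [dec]; simp

theorem dec_mem_D (n : ℕ) : dec n ∈ LogED .cd Dclass ↔ ¬ SatD (Nat.pair 2 n) := by
  constructor
  · rintro h ⟨U, V, t, ht, u, v, hb⟩
    obtain ⟨𝔪, a, hD, he⟩ := model_of_mat _ t ht u v
    have h1 := he hb
    rw [dec_neg] at h1
    refine h1 (h _ ⟨Unit, fun _ => (), fun w v => ?_⟩ 𝔪 hD u a ?_)
    · simp
    · rw [hD rfl]; trivial
  · rintro h F ⟨ι, f, hf⟩ 𝔪 hD w a ha
    by_contra hn
    obtain ⟨t, ht, hb⟩ := mat_of_model (Nat.pair 2 n) 𝔪 hD (U := {v // f v = f w}) (fun u => u.1)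
      (by
        rintro ⟨u, hu⟩ v
        rw [hf]
        constructor
        · rintro ⟨h1, h2⟩
          exact ⟨⟨v, h1.symm.trans hu⟩, fun h => h2 (congrArg Subtype.val h).symm, rfl⟩
        · rintro ⟨u', h1, rfl⟩
          exact ⟨hu.trans u'.2.symm, fun h => h1 (Subtype.ext h.symm)⟩) ⟨w, rfl⟩ a (by
        rw [dec_neg]; exact hn)
    exact h ⟨_, _, t, ht, _, _, hb⟩

theorem dec_mem_F (n : ℕ) : dec n ∈ LogED .cd DfinClass ↔ ¬ SatF (Nat.pair 2 n) := by
  constructor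
  · rintro h ⟨U, V, _, t, ht, u, v, hb⟩
    obtain ⟨𝔪, a, hD, he⟩ := model_of_mat _ t ht u v
    have h1 := he hb
    rw [dec_neg] at h1
    refine h1 (h _ ⟨Unit, fun _ => (), fun w v => ?_, fun w => Set.toFinite _⟩ 𝔪 hD u a ?_)
    · simp
    · rw [hD rfl]; trivial
  · rintro h F ⟨ι, f, hf, hfin⟩ 𝔪 hD w a ha
    by_contra hn
    obtain ⟨t, ht, hb⟩ := mat_of_model (Nat.pair 2 n) 𝔪 hD (U := {v // f v = f w}) (fun u => u.1)
      (by
        rintro ⟨u, hu⟩ v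
        rw [hf]
        constructor
        · rintro ⟨h1, h2⟩
          exact ⟨⟨v, h1.symm.trans hu⟩, fun h => h2 (congrArg Subtype.val h).symm, rfl⟩
        · rintro ⟨u', h1, rfl⟩
          exact ⟨hu.trans u'.2.symm, fun h => h1 (Subtype.ext h.symm)⟩) ⟨w, rfl⟩ a (by
        rw [dec_neg]; exact hn)
    exact h ⟨_, _, hfin w, t, ht, _, _, hb⟩

/-- bounded certificate, finite case -/
theorem satF_iff (φ : ℕ) : SatF φ ↔ ∃ m ≤ finBd (2 ^ BB φ), ∃ k ≤ finBd (2 ^ BB φ),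
    ∃ t : Fin m → Fin k → LL φ, MatOK φ t ∧ ∃ u v, bitL φ (t u v) := by
  classical
  constructor
  · rintro ⟨U, V, _, t, ⟨hr, hc⟩, u0, v0, hb⟩
    have := Fintype.ofFinite U
    choose wr hwr1 hwr2 using fun u => exists_wit (t u)
    let Vf : Finset V := insert v0 (Finset.univ.biUnion wr)
    have rowP : ∀ u, SameProf (t u) (fun v : Vf => t u v) := by
      intro u
      exact (hwr2 u).sameProf (fun v : Vf => v.1) Subtype.val_injective (fun i hi =>
        ⟨⟨i, Finset.mem_insert_of_mem (Finset.mem_biUnion.2 ⟨u, by simp, hi⟩)⟩, rfl⟩)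
    obtain ⟨U', V', _, _, T, hU, hV, h1, h2, u', v', e⟩ :=
      fin_bound (fun u (v : Vf) => t u v) u0 ⟨v0, by simp [Vf]⟩
    have hcard : Fintype.card (LL φ) = 2 ^ BB φ := by simp [LL]
    rw [hcard] at hU hV
    let eU := Fintype.equivFin U'
    let eV := Fintype.equivFin V'
    refine ⟨_, hU, _, hV, fun i j => T (eU.symm i) (eV.symm j), ⟨?_, ?_⟩, eU u', eV v', ?_⟩
    · intro u
      obtain ⟨w, hw⟩ := h1 (eU.symm u)
      have := (rowP w).trans (hw.trans (SameProf.of_equiv eV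
        (s' := fun j => T (eU.symm u) (eV.symm j)) (fun i => by simp)))
      exact RowB.inv this (fun n σ => bitL n σ) φ (hr w)
    · intro v
      obtain ⟨w, hw⟩ := h2 (eV.symm v)
      have := hw.trans (SameProf.of_equiv eU
        (s' := fun j => T (eU.symm j) (eV.symm v)) (fun i => by simp))
      exact ColB.inv this (fun n σ => bitL n σ) φ (hc w)
    · simpa [e] using hb
  · rintro ⟨m, -, k, -, t, ht, h⟩
    exact ⟨_, _, inferInstance, t, ht, h⟩

theorem satD_iff (φ : ℕ) : SatD φ ↔ ∃ m ≤ dBd (2 ^ BB φ), ∃ k ≤ dBd (2 ^ BB φ),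
    ∃ (t : Fin m → Fin k → LL φ) (W0 A G : Set (Fin m)) (D0 C H : Set (Fin k)),
      DCert t W0 A G D0 C H ∧
      (∀ u, (u ∈ W0 ∨ u ∈ A ∨ u ∈ G) → RowB φ (fun n v => bitL n (t u v))) ∧
      (∀ v, (v ∈ D0 ∨ v ∈ C ∨ v ∈ H) → ColB φ (fun n u => bitL n (t u v))) ∧
      ∃ u ∈ W0, ∃ v ∈ D0, bitL φ (t u v) := by
  classical
  constructor
  · rintro ⟨U, V, t, ⟨hr, hc⟩, u0, v0, hb⟩
    obtain ⟨U', V', _, _, T, W0, A, G, D0, C, H, hU, hV, hcert, h1, h2, u', hu', v', hv', e⟩ :=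
      d_complete t u0 v0
    have hcard : Fintype.card (LL φ) = 2 ^ BB φ := by simp [LL]
    rw [hcard] at hU hV
    obtain ⟨m, ⟨eU⟩⟩ := Finite.exists_equiv_fin U'
    obtain ⟨k, ⟨eV⟩⟩ := Finite.exists_equiv_fin V'
    obtain rfl : Fintype.card U' = m := by simpa using Fintype.card_congr eU
    obtain rfl : Fintype.card V' = k := by simpa using Fintype.card_congr eV
    have half : ∀ {U V U' V' L : Type} (eU : U ≃ U') (eV : V ≃ V') (q : U → V → L)
        (W0 A G : Set U) (D0 C H : Set V), DHalf q W0 A G D0 C H →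
        DHalf (fun u v => q (eU.symm u) (eV.symm v)) {u | eU.symm u ∈ W0} {u | eU.symm u ∈ A}
          {u | eU.symm u ∈ G} {u | eV.symm u ∈ D0} {u | eV.symm u ∈ C} {u | eV.symm u ∈ H} := by
      intro U V U' V' L eU eV q W0 A G D0 C H h
      refine ⟨?_, ?_, ?_, ?_⟩
      · intro w hw
        refine (SameProf.of_equiv eV.symm (by simp)).trans ((h.h1 _ hw).trans ?_)
        refine (SameProf.of_equiv (s := fun j : {j // eV.symm j ∈ D0 ∨ eV.symm j ∈ C} =>
          q (eU.symm w) (eV.symm j.1)) ?_ ?_).symm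
        · exact eV.symm.subtypeEquiv (by simp)
        · rintro ⟨i, hi⟩; rfl
      · intro j hj; exact h.h0 _ hj
      · intro w hw v hv
        have := h.h2 _ hw _ hv
        exact ((SameProf.of_equiv eV.symm (s := fun v => q (eU.symm w) (eV.symm v))
          (s' := q (eU.symm w)) (by simp)) _).2.2 this
      · intro i hi j hj
        obtain ⟨v, hv, i', hi', e⟩ := h.h3 _ hi _ hj
        exact ⟨eV v, by simpa using hv, eU i', by simpa using hi', by simpa using e⟩
    refine ⟨_, hU, _, hV, fun u v => T (eU.symm u) (eV.symm v), {u | eU.symm u ∈ W0},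
      {u | eU.symm u ∈ A},
          {u | eU.symm u ∈ G}, {u | eV.symm u ∈ D0}, {u | eV.symm u ∈ C}, {u | eV.symm u ∈ H},
      ⟨half eU eV _ _ _ _ _ _ _ hcert.hR, half eV eU _ _ _ _ _ _ _ hcert.hC, ?_⟩, ?_, ?_, ?_⟩
    · intro i hi j hj
      obtain ⟨σ, s1, s2⟩ := hcert.fill _ hi _ hj
      exact ⟨σ, ((SameProf.of_equiv eV.symm (s := fun v => T (eU.symm i) (eV.symm v))
          (s' := T (eU.symm i)) (by simp)) _).2.2 s1,
        ((SameProf.of_equiv eU.symm (s := fun u => T (eU.symm u) (eV.symm j))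
          (s' := fun u => T u (eV.symm j)) (by simp)) _).2.2 s2⟩
    · intro u hu
      obtain ⟨w, hw⟩ := h1 _ hu
      have := hw.trans (SameProf.of_equiv eV
        (s' := fun j => T (eU.symm u) (eV.symm j)) (fun i => by simp))
      exact RowB.inv this (fun n σ => bitL n σ) φ (hr w)
    · intro v hv
      obtain ⟨w, hw⟩ := h2 _ hv
      have := hw.trans (SameProf.of_equiv eU
        (s' := fun j => T (eU.symm j) (eV.symm v)) (fun i => by simp))
      exact ColB.inv this (fun n σ => bitL n σ) φ (hc w)
    · exact ⟨eU u', by simpa using hu', eV v', by simpa using hv', by simpa [e] using hb⟩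
  · rintro ⟨m, -, k, -, q, W0, A, G, D0, C, H, hcert, h1, h2, w, hw, a, ha, hb⟩
    obtain ⟨U', V', T, hR, hC, hcell⟩ := d_sound q W0 A G D0 C H hcert
    obtain ⟨u', v', e⟩ := hcell w hw a ha
    refine ⟨U', V', T, ⟨?_, ?_⟩, u', v', by rwa [e]⟩
    · intro u
      obtain ⟨x, hx, hp⟩ := hR u
      exact RowB.inv hp (fun n σ => bitL n σ) φ (h1 x hx)
    · intro u
      obtain ⟨x, hx, hp⟩ := hC u
      exact ColB.inv hp (fun n σ => bitL n σ) φ (h2 x hx)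

end OneVarEq

namespace OneVarEq

/-- primitive recursive functions (a wrapper used for automation) -/
@[fun_prop]
def PR {α β : Type} [Primcodable α] [Primcodable β] (f : α → β) : Prop := Primrec f

section PRsec
variable {α β γ : Type} [Primcodable α] [Primcodable β] [Primcodable γ]

@[fun_prop] theorem PR.id' : PR (fun a : α => a) := Primrec.id
@[fun_prop] theorem PR.const' (b : β) : PR (fun _ : α => b) := Primrec.const b
@[fun_prop] theorem PR.comp' {f : β → γ} {g : α → β} (hf : PR f) (hg : PR g) :
    PR (fun a => f (g a)) := Primrec.comp hf hg
@[fun_prop] theorem PR.fst' {f : α → β × γ} (hf : PR f) : PR (fun a => (f a).1) :=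
  Primrec.fst.comp hf
@[fun_prop] theorem PR.snd' {f : α → β × γ} (hf : PR f) : PR (fun a => (f a).2) :=
  Primrec.snd.comp hf
@[fun_prop] theorem PR.mk' {f : α → β} {g : α → γ} (hf : PR f) (hg : PR g) :
    PR (fun a => (f a, g a)) := Primrec.pair hf hg
@[fun_prop] theorem PR.add' {f g : α → ℕ} (hf : PR f) (hg : PR g) :
    PR (fun a => f a + g a) := Primrec.nat_add.comp hf hg
@[fun_prop] theorem PR.mul' {f g : α → ℕ} (hf : PR f) (hg : PR g) :
    PR (fun a => f a * g a) := Primrec.nat_mul.comp hf hg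
@[fun_prop] theorem PR.div' {f g : α → ℕ} (hf : PR f) (hg : PR g) :
    PR (fun a => f a / g a) := Primrec.nat_div.comp hf hg
@[fun_prop] theorem PR.mod' {f g : α → ℕ} (hf : PR f) (hg : PR g) :
    PR (fun a => f a % g a) := Primrec.nat_mod.comp hf hg
@[fun_prop] theorem PR.unpair' {f : α → ℕ} (hf : PR f) :
    PR (fun a => (f a).unpair) := Primrec.unpair.comp hf
@[fun_prop] theorem PR.pair' {f g : α → ℕ} (hf : PR f) (hg : PR g) :
    PR (fun a => Nat.pair (f a) (g a)) := Primrec₂.natPair.comp hf hg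

theorem pow_primrec₂ : Primrec₂ (fun a b : ℕ => a ^ b) :=
  Primrec₂.unpaired'.1 Nat.Primrec.pow
@[fun_prop] theorem PR.pow' {f g : α → ℕ} (hf : PR f) (hg : PR g) :
    PR (fun a => f a ^ g a) := pow_primrec₂.comp hf hg

theorem PR.iter {f : α → ℕ} {g : α → β} {h : α × β → β} (hf : PR f) (hg : PR g) (hh : PR h) :
    PR (fun a => (fun b => h (a, b))^[f a] (g a)) :=
  Primrec.nat_iterate (h := fun a b => h (a, b)) hf hg hh

theorem PP.lt {f g : α → ℕ} (hf : PR f) (hg : PR g) : PrimrecPred (fun a => f a < g a) :=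
  Primrec.nat_lt.comp hf hg
theorem PP.le {f g : α → ℕ} (hf : PR f) (hg : PR g) : PrimrecPred (fun a => f a ≤ g a) :=
  Primrec.nat_le.comp hf hg
theorem PP.eq {f g : α → ℕ} (hf : PR f) (hg : PR g) : PrimrecPred (fun a => f a = g a) :=
  Primrec.eq.comp hf hg
theorem PP.ne {f g : α → ℕ} (hf : PR f) (hg : PR g) : PrimrecPred (fun a => f a ≠ g a) :=
  (PP.eq hf hg).not
theorem PP.and {p q : α → Prop} (hp : PrimrecPred p) (hq : PrimrecPred q) :
    PrimrecPred (fun a => p a ∧ q a) := PrimrecPred.and hp hq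
theorem PP.or {p q : α → Prop} (hp : PrimrecPred p) (hq : PrimrecPred q) :
    PrimrecPred (fun a => p a ∨ q a) := PrimrecPred.or hp hq
theorem PP.not {p : α → Prop} (hp : PrimrecPred p) :
    PrimrecPred (fun a => ¬ p a) := PrimrecPred.not hp
theorem PP.imp {p q : α → Prop} (hp : PrimrecPred p) (hq : PrimrecPred q) :
    PrimrecPred (fun a => p a → q a) :=
  (PP.or (PP.not hp) hq).of_eq (fun _ => imp_iff_not_or.symm)
theorem PP.iff {p q : α → Prop} (hp : PrimrecPred p) (hq : PrimrecPred q) :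
    PrimrecPred (fun a => p a ↔ q a) :=
  (PP.and (PP.imp hp hq) (PP.imp hq hp)).of_eq (fun _ => iff_iff_implies_and_implies.symm)
theorem PP.all {f : α → ℕ} {p : α → ℕ → Prop} (hf : PR f)
    (hp : PrimrecPred (fun x : α × ℕ => p x.1 x.2)) :
    PrimrecPred (fun a => ∀ x < f a, p a x) := by
  have h : PrimrecRel (fun (x : ℕ) (a : α) => p a x) := by
    exact hp.comp (Primrec.pair Primrec.snd Primrec.fst)
  exact ((PrimrecRel.forall_mem_list h).comp (Primrec.list_range.comp hf) Primrec.id).of_eq (by simp)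
theorem PP.exi {f : α → ℕ} {p : α → ℕ → Prop} (hf : PR f)
    (hp : PrimrecPred (fun x : α × ℕ => p x.1 x.2)) :
    PrimrecPred (fun a => ∃ x < f a, p a x) := by
  have h : PrimrecRel (fun (x : ℕ) (a : α) => p a x) := by
    exact hp.comp (Primrec.pair Primrec.snd Primrec.fst)
  exact ((PrimrecRel.exists_mem_list h).comp (Primrec.list_range.comp hf) Primrec.id).of_eq (by simp)
theorem PP.alle {f : α → ℕ} {p : α → ℕ → Prop} (hf : PR f)
    (hp : PrimrecPred (fun x : α × ℕ => p x.1 x.2)) :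
    PrimrecPred (fun a => ∀ x ≤ f a, p a x) :=
  (PP.all (f := fun a => f a + 1) (by fun_prop) hp).of_eq
    (fun a => by simp only [Nat.lt_succ_iff])
theorem PP.exie {f : α → ℕ} {p : α → ℕ → Prop} (hf : PR f)
    (hp : PrimrecPred (fun x : α × ℕ => p x.1 x.2)) :
    PrimrecPred (fun a => ∃ x ≤ f a, p a x) :=
  (PP.exi (f := fun a => f a + 1) (by fun_prop) hp).of_eq
    (fun a => by simp only [Nat.lt_succ_iff])
end PRsec


/-! ### bounds -/

@[fun_prop] theorem PR.zM' {α : Type} [Primcodable α] {f : α → ℕ} (hf : PR f) :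
    PR (fun a => zM (f a)) := by unfold zM; fun_prop

theorem zN_iter (k P b : ℕ) :
    ((fun x : ℕ × ℕ => (x.1 * zM x.2, zM x.2 * x.2))^[k] (P, b)).1 = P * zN k b := by
  induction k generalizing P b with
  | zero => simp [zN]
  | succ k ih => rw [Function.iterate_succ_apply, ih, zN, mul_assoc]

@[fun_prop] theorem PR.zN' {α : Type} [Primcodable α] {f g : α → ℕ} (hf : PR f) (hg : PR g) :
    PR (fun a => zN (f a) (g a)) := by
  have h := PR.fst' (PR.iter (g := fun a => ((1 : ℕ), g a))
    (h := fun x : α × (ℕ × ℕ) => (x.2.1 * zM x.2.2, zM x.2.2 * x.2.2)) hf (by fun_prop)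
    (by fun_prop))
  have e : (fun a => zN (f a) (g a)) = fun a => ((fun x : ℕ × ℕ =>
    (x.1 * zM x.2, zM x.2 * x.2))^[f a] (1, g a)).1 := by
    funext a; rw [zN_iter, one_mul]
  rw [e]; exact h

@[fun_prop] theorem PR.finBd' {α : Type} [Primcodable α] {f : α → ℕ} (hf : PR f) :
    PR (fun a => finBd (f a)) := by
  have h1 : PR (fun a => coreBd (finF (f a)) (f a)) := by
    unfold coreBd finF finN1
    exact PR.iter (g := fun _ => 2) (h := fun x : α × ℕ => x.2 +
      ((2 * f x.1 * x.2 + 2 * f x.1) * zN (f x.1) 2 + 2 * f x.1)) (by fun_prop) (by fun_prop)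
      (by fun_prop)
  unfold finBd finN1 finN2
  fun_prop

@[fun_prop] theorem PR.dBd' {α : Type} [Primcodable α] {f : α → ℕ} (hf : PR f) :
    PR (fun a => dBd (f a)) := by
  have h1 : PR (fun a => coreBd (dF (f a)) (f a)) := by
    unfold coreBd dF
    exact PR.iter (g := fun _ => 2) (h := fun x : α × ℕ => x.2 +
      (2 * f x.1 * x.2 + 2 * f x.1)) (by fun_prop) (by fun_prop)
      (by fun_prop)
  unfold dBd dR
  fun_prop

@[fun_prop] theorem PR.BB' {α : Type} [Primcodable α] {f : α → ℕ} (hf : PR f) :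
    PR (fun a => BB (f a)) := by unfold BB; fun_prop
@[fun_prop] theorem PR.eqc' {α : Type} [Primcodable α] {f : α → ℕ} (hf : PR f) :
    PR (fun a => eqc (f a)) := by unfold eqc; fun_prop

/-! ### bounded forms of the matrix conditions -/

def RowN (φ k : ℕ) (b : ℕ → ℕ → Prop) : Prop :=
  (∀ n ≤ φ, ∀ j < k,
    (n.unpair.1 = 0 → n.unpair.2.unpair.2 ≠ 0 → (b n j ↔ ∃ j' < k, b (eqc n.unpair.2.unpair.2) j' ∧
      b (Nat.pair 0 (Nat.pair n.unpair.2.unpair.1 0)) j')) ∧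
    (n.unpair.1 = 1 → n.unpair.2.unpair.1 = 0 → n.unpair.2.unpair.2 = 0 → b n j) ∧
    (n.unpair.1 = 1 → n.unpair.2.unpair.1 ≠ 0 → n.unpair.2.unpair.2 = 0 →
      (b n j ↔ b (eqc n.unpair.2.unpair.1) j)) ∧
    (n.unpair.1 = 1 → n.unpair.2.unpair.1 ≠ 0 → n.unpair.2.unpair.2 ≠ 0 →
      (b n j ↔ ∃ j' < k, b (eqc n.unpair.2.unpair.1) j' ∧ b (eqc n.unpair.2.unpair.2) j')) ∧
    (n.unpair.1 = 2 → (b n j ↔ ¬ b n.unpair.2 j)) ∧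
    (n.unpair.1 = 3 → (b n j ↔ b n.unpair.2.unpair.1 j ∧ b n.unpair.2.unpair.2 j)) ∧
    (n.unpair.1 = 4 → (b n j ↔ ∃ j' < k, b n.unpair.2 j')) ∧
    (6 ≤ n.unpair.1 → (b n j ↔ b 0 j))) ∧
  ∀ i ≤ φ, ∃ j < k, b (eqc (i + 1)) j ∧ ∀ j' < k, b (eqc (i + 1)) j' → j' = j

def ColN (φ m : ℕ) (b : ℕ → ℕ → Prop) : Prop :=
  ∀ n ≤ φ, n.unpair.1 = 5 → ∀ i < m, (b n i ↔ ∀ i' < m, i' ≠ i → b n.unpair.2.unpair.2 i')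

theorem fin_all {k : ℕ} (p : ℕ → Prop) : (∀ i : Fin k, p i) ↔ ∀ i < k, p i :=
  ⟨fun h i hi => h ⟨i, hi⟩, fun h i => h i.1 i.2⟩
theorem fin_ex {k : ℕ} (p : ℕ → Prop) : (∃ i : Fin k, p i) ↔ ∃ i < k, p i :=
  ⟨fun ⟨i, h⟩ => ⟨i.1, i.2, h⟩, fun ⟨i, hi, h⟩ => ⟨⟨i, hi⟩, h⟩⟩

theorem locN_iff {k : ℕ} (b : ℕ → ℕ → Prop) (n tg r r1 r2 : ℕ) (j : Fin k) :
    LocN (fun n (v : Fin k) => b n v) n tg r r1 r2 j ↔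
    (tg = 0 → r2 ≠ 0 → (b n j ↔ ∃ j' < k, b (eqc r2) j' ∧ b (Nat.pair 0 (Nat.pair r1 0)) j')) ∧
    (tg = 1 → r1 = 0 → r2 = 0 → b n j) ∧
    (tg = 1 → r1 ≠ 0 → r2 = 0 → (b n j ↔ b (eqc r1) j)) ∧
    (tg = 1 → r1 ≠ 0 → r2 ≠ 0 → (b n j ↔ ∃ j' < k, b (eqc r1) j' ∧ b (eqc r2) j')) ∧
    (tg = 2 → (b n j ↔ ¬ b r j)) ∧
    (tg = 3 → (b n j ↔ b r1 j ∧ b r2 j)) ∧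
    (tg = 4 → (b n j ↔ ∃ j' < k, b r j')) ∧
    (6 ≤ tg → (b n j ↔ b 0 j)) := by
  have e0 := fin_ex (k := k) (fun j' => b (eqc r2) j' ∧ b (Nat.pair 0 (Nat.pair r1 0)) j')
  have e1 := fin_ex (k := k) (fun j' => b (eqc r1) j' ∧ b (eqc r2) j')
  have e2 := fin_ex (k := k) (fun j' => b r j')
  constructor
  · rintro ⟨a0, a1, a2, a3, a4, a5, a6, a7⟩
    rw [e0] at a0; rw [e1] at a3; rw [e2] at a6
    exact ⟨a0, a1, a2, a3, a4, a5, a6, a7⟩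
  · rintro ⟨a0, a1, a2, a3, a4, a5, a6, a7⟩
    rw [← e0] at a0; rw [← e1] at a3; rw [← e2] at a6
    exact ⟨a0, a1, a2, a3, a4, a5, a6, a7⟩

theorem rowB_iff (φ k : ℕ) (b : ℕ → ℕ → Prop) :
    RowB φ (fun n (v : Fin k) => b n v) ↔ RowN φ k b := by
  unfold RowB RowN LocC
  simp only [locN_iff]
  refine and_congr (forall₂_congr fun n _ => ?_) (forall₂_congr fun i _ => ?_)
  · exact ⟨fun h j hj => h ⟨j, hj⟩, fun h j => h j.1 j.2⟩
  · constructor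
    · rintro ⟨j, h, h'⟩
      exact ⟨j, j.2, h, fun j' hj' hh => congrArg Fin.val (h' ⟨j', hj'⟩ hh)⟩
    · rintro ⟨j, hj, h, h'⟩
      exact ⟨⟨j, hj⟩, h, fun j' hh => Fin.ext (h' j' j'.2 hh)⟩

theorem colB_iff (φ m : ℕ) (b : ℕ → ℕ → Prop) :
    ColB φ (fun n (v : Fin m) => b n v) ↔ ColN φ m b := by
  unfold ColB ColN
  refine forall₃_congr fun n _ _ => ?_
  constructor
  · intro h i hi
    refine (h ⟨i, hi⟩).trans ?_
    exact ⟨fun g i' hi' hne => g ⟨i', hi'⟩ (fun e => hne (congrArg Fin.val e)),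
      fun g i' hne => g i' i'.2 (fun e => hne (Fin.ext e))⟩
  · intro h i
    refine (h i i.2).trans ?_
    exact ⟨fun g i' hne => g i' i'.2 (fun e => hne (Fin.ext e)),
      fun g i' hi' hne => g ⟨i', hi'⟩ (fun e => hne (congrArg Fin.val e))⟩

theorem PP.rowN {α : Type} [Primcodable α] {f k : α → ℕ} {b : α → ℕ → ℕ → Prop}
    (hf : PR f) (hk : PR k)
    (hb : PrimrecPred (fun x : α × ℕ × ℕ => b x.1 x.2.1 x.2.2)) :
    PrimrecPred (fun a => RowN (f a) (k a) (b a)) := by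
  have hb' : ∀ {β : Type} [Primcodable β] {F : β → α} {g h : β → ℕ}, PR F → PR g → PR h →
      PrimrecPred (fun x => b (F x) (g x) (h x)) := fun hF hg hh =>
    hb.comp (f := fun x => (_, _, _)) (PR.mk' hF (PR.mk' hg hh))
  unfold RowN
  repeat' first
    | fun_prop
    | apply PP.and
    | apply PP.alle
    | apply PP.all
    | apply PP.exi
    | apply hb'
    | apply PP.ne
    | apply PP.not
    | apply PP.imp
    | apply PP.iff
    | apply PP.eq
    | apply PP.le

theorem PP.colN {α : Type} [Primcodable α] {f k : α → ℕ} {b : α → ℕ → ℕ → Prop}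
    (hf : PR f) (hk : PR k)
    (hb : PrimrecPred (fun x : α × ℕ × ℕ => b x.1 x.2.1 x.2.2)) :
    PrimrecPred (fun a => ColN (f a) (k a) (b a)) := by
  have hb' : ∀ {β : Type} [Primcodable β] {F : β → α} {g h : β → ℕ}, PR F → PR g → PR h →
      PrimrecPred (fun x => b (F x) (g x) (h x)) := fun hF hg hh =>
    hb.comp (f := fun x => (_, _, _)) (PR.mk' hF (PR.mk' hg hh))
  unfold ColN
  repeat' first
    | fun_prop
    | apply PP.and
    | apply PP.alle
    | apply PP.all
    | apply PP.exi
    | apply hb'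
    | apply PP.ne
    | apply PP.not
    | apply PP.imp
    | apply PP.iff
    | apply PP.eq
    | apply PP.le

/-! ### bounded form of the certificates -/

def HalfN (m k : ℕ) (E : ℕ → ℕ → ℕ → ℕ → Prop) (W0 A G D0 C H : ℕ → Prop) : Prop :=
  (∀ w < m, W0 w → (∀ j < k, ∃ j' < k, (D0 j' ∨ C j') ∧ E w j' w j) ∧
    (∀ j < k, ∀ j' < k, j ≠ j' → E w j w j' → ∃ j1 < k, ∃ j2 < k, (D0 j1 ∨ C j1) ∧
      (D0 j2 ∨ C j2) ∧ j1 ≠ j2 ∧ E w j1 w j ∧ E w j2 w j)) ∧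
  (∀ j < k, C j → ¬ D0 j) ∧
  (∀ w < m, W0 w → ∀ h < k, H h → ∃ i < k, ∃ j < k, i ≠ j ∧ E w i w h ∧ E w j w h) ∧
  (∀ i < m, (A i ∨ G i) → ∀ j < k, ¬ D0 j → ∃ h < k, H h ∧ ∃ i' < m, ¬ W0 i' ∧ E i' h i j)

def CertN (m k : ℕ) (E : ℕ → ℕ → ℕ → ℕ → Prop) (W0 A G D0 C H : ℕ → Prop) : Prop :=
  HalfN m k E W0 A G D0 C H ∧ HalfN k m (fun v u v' u' => E u v u' v') D0 C H W0 A G ∧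
  (∀ i < m, (A i ∨ G i) → ∀ j < k, (C j ∨ H j) → ∃ j1 < k, ∃ j2 < k, j1 ≠ j2 ∧ E i j1 i j2 ∧
    ∃ u1 < m, ∃ u2 < m, u1 ≠ u2 ∧ E u1 j u2 j ∧ E u1 j i j1)

theorem half_iff {m k : ℕ} {L : Type} (t : Fin m → Fin k → L) (E : ℕ → ℕ → ℕ → ℕ → Prop)
    (W0 A G D0 C H : ℕ → Prop) (hE : ∀ u v u' v', t u v = t u' v' ↔ E u v u' v') :
    DHalf t {u | W0 u} {u | A u} {u | G u} {v | D0 v} {v | C v} {v | H v} ↔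
      HalfN m k E W0 A G D0 C H := by
  constructor
  · rintro ⟨h1, h0, h2, h3⟩
    refine ⟨fun w hw hw0 => ⟨fun j hj => ?_, fun j hj j' hj' hne he => ?_⟩, fun j hj => h0 ⟨j, hj⟩,
      fun w hw hw0 h hh hH => ?_, fun i hi hA j hj hD => ?_⟩
    · obtain ⟨⟨j', h'⟩, e⟩ := (h1 ⟨w, hw⟩ hw0 (t ⟨w, hw⟩ ⟨j, hj⟩)).1.1 ⟨_, rfl⟩
      exact ⟨j'.1, j'.2, h', (hE _ _ _ _).1 e⟩
    · obtain ⟨⟨j1, h1'⟩, ⟨j2, h2'⟩, hne, e1, e2⟩ := (h1 ⟨w, hw⟩ hw0 (t ⟨w, hw⟩ ⟨j, hj⟩)).2.1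
        ⟨⟨j, hj⟩, ⟨j', hj'⟩, fun e => hne (congrArg Fin.val e), rfl, ((hE _ _ _ _).2 he).symm⟩
      exact ⟨j1, j1.2, j2, j2.2, h1', h2', fun e => hne (Subtype.ext (Fin.ext e)),
        (hE _ _ _ _).1 e1, (hE _ _ _ _).1 e2⟩
    · obtain ⟨i, j, hne, e1, e2⟩ := h2 ⟨w, hw⟩ hw0 ⟨h, hh⟩ hH
      exact ⟨i, i.2, j, j.2, fun e => hne (Fin.ext e), (hE _ _ _ _).1 e1, (hE _ _ _ _).1 e2⟩
    · obtain ⟨h, hh, i', hi', e⟩ := h3 ⟨i, hi⟩ hA ⟨j, hj⟩ hD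
      exact ⟨h, h.2, hh, i', i'.2, hi', (hE _ _ _ _).1 e⟩
  · rintro ⟨h1, h0, h2, h3⟩
    refine ⟨fun w hw0 σ => ⟨⟨?_, ?_⟩, ⟨?_, ?_⟩⟩, fun j hj => h0 j j.2 hj,
      fun w hw0 h hH => ?_, fun i hA j hD => ?_⟩
    · rintro ⟨j, rfl⟩
      obtain ⟨j', hj', h', e⟩ := (h1 w w.2 hw0).1 j j.2
      exact ⟨⟨⟨j', hj'⟩, h'⟩, (hE _ _ _ _).2 e⟩
    · rintro ⟨j, rfl⟩
      exact ⟨_, rfl⟩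
    · rintro ⟨j, j', hne, rfl, e⟩
      obtain ⟨j1, q1, j2, q2, d1, d2, hn, e1, e2⟩ := (h1 w w.2 hw0).2 j j.2 j' j'.2
        (fun h => hne (Fin.ext h)) ((hE _ _ _ _).1 e.symm)
      exact ⟨⟨⟨j1, q1⟩, d1⟩, ⟨⟨j2, q2⟩, d2⟩,
        fun h => hn (congrArg (fun x => x.1.1) h),
        (hE _ _ _ _).2 e1, (hE _ _ _ _).2 e2⟩
    · rintro ⟨j, j', hne, e, e'⟩
      exact ⟨j, j', fun h => hne (Subtype.ext h), e, e'⟩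
    · obtain ⟨i, hi, j, hj, hne, e1, e2⟩ := h2 w w.2 hw0 h h.2 hH
      exact ⟨⟨i, hi⟩, ⟨j, hj⟩, fun h => hne (congrArg Fin.val h),
        (hE _ _ _ _).2 e1, (hE _ _ _ _).2 e2⟩
    · obtain ⟨h, hh, hH, i', hi', hw, e⟩ := h3 i i.2 hA j j.2 hD
      exact ⟨⟨h, hh⟩, hH, ⟨i', hi'⟩, hw, (hE _ _ _ _).2 e⟩

theorem cert_iff {m k : ℕ} {L : Type} (t : Fin m → Fin k → L) (E : ℕ → ℕ → ℕ → ℕ → Prop)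
    (W0 A G D0 C H : ℕ → Prop) (hE : ∀ u v u' v', t u v = t u' v' ↔ E u v u' v') :
    DCert t {u | W0 u} {u | A u} {u | G u} {v | D0 v} {v | C v} {v | H v} ↔
      CertN m k E W0 A G D0 C H := by
  have e1 := half_iff t E W0 A G D0 C H hE
  have e2 := half_iff (fun v u => t u v) (fun v u v' u' => E u v u' v') D0 C H W0 A G
    (fun u v u' v' => hE _ _ _ _)
  constructor
  · rintro ⟨a, b, c⟩
    refine ⟨e1.1 a, e2.1 b, fun i hi hA j hj hC => ?_⟩
    obtain ⟨σ, ⟨j1, j2, hne, q1, q2⟩, ⟨u1, u2, hne', q3, q4⟩⟩ := c ⟨i, hi⟩ hA ⟨j, hj⟩ hC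
    exact ⟨j1, j1.2, j2, j2.2, fun h => hne (Fin.ext h), (hE ⟨i, hi⟩ j1 ⟨i, hi⟩ j2).1 (q1.trans q2.symm),
      u1, u1.2, u2, u2.2, fun h => hne' (Fin.ext h), (hE u1 ⟨j, hj⟩ u2 ⟨j, hj⟩).1 (q3.trans q4.symm),
      (hE u1 ⟨j, hj⟩ ⟨i, hi⟩ j1).1 (q3.trans q1.symm)⟩
  · rintro ⟨a, b, c⟩
    refine ⟨e1.2 a, e2.2 b, fun i hA j hC => ?_⟩
    obtain ⟨j1, l1, j2, l2, hne, q1, u1, l3, u2, l4, hne', q3, q4⟩ := c i i.2 hA j j.2 hC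
    have q1' := (hE i ⟨j1, l1⟩ i ⟨j2, l2⟩).2 q1
    have q3' := (hE ⟨u1, l3⟩ j ⟨u2, l4⟩ j).2 q3
    have q4' := (hE ⟨u1, l3⟩ j i ⟨j1, l1⟩).2 q4
    exact ⟨_, ⟨_, _, fun h => hne (congrArg Fin.val h), rfl, q1'.symm⟩,
      ⟨_, _, fun h => hne' (congrArg Fin.val h), q4', q3'.symm.trans q4'⟩⟩

theorem PP.halfN {α : Type} [Primcodable α] {m k : α → ℕ} {E : α → ℕ → ℕ → ℕ → ℕ → Prop}
    {W0 A G D0 C H : α → ℕ → Prop} (hm : PR m) (hk : PR k)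
    (hE : PrimrecPred (fun x : α × ℕ × ℕ × ℕ × ℕ => E x.1 x.2.1 x.2.2.1 x.2.2.2.1 x.2.2.2.2))
    (hW : PrimrecPred (fun x : α × ℕ => W0 x.1 x.2))
    (hA : PrimrecPred (fun x : α × ℕ => A x.1 x.2))
    (hG : PrimrecPred (fun x : α × ℕ => G x.1 x.2))
    (hD : PrimrecPred (fun x : α × ℕ => D0 x.1 x.2))
    (hC : PrimrecPred (fun x : α × ℕ => C x.1 x.2))
    (hH : PrimrecPred (fun x : α × ℕ => H x.1 x.2)) :
    PrimrecPred (fun a => HalfN (m a) (k a) (E a) (W0 a) (A a) (G a) (D0 a) (C a) (H a)) := by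
  have hE' : ∀ {β : Type} [Primcodable β] {F : β → α} {f1 f2 f3 f4 : β → ℕ}, PR F → PR f1 →
      PR f2 → PR f3 → PR f4 →
      PrimrecPred (fun x => E (F x) (f1 x) (f2 x) (f3 x) (f4 x)) := fun hF h1 h2 h3 h4 =>
    hE.comp (f := fun x => (_, _, _, _, _)) (PR.mk' hF (PR.mk' h1 (PR.mk' h2 (PR.mk' h3 h4))))
  have key : ∀ {P : α → ℕ → Prop}, PrimrecPred (fun x : α × ℕ => P x.1 x.2) →
    ∀ {β : Type} [Primcodable β] {F : β → α} {f : β → ℕ}, PR F → PR f →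
      PrimrecPred (fun x => P (F x) (f x)) := fun hP _ _ _ _ hF h1 =>
    hP.comp (f := fun x => (_, _)) (PR.mk' hF h1)
  unfold HalfN
  repeat' first
    | fun_prop
    | apply PP.and
    | apply PP.or
    | apply PP.all
    | apply PP.exi
    | apply hE'
    | apply key hW
    | apply key hA
    | apply key hG
    | apply key hD
    | apply key hC
    | apply key hH
    | apply PP.ne
    | apply PP.not
    | apply PP.imp

theorem PP.certN {α : Type} [Primcodable α] {m k : α → ℕ} {E : α → ℕ → ℕ → ℕ → ℕ → Prop}
    {W0 A G D0 C H : α → ℕ → Prop} (hm : PR m) (hk : PR k)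
    (hE : PrimrecPred (fun x : α × ℕ × ℕ × ℕ × ℕ => E x.1 x.2.1 x.2.2.1 x.2.2.2.1 x.2.2.2.2))
    (hW : PrimrecPred (fun x : α × ℕ => W0 x.1 x.2))
    (hA : PrimrecPred (fun x : α × ℕ => A x.1 x.2))
    (hG : PrimrecPred (fun x : α × ℕ => G x.1 x.2))
    (hD : PrimrecPred (fun x : α × ℕ => D0 x.1 x.2))
    (hC : PrimrecPred (fun x : α × ℕ => C x.1 x.2))
    (hH : PrimrecPred (fun x : α × ℕ => H x.1 x.2)) :
    PrimrecPred (fun a => CertN (m a) (k a) (E a) (W0 a) (A a) (G a) (D0 a) (C a) (H a)) := by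
  have hE' : ∀ {β : Type} [Primcodable β] {F : β → α} {f1 f2 f3 f4 : β → ℕ}, PR F → PR f1 →
      PR f2 → PR f3 → PR f4 →
      PrimrecPred (fun x => E (F x) (f1 x) (f2 x) (f3 x) (f4 x)) := fun hF h1 h2 h3 h4 =>
    hE.comp (f := fun x => (_, _, _, _, _)) (PR.mk' hF (PR.mk' h1 (PR.mk' h2 (PR.mk' h3 h4))))
  have key : ∀ {P : α → ℕ → Prop}, PrimrecPred (fun x : α × ℕ => P x.1 x.2) →
    ∀ {β : Type} [Primcodable β] {F : β → α} {f : β → ℕ}, PR F → PR f →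
      PrimrecPred (fun x => P (F x) (f x)) := fun hP _ _ _ _ hF h1 =>
    hP.comp (f := fun x => (_, _)) (PR.mk' hF h1)
  unfold CertN
  refine PP.and (PP.halfN hm hk hE hW hA hG hD hC hH) (PP.and
    (PP.halfN hk hm ?_ hD hC hH hW hA hG) ?_)
  · apply hE' <;> fun_prop
  repeat' first
    | fun_prop
    | apply PP.and
    | apply PP.or
    | apply PP.all
    | apply PP.exi
    | apply hE'
    | apply key hW
    | apply key hA
    | apply key hG
    | apply key hD
    | apply key hC
    | apply key hH
    | apply PP.ne
    | apply PP.not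
    | apply PP.imp

end OneVarEq

namespace OneVarEq

def tb (c n : ℕ) : Prop := c / 2 ^ n % 2 = 1

theorem PP.tb {α : Type} [Primcodable α] {f g : α → ℕ} (hf : PR f) (hg : PR g) :
    PrimrecPred (fun a => OneVarEq.tb (f a) (g a)) := by
  unfold OneVarEq.tb
  apply PP.eq <;> fun_prop

theorem tb_exists (p : ℕ → Prop) (M : ℕ) : ∃ c < 2 ^ M, ∀ n < M, tb c n ↔ p n := by
  classical
  refine ⟨Nat.ofBits (fun i : Fin M => decide (p i)), Nat.ofBits_lt_two_pow _, fun n hn => ?_⟩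
  have := Nat.testBit_ofBits_lt (fun i : Fin M => decide (p i)) n hn
  rw [Nat.testBit_eq_decide_div_mod_eq] at this
  simpa [tb] using this

/-! ### codes -/

def CodeLoc (c k : ℕ) : Prop :=
  k.unpair.1 ≤ 5 ∧ (k.unpair.1 = 2 → tb c k.unpair.2) ∧
  (k.unpair.1 = 3 → tb c k.unpair.2.unpair.1 ∧ tb c k.unpair.2.unpair.2) ∧
  (k.unpair.1 = 4 → tb c k.unpair.2) ∧
  (k.unpair.1 = 5 → k.unpair.2.unpair.1 = 0 ∧ tb c k.unpair.2.unpair.2)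

theorem code_step (k : ℕ) : EF.encode eU (dec k) = k ↔ k.unpair.1 ≤ 5 ∧
    (k.unpair.1 = 2 → EF.encode eU (dec k.unpair.2) = k.unpair.2) ∧
    (k.unpair.1 = 3 → EF.encode eU (dec k.unpair.2.unpair.1) = k.unpair.2.unpair.1 ∧
      EF.encode eU (dec k.unpair.2.unpair.2) = k.unpair.2.unpair.2) ∧
    (k.unpair.1 = 4 → EF.encode eU (dec k.unpair.2) = k.unpair.2) ∧
    (k.unpair.1 = 5 → k.unpair.2.unpair.1 = 0 ∧
      EF.encode eU (dec k.unpair.2.unpair.2) = k.unpair.2.unpair.2) := by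
  obtain ⟨⟨a, b⟩, rfl⟩ : ∃ p : ℕ × ℕ, k = Nat.pair p.1 p.2 := ⟨k.unpair, by simp⟩
  obtain ⟨⟨b, d⟩, rfl⟩ : ∃ p : ℕ × ℕ, b = Nat.pair p.1 p.2 := ⟨b.unpair, by simp⟩
  rw [dec]
  simp only [Nat.unpair_pair]
  rcases a with _ | _ | _ | _ | _ | _ | a
  · simp [EF.encode, code_tmDec]
  · simp [EF.encode, code_tmDec]
  all_goals simp [EF.encode, eU, ETm.code, eq_comm]

theorem code_iff (n : ℕ) : EF.encode eU (dec n) = n ↔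
    ∃ c < 2 ^ (n + 1), (∀ k ≤ n, tb c k → CodeLoc c k) ∧ tb c n := by
  constructor
  · intro h
    obtain ⟨c, hc, hb⟩ := tb_exists (fun k => EF.encode eU (dec k) = k) (n + 1)
    refine ⟨c, hc, fun k hk hck => ?_, (hb n (by omega)).2 h⟩
    have h1 := (code_step k).1 ((hb k (by omega)).1 hck)
    have q0 := Nat.unpair_right_le k
    have q1 := r1_le k
    have q2 := r2_le k
    unfold CodeLoc
    rw [hb _ (by omega), hb _ (by omega), hb _ (by omega)]
    exact h1
  · rintro ⟨c, -, h, hn⟩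
    have : ∀ k ≤ n, tb c k → EF.encode eU (dec k) = k := by
      intro k
      induction k using Nat.strong_induction_on with
      | _ k ih =>
        intro hk hc
        obtain ⟨h5, h2, h3, h4, h5'⟩ := h k hk hc
        have q0 := Nat.unpair_right_le k
        have q1 := r1_le k
        have q2 := r2_le k
        have l : 1 ≤ k.unpair.1 → k.unpair.2 < k := fun h => le_unpair_lt h
        have l1 := Nat.unpair_left_le k.unpair.2
        have l2 := Nat.unpair_right_le k.unpair.2
        rw [code_step]
        refine ⟨h5, fun e => ?_, fun e => ⟨?_, ?_⟩, fun e => ?_, fun e => ⟨(h5' e).1, ?_⟩⟩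
        · exact ih _ (by omega) (by omega) (h2 e)
        · exact ih _ (by omega) (by omega) (h3 e).1
        · exact ih _ (by omega) (by omega) (h3 e).2
        · exact ih _ (by omega) (by omega) (h4 e)
        · exact ih _ (by omega) (by omega) (h5' e).2
    exact this n le_rfl hn

theorem code_pp : PrimrecPred (fun n : ℕ => EF.encode eU (dec n) = n) := by
  simp only [code_iff]
  unfold CodeLoc
  repeat' first
    | fun_prop
    | apply PP.and
    | apply PP.alle
    | apply PP.exi
    | apply PP.tb
    | apply PP.imp
    | apply PP.eq
    | apply PP.le

theorem decidable_of (L : Set (EF Unit)) (S : ℕ → Prop) (hS : PrimrecPred S)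
    (h : ∀ n, dec n ∈ L ↔ ¬ S (Nat.pair 2 n)) : DecidableELogic eU L := by
  unfold DecidableELogic
  have : PrimrecPred (fun n : ℕ => EF.encode eU (dec n) = n ∧ ¬ S (Nat.pair 2 n)) := by
    refine PP.and code_pp (PP.not (hS.comp (f := fun n => Nat.pair 2 n) ?_))
    exact Primrec₂.natPair.comp (Primrec.const 2) Primrec.id
  refine PrimrecPred.computablePred (this.of_eq fun n => ?_)
  rw [← h]
  constructor
  · rintro ⟨h1, h2⟩
    exact ⟨_, h2, h1⟩
  · rintro ⟨φ, h1, rfl⟩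
    rw [dec_encode]
    exact ⟨rfl, h1⟩

/-! ### cells -/

def cl (φ c u v n : ℕ) : Prop := n < BB φ ∧ tb c (Nat.pair 0 (Nat.pair u (Nat.pair v n)))

open Classical in
noncomputable def tOf (φ c m k : ℕ) : Fin m → Fin k → LL φ :=
  fun u v n => decide (tb c (Nat.pair 0 (Nat.pair u (Nat.pair v n))))

theorem bitL_tOf {φ c m k : ℕ} (u : Fin m) (v : Fin k) (n : ℕ) :
    bitL n (tOf φ c m k u v) ↔ cl φ c u v n := by
  simp [bitL, tOf, cl]

def clE (φ c u v u' v' : ℕ) : Prop := ∀ n < BB φ,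
  (tb c (Nat.pair 0 (Nat.pair u (Nat.pair v n))) ↔ tb c (Nat.pair 0 (Nat.pair u' (Nat.pair v' n))))

theorem tOf_eq {φ c m k : ℕ} (u : Fin m) (v : Fin k) (u' v') :
    tOf φ c m k u v = tOf φ c m k u' v' ↔ clE φ c u v u' v' := by
  unfold clE tOf
  rw [funext_iff]
  simp only [decide_eq_decide]
  exact ⟨fun h n hn => h ⟨n, hn⟩, fun h n => h n n.2⟩

def MM (φ B : ℕ) : ℕ := Nat.pair 7 (Nat.pair B (Nat.pair B (BB φ)))

theorem pair_left_mono' (b : ℕ) : Monotone (fun a => Nat.pair a b) :=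
  StrictMono.monotone (fun _ _ h => Nat.pair_lt_pair_left b h)
theorem pair_right_mono' (a : ℕ) : Monotone (fun b => Nat.pair a b) :=
  StrictMono.monotone (fun _ _ h => Nat.pair_lt_pair_right a h)

theorem tb_exists2 (P : ℕ → ℕ → Prop) (M : ℕ) :
    ∃ c < 2 ^ M, ∀ s y, Nat.pair s y < M → (tb c (Nat.pair s y) ↔ P s y) := by
  obtain ⟨c, hc, h⟩ := tb_exists (fun x => P x.unpair.1 x.unpair.2) M
  refine ⟨c, hc, fun s y hy => ?_⟩
  have := h _ hy
  simpa only [Nat.unpair_pair] using this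

def cellP {φ m k : ℕ} (t : Fin m → Fin k → LL φ) (y : ℕ) : Prop :=
  ∃ (hu : y.unpair.1 < m) (hv : y.unpair.2.unpair.1 < k),
      bitL y.unpair.2.unpair.2 (t ⟨_, hu⟩ ⟨_, hv⟩)

theorem cellP_iff {φ m k : ℕ} (t : Fin m → Fin k → LL φ) (u : Fin m) (v : Fin k) (n : Fin (BB φ)) :
    cellP t (Nat.pair u (Nat.pair v n)) ↔ t u v n = true := by
  unfold cellP bitL
  constructor
  · rintro ⟨h1, h2, h3, h4⟩
    simpa only [Nat.unpair_pair] using h4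
  · intro h
    simp only [Nat.unpair_pair]
    exact ⟨u.2, v.2, n.2, h⟩

theorem pair_le_pair {a b c d : ℕ} (h : a ≤ c) (h' : b ≤ d) : Nat.pair a b ≤ Nat.pair c d :=
  ((pair_left_mono' b) h).trans ((pair_right_mono' c) h')

theorem lt_MM0 {φ B u v n : ℕ} (hu : u ≤ B) (hv : v ≤ B) (hn : n < BB φ) :
    Nat.pair 0 (Nat.pair u (Nat.pair v n)) < MM φ B :=
  (pair_le_pair le_rfl (pair_le_pair hu (pair_le_pair hv hn.le))).trans_lt
    (Nat.pair_lt_pair_left _ (by omega))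

theorem lt_MM1 {φ B s u : ℕ} (hs : s < 7) (hu : u ≤ B) : Nat.pair s u < MM φ B :=
  (pair_le_pair le_rfl (hu.trans (Nat.left_le_pair _ _))).trans_lt (Nat.pair_lt_pair_left _ hs)

theorem satF_iff2 (φ : ℕ) : SatF φ ↔ ∃ m ≤ finBd (2 ^ BB φ), ∃ k ≤ finBd (2 ^ BB φ),
    ∃ c < 2 ^ (MM φ (finBd (2 ^ BB φ))),
      ((∀ u < m, RowN φ k (fun n v => cl φ c u v n)) ∧
        (∀ v < k, ColN φ m (fun n u => cl φ c u v n))) ∧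
      ∃ u < m, ∃ v < k, cl φ c u v φ := by
  rw [satF_iff]
  generalize finBd (2 ^ BB φ) = B
  refine exists_congr fun m => and_congr_right fun hm => exists_congr fun k =>
    and_congr_right fun hk => ?_
  have key : ∀ c, (MatOK φ (tOf φ c m k) ∧ ∃ u v, bitL φ (tOf φ c m k u v)) ↔
      ((∀ u < m, RowN φ k (fun n v => cl φ c u v n)) ∧
        (∀ v < k, ColN φ m (fun n u => cl φ c u v n))) ∧
      ∃ u < m, ∃ v < k, cl φ c u v φ := by
    intro c
    unfold MatOK
    simp only [bitL_tOf]
    refine and_congr (and_congr ?_ ?_) ?_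
    · rw [← fin_all (fun u => RowN φ k (fun n v => cl φ c u v n))]
      exact forall_congr' fun u => rowB_iff φ k (fun n v => cl φ c u v n)
    · rw [← fin_all (fun v => ColN φ m (fun n u => cl φ c u v n))]
      exact forall_congr' fun v => colB_iff φ m (fun n u => cl φ c u v n)
    · rw [← fin_ex (fun u => ∃ v < k, cl φ c u v φ)]
      exact exists_congr fun u => fin_ex (fun v => cl φ c u v φ)
  constructor
  · rintro ⟨t, h⟩
    obtain ⟨c, hc, hb⟩ := tb_exists2 (fun s y => cellP t y) (MM φ B)
    have : tOf φ c m k = t := by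
      funext u v n
      have := (hb _ _ (lt_MM0 (u.2.le.trans hm) (v.2.le.trans hk) n.2)).trans (cellP_iff t u v n)
      rw [Bool.eq_iff_iff, ← this]; simp only [tOf, decide_eq_true_eq]
    rw [← this] at h
    exact ⟨c, hc, (key c).1 h⟩
  · rintro ⟨c, hc, h⟩
    exact ⟨_, (key c).2 h⟩

theorem satD_iff2 (φ : ℕ) : SatD φ ↔ ∃ m ≤ dBd (2 ^ BB φ), ∃ k ≤ dBd (2 ^ BB φ),
    ∃ c < 2 ^ (MM φ (dBd (2 ^ BB φ))),
      CertN m k (clE φ c) (fun u => tb c (Nat.pair 1 u)) (fun u => tb c (Nat.pair 2 u))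
        (fun u => tb c (Nat.pair 3 u)) (fun u => tb c (Nat.pair 4 u))
        (fun u => tb c (Nat.pair 5 u)) (fun u => tb c (Nat.pair 6 u)) ∧
      (∀ u < m, (tb c (Nat.pair 1 u) ∨ tb c (Nat.pair 2 u) ∨ tb c (Nat.pair 3 u)) →
        RowN φ k (fun n v => cl φ c u v n)) ∧
      (∀ v < k, (tb c (Nat.pair 4 v) ∨ tb c (Nat.pair 5 v) ∨ tb c (Nat.pair 6 v)) →
        ColN φ m (fun n u => cl φ c u v n)) ∧
      ∃ u < m, tb c (Nat.pair 1 u) ∧ ∃ v < k, tb c (Nat.pair 4 v) ∧ cl φ c u v φ := by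
  rw [satD_iff]
  generalize dBd (2 ^ BB φ) = B
  refine exists_congr fun m => and_congr_right fun hm => exists_congr fun k =>
    and_congr_right fun hk => ?_
  have key : ∀ c, (DCert (tOf φ c m k) {u | tb c (Nat.pair 1 u)} {u | tb c (Nat.pair 2 u)}
      {u | tb c (Nat.pair 3 u)} {u | tb c (Nat.pair 4 u)} {u | tb c (Nat.pair 5 u)}
      {u | tb c (Nat.pair 6 u)} ∧
      (∀ u : Fin m, (tb c (Nat.pair 1 u) ∨ tb c (Nat.pair 2 u) ∨ tb c (Nat.pair 3 u)) →
        RowB φ (fun n v => bitL n (tOf φ c m k u v))) ∧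
      (∀ v : Fin k, (tb c (Nat.pair 4 v) ∨ tb c (Nat.pair 5 v) ∨ tb c (Nat.pair 6 v)) →
        ColB φ (fun n u => bitL n (tOf φ c m k u v))) ∧
      ∃ u : Fin m, tb c (Nat.pair 1 u) ∧ ∃ v : Fin k, tb c (Nat.pair 4 v) ∧
        bitL φ (tOf φ c m k u v)) ↔
      (CertN m k (clE φ c) (fun u => tb c (Nat.pair 1 u)) (fun u => tb c (Nat.pair 2 u))
        (fun u => tb c (Nat.pair 3 u)) (fun u => tb c (Nat.pair 4 u))
        (fun u => tb c (Nat.pair 5 u)) (fun u => tb c (Nat.pair 6 u)) ∧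
      (∀ u < m, (tb c (Nat.pair 1 u) ∨ tb c (Nat.pair 2 u) ∨ tb c (Nat.pair 3 u)) →
        RowN φ k (fun n v => cl φ c u v n)) ∧
      (∀ v < k, (tb c (Nat.pair 4 v) ∨ tb c (Nat.pair 5 v) ∨ tb c (Nat.pair 6 v)) →
        ColN φ m (fun n u => cl φ c u v n)) ∧
      ∃ u < m, tb c (Nat.pair 1 u) ∧ ∃ v < k, tb c (Nat.pair 4 v) ∧ cl φ c u v φ) := by
    intro c
    simp only [bitL_tOf]
    refine and_congr ?_ (and_congr ?_ (and_congr ?_ ?_))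
    · exact cert_iff (tOf φ c m k) (clE φ c) (fun u => tb c (Nat.pair 1 u))
        (fun u => tb c (Nat.pair 2 u))
        (fun u => tb c (Nat.pair 3 u)) (fun u => tb c (Nat.pair 4 u))
        (fun u => tb c (Nat.pair 5 u)) (fun u => tb c (Nat.pair 6 u)) (fun u v u' v' => tOf_eq u v u' v')
    · rw [← fin_all (fun u => (tb c (Nat.pair 1 u) ∨ tb c (Nat.pair 2 u) ∨ tb c (Nat.pair 3 u)) →
        RowN φ k (fun n v => cl φ c u v n))]
      exact forall_congr' fun u => imp_congr_right fun _ => rowB_iff φ k (fun n v => cl φ c u v n)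
    · rw [← fin_all (fun v => (tb c (Nat.pair 4 v) ∨ tb c (Nat.pair 5 v) ∨ tb c (Nat.pair 6 v)) →
        ColN φ m (fun n u => cl φ c u v n))]
      exact forall_congr' fun v => imp_congr_right fun _ => colB_iff φ m (fun n u => cl φ c u v n)
    · rw [← fin_ex (fun u => tb c (Nat.pair 1 u) ∧ ∃ v < k, tb c (Nat.pair 4 v) ∧ cl φ c u v φ)]
      exact exists_congr fun u => and_congr_right fun _ =>
        fin_ex (fun v => tb c (Nat.pair 4 v) ∧ cl φ c u v φ)
  constructor
  · rintro ⟨t, W0, A, G, D0, C, H, h⟩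
    obtain ⟨c, hc, hb⟩ := tb_exists2 (fun s y => match s with
      | 0 => cellP t y
      | 1 => ∃ hu : y < m, ⟨_, hu⟩ ∈ W0
      | 2 => ∃ hu : y < m, ⟨_, hu⟩ ∈ A
      | 3 => ∃ hu : y < m, ⟨_, hu⟩ ∈ G
      | 4 => ∃ hu : y < k, ⟨_, hu⟩ ∈ D0
      | 5 => ∃ hu : y < k, ⟨_, hu⟩ ∈ C
      | _ => ∃ hu : y < k, ⟨_, hu⟩ ∈ H) (MM φ B)
    have e0 : tOf φ c m k = t := by
      funext u v n
      have := (hb 0 _ (lt_MM0 (u.2.le.trans hm) (v.2.le.trans hk) n.2)).trans (cellP_iff t u v n)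
      rw [Bool.eq_iff_iff, ← this]; simp only [tOf, decide_eq_true_eq]
    have e1 : {u : Fin m | tb c (Nat.pair 1 u)} = W0 := by
      ext u
      refine (hb 1 u (lt_MM1 (by omega) (u.2.le.trans hm))).trans ⟨fun h => h.2, fun h => ⟨u.2, h⟩⟩
    have e2 : {u : Fin m | tb c (Nat.pair 2 u)} = A := by
      ext u
      refine (hb 2 u (lt_MM1 (by omega) (u.2.le.trans hm))).trans ⟨fun h => h.2, fun h => ⟨u.2, h⟩⟩
    have e3 : {u : Fin m | tb c (Nat.pair 3 u)} = G := by
      ext u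
      refine (hb 3 u (lt_MM1 (by omega) (u.2.le.trans hm))).trans ⟨fun h => h.2, fun h => ⟨u.2, h⟩⟩
    have e4 : {u : Fin k | tb c (Nat.pair 4 u)} = D0 := by
      ext u
      refine (hb 4 u (lt_MM1 (by omega) (u.2.le.trans hk))).trans ⟨fun h => h.2, fun h => ⟨u.2, h⟩⟩
    have e5 : {u : Fin k | tb c (Nat.pair 5 u)} = C := by
      ext u
      refine (hb 5 u (lt_MM1 (by omega) (u.2.le.trans hk))).trans ⟨fun h => h.2, fun h => ⟨u.2, h⟩⟩
    have e6 : {u : Fin k | tb c (Nat.pair 6 u)} = H := by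
      ext u
      refine (hb 6 u (lt_MM1 (by omega) (u.2.le.trans hk))).trans ⟨fun h => h.2, fun h => ⟨u.2, h⟩⟩
    refine ⟨c, hc, (key c).1 ?_⟩
    subst e0 e1 e2 e3 e4 e5 e6
    exact h
  · rintro ⟨c, hc, h⟩
    exact ⟨_, _, _, _, _, _, _, (key c).2 h⟩

@[fun_prop] theorem PR.MM' {α : Type} [Primcodable α] {f g : α → ℕ} (hf : PR f) (hg : PR g) :
    PR (fun a => MM (f a) (g a)) := by unfold MM; fun_prop

theorem PP.cl {α : Type} [Primcodable α] {f c u v n : α → ℕ} (hf : PR f) (hc : PR c)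
    (hu : PR u) (hv : PR v) (hn : PR n) :
    PrimrecPred (fun a => OneVarEq.cl (f a) (c a) (u a) (v a) (n a)) := by
  unfold OneVarEq.cl
  refine PP.and (PP.lt hn (by fun_prop)) (PP.tb hc (by fun_prop))

theorem PP.clE {α : Type} [Primcodable α] {f c u v u' v' : α → ℕ} (hf : PR f) (hc : PR c)
    (hu : PR u) (hv : PR v) (hu' : PR u') (hv' : PR v') :
    PrimrecPred (fun a => OneVarEq.clE (f a) (c a) (u a) (v a) (u' a) (v' a)) := by
  unfold OneVarEq.clE
  exact PP.all (by fun_prop) (PP.iff (PP.tb (by fun_prop) (by fun_prop))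
    (PP.tb (by fun_prop) (by fun_prop)))

theorem satF_pp : PrimrecPred SatF := by
  refine PrimrecPred.of_eq ?_ (fun φ => (satF_iff2 φ).symm)
  repeat' first
    | fun_prop
    | with_reducible apply PP.exie
    | with_reducible apply PP.exi
    | with_reducible apply PP.all
    | with_reducible apply PP.cl
    | with_reducible apply PP.certN
    | with_reducible apply PP.rowN
    | with_reducible apply PP.colN
    | with_reducible apply PP.and
    | with_reducible apply PP.or

theorem satD_pp : PrimrecPred SatD := by
  refine PrimrecPred.of_eq ?_ (fun φ => (satD_iff2 φ).symm)
  repeat' first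
    | fun_prop
    | with_reducible apply PP.exie
    | with_reducible apply PP.exi
    | with_reducible apply PP.all
    | with_reducible apply PP.tb
    | with_reducible apply PP.cl
    | with_reducible apply PP.clE
    | with_reducible apply PP.certN
    | with_reducible apply PP.rowN
    | with_reducible apply PP.colN
    | with_reducible apply PP.and
    | with_reducible apply PP.or
    | with_reducible apply PP.imp

theorem decD : DecidableELogic eU (LogED DSem.cd Dclass) := decidable_of _ _ satD_pp dec_mem_D
theorem decF : DecidableELogic eU (LogED DSem.cd DfinClass) := decidable_of _ _ satF_pp dec_mem_F
end OneVarEq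

namespace OneVarEq

/-! ### formulas -/

abbrev UU := Unit ⊕ Unit
abbrev Fm := EF UU

def md : Bool → UU
  | true => .inr ()
  | false => .inl ()
def dm : UU → Bool
  | .inr _ => true
  | .inl _ => false
theorem dm_md (d : Bool) : dm (md d) = d := by cases d <;> rfl

def ix (d : Bool) (i : ℕ) : ℕ := 2 * i + d.toNat
theorem ix_inj {d d' : Bool} {i j : ℕ} : ix d i = ix d' j ↔ d = d' ∧ i = j := by
  unfold ix
  cases d <;> cases d' <;> simp <;> omega

def EF.dia {M : Type} (m : M) (φ : EF M) : EF M := .neg (.box m (.neg φ))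
def EF.conj {M : Type} : List (EF M) → EF M
  | [] => .eq .var .var
  | φ :: l => .and φ (EF.conj l)

section evals
variable {M : Type} {F : KFrame M} (𝔪 : EModel F)

theorem eval_neg (φ : EF M) (w a) : 𝔪.eval (.neg φ) w a ↔ ¬ 𝔪.eval φ w a := Iff.rfl
theorem eval_and (φ ψ : EF M) (w a) : 𝔪.eval (.and φ ψ) w a ↔ 𝔪.eval φ w a ∧ 𝔪.eval ψ w a := Iff.rfl
theorem eval_box (m) (φ : EF M) (w a) :
    𝔪.eval (.box m φ) w a ↔ ∀ v, F.R m w v → 𝔪.eval φ v a := Iff.rfl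
theorem eval_imp (φ ψ : EF M) (w a) :
    𝔪.eval (EF.imp φ ψ) w a ↔ (𝔪.eval φ w a → 𝔪.eval ψ w a) := by
  simp [EF.imp, EModel.eval]
theorem eval_or (φ ψ : EF M) (w a) :
    𝔪.eval (EF.or φ ψ) w a ↔ (𝔪.eval φ w a ∨ 𝔪.eval ψ w a) := by
  simp only [EF.or, EModel.eval]; tauto
theorem eval_iff (φ ψ : EF M) (w a) :
    𝔪.eval (EF.iff φ ψ) w a ↔ (𝔪.eval φ w a ↔ 𝔪.eval ψ w a) := by
  simp only [EF.iff, eval_and, eval_imp]; tauto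
theorem eval_dia (m) (φ : EF M) (w a) :
    𝔪.eval (EF.dia m φ) w a ↔ ∃ v, F.R m w v ∧ 𝔪.eval φ v a := by
  simp [EF.dia, EModel.eval]
theorem eval_conj (l : List (EF M)) (w a) :
    𝔪.eval (EF.conj l) w a ↔ ∀ φ ∈ l, 𝔪.eval φ w a := by
  induction l with
  | nil => simp [EF.conj, EModel.eval]
  | cons φ l ih => simp [EF.conj, EModel.eval, ih]
theorem eval_pv (k) (w a) : 𝔪.eval (.pred k .var) w a ↔ a ∈ 𝔪.I w k := Iff.rfl
theorem eval_ex (hD : 𝔪.IsD .cd) (φ : EF M) (w a) : 𝔪.eval (.ex φ) w a ↔ ∃ b, 𝔪.eval φ w b := by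
  simp [EModel.eval, hD rfl w]
theorem eval_all (hD : 𝔪.IsD .cd) (φ : EF M) (w a) : 𝔪.eval (EF.all φ) w a ↔ ∀ b, 𝔪.eval φ w b := by
  simp [EF.all, EModel.eval, hD rfl w]
end evals

def PV (d : Bool) (i : ℕ) : Fm := .pred (ix d i) .var

def rigF (d : Bool) (i j : ℕ) : Fm :=
  .and (EF.all (EF.imp (PV d i) (.box (md d) (PV (!d) j))))
    (EF.all (EF.imp (.neg (PV d i)) (.box (md d) (.neg (PV (!d) j)))))

def sumF (d : Bool) (i j : ℕ) : Fm :=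
  .and (EF.all (EF.iff (PV d i) (EF.dia (md d) (PV (!d) j))))
    (EF.all (.neg (EF.dia (md d) (.and (PV (!d) j) (EF.dia (md d) (PV (!d) j))))))

def rowF (d : Bool) (j : ℕ) (G : Fm) : Fm := EF.all (.box (md d) (EF.imp (PV (!d) j) G))

theorem eval_rigF {F : KFrame UU} (𝔪 : EModel F) (hD : 𝔪.IsD .cd) (d i j w a) :
    𝔪.eval (rigF d i j) w a ↔ ∀ v, F.R (md d) w v → 𝔪.I v (ix (!d) j) = 𝔪.I w (ix d i) := by
  simp only [rigF, eval_and, eval_all 𝔪 hD, eval_imp, eval_box, eval_neg, PV, eval_pv]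
  constructor
  · rintro ⟨h1, h2⟩ v hv
    ext x
    by_cases hx : x ∈ 𝔪.I w (ix d i)
    · simp [hx, h1 x hx v hv]
    · simp [hx, h2 x hx v hv]
  · intro h
    exact ⟨fun x hx v hv => by rw [h v hv]; exact hx, fun x hx v hv => by rw [h v hv]; exact hx⟩

theorem eval_sumF {F : KFrame UU} (𝔪 : EModel F) (hD : 𝔪.IsD .cd) (d i j w a) :
    𝔪.eval (sumF d i j) w a ↔
      (∀ x, x ∈ 𝔪.I w (ix d i) ↔ ∃ v, F.R (md d) w v ∧ x ∈ 𝔪.I v (ix (!d) j)) ∧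
      ∀ x v u, F.R (md d) w v → F.R (md d) v u → x ∈ 𝔪.I v (ix (!d) j) →
        x ∈ 𝔪.I u (ix (!d) j) → False := by
  simp only [sumF, eval_and, eval_all 𝔪 hD, eval_iff, eval_dia, eval_neg, PV, eval_pv]
  refine and_congr_right fun _ => ?_
  constructor
  · intro h x v u h1 h2 h3 h4
    exact h x ⟨v, h1, h3, u, h2, h4⟩
  · rintro h x ⟨v, h1, h3, u, h2, h4⟩
    exact h x v u h1 h2 h3 h4

theorem eval_rowF {F : KFrame UU} (𝔪 : EModel F) (hD : 𝔪.IsD .cd) (d j G w a) :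
    𝔪.eval (rowF d j G) w a ↔
      ∀ x v, F.R (md d) w v → x ∈ 𝔪.I v (ix (!d) j) → 𝔪.eval G v x := by
  simp only [rowF, eval_all 𝔪 hD, eval_box, eval_imp, PV, eval_pv]

/-! ### tree models -/

structure Lab (M : ℕ) where
  P : ℕ → Set (Fin M)
  c : ℕ → Fin M

def lev {M : ℕ} : List (Fin M) → Bool
  | [] => true
  | _ :: p => !lev p

def comp {M : ℕ} (d : Bool) (p : List (Fin M)) : List (Fin M) := if lev p = d then p else p.tail

abbrev treeFrame (M : ℕ) : KFrame UU where
  W := List (Fin M)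
  ne := ⟨[]⟩
  R := fun m p q => comp (dm m) p = comp (dm m) q ∧ p ≠ q

theorem comp_finite {M : ℕ} (d : Bool) (q : List (Fin M)) : {v | comp d v = q}.Finite := by
  refine Set.Finite.subset ((Set.finite_singleton q).union ((Set.finite_singleton []).union
    (Set.finite_range (fun i : Fin M => i :: q)))) ?_
  intro v hv
  simp only [comp, Set.mem_ofPred_eq] at hv
  split_ifs at hv with h
  · exact .inl hv
  · rcases v with _ | ⟨i, v⟩
    · exact .inr (.inl rfl)
    · exact .inr (.inr ⟨i, by simp at hv; simp [hv]⟩)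

theorem treeFrame_mem (M : ℕ) : treeFrame M ∈ frameFusion Dclass DfinClass := by
  refine ⟨⟨List (Fin M), comp false, fun w v => Iff.rfl⟩,
    ⟨List (Fin M), comp true, fun w v => Iff.rfl, fun w => comp_finite _ _⟩⟩

theorem tree_R {M : ℕ} {d : Bool} {p : List (Fin M)} (hp : lev p = d) (q : List (Fin M)) :
    (treeFrame M).R (md d) p q ↔ ∃ i, q = i :: p := by
  simp only [dm_md, comp, hp, if_true]
  constructor
  · rintro ⟨h, hne⟩
    split_ifs at h with h1
    · exact absurd h hne
    · rcases q with _ | ⟨i, q⟩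
      · exact absurd h hne
      · exact ⟨i, by rw [h]; rfl⟩
  · rintro ⟨i, rfl⟩
    simp [lev, hp]

theorem tree_R2 {M : ℕ} {d : Bool} {p : List (Fin M)} (hp : lev p = d) (i) (q : List (Fin M)) :
    (treeFrame M).R (md d) (i :: p) q ↔ q = p ∨ ∃ i', i' ≠ i ∧ q = i' :: p := by
  simp only [dm_md, comp, lev, hp]
  simp only [Bool.not_eq_self, if_false, List.tail_cons]
  constructor
  · rintro ⟨h, hne⟩
    split_ifs at h with h1
    · exact .inl h.symm
    · rcases q with _ | ⟨i', q⟩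
      · exact .inl h.symm
      · simp at h; subst h
        exact .inr ⟨i', fun e => hne (by rw [e]), rfl⟩
  · rintro (rfl | ⟨i', hi, rfl⟩)
    · simp [hp]
    · simp [lev, hp, Ne.symm hi]

abbrev treeModel {M : ℕ} (Λ : List (Fin M) → Lab M) : EModel (treeFrame M) where
  D := Fin M
  dom := fun _ => Set.univ
  domNe := fun w => ⟨(Λ w).c 0, trivial⟩
  expand := fun _ _ _ _ => le_rfl
  I := fun w k => (Λ w).P k
  cst := fun w k => (Λ w).c k
  cstMem := fun _ _ => trivial

theorem treeModel_isD {M : ℕ} (Λ : List (Fin M) → Lab M) : (treeModel Λ).IsD .cd := fun _ _ => rfl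

def rootP {M n : ℕ} (d : Bool) (Q : Fin n → Set (Fin M)) : ℕ → Set (Fin M) :=
  fun k => {x | ∃ i : Fin n, k = ix d i ∧ x ∈ Q i}

theorem rootP_same {M n : ℕ} (d : Bool) (Q : Fin n → Set (Fin M)) (i : Fin n) :
    rootP d Q (ix d i) = Q i := by
  ext x
  simp only [rootP, Set.mem_ofPred_eq, ix_inj]
  constructor
  · rintro ⟨j, ⟨-, h⟩, hx⟩
    rwa [Fin.ext h]
  · exact fun h => ⟨i, ⟨trivial, rfl⟩, h⟩

theorem rootP_diff {M n : ℕ} (d : Bool) (Q : Fin n → Set (Fin M)) (i : ℕ) :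
    rootP d Q (ix (!d) i) = ∅ := by
  ext x
  simp only [rootP, Set.mem_ofPred_eq, ix_inj, Set.mem_empty_iff_false, iff_false]
  rintro ⟨j, ⟨h, -⟩, -⟩
  simp at h

/-! ### expressible sets -/

def Sound {n : ℕ} (S : (Fin n → ℕ) → Prop) (Φ : Bool → Fm) : Prop :=
  ∀ (F : KFrame UU), F ∈ frameFusion Dclass DfinClass → ∀ (𝔪 : EModel F), 𝔪.IsD .cd → Finite 𝔪.D →
    ∀ d w a, 𝔪.eval (Φ d) w a → S (fun i => (𝔪.I w (ix d i)).ncard)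

def Real {M n : ℕ} (Φ : Bool → Fm) (d : Bool) (Q : Fin n → Set (Fin M))
    (L : List (Fin M) → Lab M) : Prop :=
  (L []).P = rootP d Q ∧ ∀ (Λ : List (Fin M) → Lab M) (p : List (Fin M)), lev p = d →
    (∀ q, Λ (q ++ p) = L q) → ∀ a, (treeModel Λ).eval (Φ d) p a

def Compl {n : ℕ} (S : (Fin n → ℕ) → Prop) (Φ : Bool → Fm) : Prop :=
  ∀ v, S v → ∃ M0, ∀ M ≥ M0, ∀ Q : Fin n → Set (Fin M), (∀ i, (Q i).ncard = v i) →
    ∀ d, ∃ L : List (Fin M) → Lab M, Real Φ d Q L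

def Ex {n : ℕ} (S : (Fin n → ℕ) → Prop) : Prop := ∃ Φ, Sound S Φ ∧ Compl S Φ

theorem fusion_R {F : KFrame UU} (hF : F ∈ frameFusion Dclass DfinClass) (d : Bool) :
    ∃ (ι : Type) (f : F.W → ι), ∀ w v, F.R (md d) w v ↔ (f w = f v ∧ w ≠ v) := by
  cases d with
  | false => exact hF.1
  | true =>
    obtain ⟨ι, f, h, _⟩ := hF.2
    exact ⟨ι, f, h⟩

theorem fusion_R3 {F : KFrame UU} (hF : F ∈ frameFusion Dclass DfinClass) {d : Bool} {w u v : F.W}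
    (h1 : F.R (md d) w u) (h2 : F.R (md d) w v) (hne : u ≠ v) : F.R (md d) u v := by
  obtain ⟨ι, f, h⟩ := fusion_R hF d
  rw [h] at h1 h2 ⊢
  exact ⟨h1.1.symm.trans h2.1, hne⟩

/-- gluing labelled trees under a new root -/
def glue {M : ℕ} (r : Lab M) (L : Fin M → List (Fin M) → Lab M) (q : List (Fin M)) : Lab M :=
  if h : q = [] then r else L (q.getLast h) q.dropLast

theorem glue_nil {M : ℕ} (r : Lab M) (L) : glue r L [] = r := by simp [glue]
theorem glue_snoc {M : ℕ} (r : Lab M) (L) (q i) : glue r L (q ++ [i]) = L i q := by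
  simp [glue]

theorem glue_child {M : ℕ} {r : Lab M} {L} {Λ : List (Fin M) → Lab M} {p}
    (h : ∀ q, Λ (q ++ p) = glue r L q) (i : Fin M) (q) : Λ (q ++ (i :: p)) = L i q := by
  have := h (q ++ [i])
  rw [glue_snoc] at this
  rw [← this]; simp

theorem glue_root {M : ℕ} {r : Lab M} {L} {Λ : List (Fin M) → Lab M} {p}
    (h : ∀ q, Λ (q ++ p) = glue r L q) : Λ p = r := by
  have := h []
  rwa [glue_nil] at this

theorem ex_or {n : ℕ} {S T : (Fin n → ℕ) → Prop} (hS : Ex S) (hT : Ex T) :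
    Ex (fun v => S v ∨ T v) := by
  obtain ⟨Φ, s1, c1⟩ := hS
  obtain ⟨Ψ, s2, c2⟩ := hT
  refine ⟨fun d => EF.or (Φ d) (Ψ d), ?_, ?_⟩
  · intro F hF 𝔪 hD hfin d w a h
    rw [eval_or] at h
    exact h.imp (s1 F hF 𝔪 hD hfin d w a) (s2 F hF 𝔪 hD hfin d w a)
  · rintro v (hv | hv)
    · obtain ⟨M0, h⟩ := c1 v hv
      refine ⟨M0, fun M hM Q hQ d => ?_⟩
      obtain ⟨L, hL, h'⟩ := h M hM Q hQ d
      exact ⟨L, hL, fun Λ p hp hq a => (eval_or _ _ _ _ _).2 (.inl (h' Λ p hp hq a))⟩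
    · obtain ⟨M0, h⟩ := c2 v hv
      refine ⟨M0, fun M hM Q hQ d => ?_⟩
      obtain ⟨L, hL, h'⟩ := h M hM Q hQ d
      exact ⟨L, hL, fun Λ p hp hq a => (eval_or _ _ _ _ _).2 (.inr (h' Λ p hp hq a))⟩

theorem ex_zero : Ex (fun v : Fin 1 → ℕ => v 0 = 0) := by
  refine ⟨fun d => EF.all (.neg (PV d 0)), ?_, ?_⟩
  · intro F hF 𝔪 hD hfin d w a h
    simp only [eval_all 𝔪 hD, eval_neg, PV, eval_pv] at h
    rw [Set.ncard_eq_zero]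
    exact Set.eq_empty_of_forall_notMem h
  · intro v hv
    refine ⟨1, fun M hM Q hQ d => ⟨fun _ => ⟨rootP d Q, fun _ => ⟨0, hM⟩⟩, rfl, ?_⟩⟩
    intro Λ p hp hq a
    have h0 := hq []
    simp only [eval_all _ (treeModel_isD Λ), eval_neg, PV, eval_pv]
    intro b hb
    have hb : b ∈ (Λ p).P (ix d 0) := hb
    rw [List.nil_append] at h0
    rw [h0] at hb
    have e := rootP_same d Q 0
    have hb' : b ∈ Q 0 := by rw [← e]; exact hb
    have := hQ 0
    rw [hv, Set.ncard_eq_zero] at this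
    rw [this] at hb'
    exact hb'

theorem ex_one : Ex (fun v : Fin 1 → ℕ => v 0 = 1) := by
  refine ⟨fun d => .and (.ex (PV d 0)) (EF.all (EF.imp (PV d 0) (.eq .var (.const 0)))), ?_, ?_⟩
  · intro F hF 𝔪 hD hfin d w a h
    simp only [eval_and, eval_ex 𝔪 hD, eval_all 𝔪 hD, eval_imp, PV, eval_pv] at h
    obtain ⟨⟨x, hx⟩, h⟩ := h
    rw [Set.ncard_eq_one]
    refine ⟨𝔪.cst w 0, Set.eq_singleton_iff_unique_mem.2 ⟨?_, fun y hy => h y hy⟩⟩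
    have : x = 𝔪.cst w 0 := h x hx
    rw [← this]; exact hx
  · intro v hv
    refine ⟨1, fun M hM Q hQ d => ?_⟩
    have := hQ 0
    rw [hv, Set.ncard_eq_one] at this
    obtain ⟨x, hx⟩ := this
    refine ⟨fun _ => ⟨rootP d Q, fun _ => x⟩, rfl, ?_⟩
    intro Λ p hp hq a
    have h0 := hq []
    rw [List.nil_append] at h0
    simp only [eval_and, eval_ex _ (treeModel_isD Λ), eval_all _ (treeModel_isD Λ), eval_imp,
      PV, eval_pv]
    have e : (Λ p).P (ix d 0) = {x} := by
      rw [h0, ← hx]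
      exact rootP_same d Q 0
    rw [e]
    refine ⟨⟨x, rfl⟩, ?_⟩
    rintro b rfl
    change b = (Λ p).c 0
    rw [h0]

theorem exists_set {M k : ℕ} (h : k ≤ M) : ∃ A : Set (Fin M), A.ncard = k := by
  obtain ⟨A, -, hA⟩ := Finset.exists_subset_card_eq (s := (Finset.univ : Finset (Fin M))) (n := k)
    (by simpa using h)
  exact ⟨A, by rw [Set.ncard_coe_finset, hA]⟩

/-- two children, one for each of the sets, with rigid copies -/
theorem ex_and2 {n m : ℕ} {S T : (Fin m → ℕ) → Prop} (r : Fin m → Option (Fin n))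
    (hS : Ex S) (hT : Ex T) :
    Ex (fun v : Fin n → ℕ => (∃ u, S u ∧ ∀ j i, r j = some i → u j = v i) ∧
      (∃ u, T u ∧ ∀ j i, r j = some i → u j = v i)) := by
  obtain ⟨Φ, s1, c1⟩ := hS
  obtain ⟨Ψ, s2, c2⟩ := hT
  refine ⟨fun d => .and (EF.conj ((List.finRange m).map (fun j => match r j with
    | none => .eq .var .var
    | some i => rigF d i j))) (.and (EF.dia (md d) (Φ (!d))) (EF.dia (md d) (Ψ (!d)))), ?_, ?_⟩
  · intro F hF 𝔪 hD hfin d w a h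
    simp only [eval_and, eval_dia, eval_conj] at h
    obtain ⟨h0, ⟨v1, hv1, h1⟩, ⟨v2, hv2, h2⟩⟩ := h
    have key : ∀ v, F.R (md d) w v → ∀ j i, r j = some i →
        (𝔪.I v (ix (!d) j)).ncard = (𝔪.I w (ix d i)).ncard := by
      intro v hv j i hji
      have := h0 _ (List.mem_map.2 ⟨j, List.mem_finRange j, rfl⟩)
      rw [hji] at this
      simp only [eval_rigF 𝔪 hD] at this
      rw [this v hv]
    exact ⟨⟨_, s1 F hF 𝔪 hD hfin _ _ _ h1, key v1 hv1⟩, ⟨_, s2 F hF 𝔪 hD hfin _ _ _ h2, key v2 hv2⟩⟩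
  · rintro v ⟨⟨u1, hu1, e1⟩, ⟨u2, hu2, e2⟩⟩
    obtain ⟨M1, h1⟩ := c1 u1 hu1
    obtain ⟨M2, h2⟩ := c2 u2 hu2
    refine ⟨M1 + M2 + (∑ j, u1 j) + (∑ j, u2 j) + 2, fun M hM Q hQ d => ?_⟩
    have mk : ∀ u : Fin m → ℕ, (∀ j i, r j = some i → u j = v i) → (∑ j, u j) ≤ M →
        ∃ A : Fin m → Set (Fin M), (∀ j, (A j).ncard = u j) ∧ ∀ j i, r j = some i → A j = Q i := by
      intro u e hle
      have : ∀ j, ∃ A : Set (Fin M), A.ncard = u j ∧ ∀ i, r j = some i → A = Q i := by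
        intro j
        rcases hj : r j with _ | i
        · obtain ⟨A, hA⟩ := exists_set (M := M) (k := u j)
            ((Finset.single_le_sum (f := u) (fun _ _ => Nat.zero_le _) (Finset.mem_univ j)).trans hle)
          exact ⟨A, hA, by simp⟩
        · refine ⟨Q i, by rw [hQ, e j i hj], ?_⟩
          rintro _ ⟨⟩; rfl
      choose A hA using this
      exact ⟨A, fun j => (hA j).1, fun j => (hA j).2⟩
    obtain ⟨A1, hA1, q1⟩ := mk u1 e1 (by omega)
    obtain ⟨A2, hA2, q2⟩ := mk u2 e2 (by omega)
    obtain ⟨L1, g1, f1⟩ := h1 M (by omega) A1 hA1 (!d)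
    obtain ⟨L2, g2, f2⟩ := h2 M (by omega) A2 hA2 (!d)
    let i0 : Fin M := ⟨0, by omega⟩
    let i1 : Fin M := ⟨1, by omega⟩
    have hne : i1 ≠ i0 := by simp [i0, i1, Fin.ext_iff]
    refine ⟨glue ⟨rootP d Q, fun _ => i0⟩ (fun i => if i = i0 then L1 else L2), ?_, ?_⟩
    · rw [glue_nil]
    intro Λ p hp hq a
    have hr := glue_root hq
    have hc := glue_child hq
    simp only [eval_and, eval_dia, eval_conj]
    refine ⟨?_, ⟨i0 :: p, (tree_R hp _).2 ⟨_, rfl⟩, ?_⟩, ⟨i1 :: p, (tree_R hp _).2 ⟨_, rfl⟩, ?_⟩⟩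
    · intro φ hφ
      obtain ⟨j, -, rfl⟩ := List.mem_map.1 hφ
      rcases hj : r j with _ | i
      · rfl
      · simp only [eval_rigF _ (treeModel_isD Λ)]
        intro w hw
        obtain ⟨k, rfl⟩ := (tree_R hp _).1 hw
        have := hc k []
        rw [List.nil_append] at this
        change (Λ (k :: p)).P _ = (Λ p).P _
        rw [hr, this]
        simp only [rootP_same]
        split_ifs
        · rw [g1, rootP_same, q1 j i hj]
        · rw [g2, rootP_same, q2 j i hj]
    · refine f1 Λ _ (by simp [lev, hp]) (fun q => ?_) a
      rw [hc i0 q]; simp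
    · refine f2 Λ _ (by simp [lev, hp]) (fun q => ?_) a
      rw [hc i1 q]; simp [hne]
end OneVarEq

namespace OneVarEq

inductive Role (n : ℕ)
  | free
  | rig (i : Fin n)
  | sum (i : Fin n)

def StarSet {n m : ℕ} (role : Fin m → Role n) (S : (Fin m → ℕ) → Prop) (v : Fin n → ℕ) : Prop :=
  ∃ l : List (Fin m → ℕ), (∀ u ∈ l, S u) ∧ (∀ j i, role j = .rig i → ∀ u ∈ l, u j = v i) ∧
    ∀ j i, role j = .sum i → (l.map (fun u => u j)).sum = v i

theorem exists_partition {M N : ℕ} (X : Set (Fin M)) (f : Fin N → ℕ) (h : ∑ t, f t = X.ncard) :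
    ∃ A : Fin N → Set (Fin M), (∀ t, (A t).ncard = f t) ∧ (∀ x, x ∈ X ↔ ∃ t, x ∈ A t) ∧
      ∀ t t' x, x ∈ A t → x ∈ A t' → t = t' := by
  classical
  have hc : Fintype.card X = Fintype.card (Σ t, Fin (f t)) := by
    rw [Fintype.card_sigma]
    simp only [Fintype.card_fin]
    rw [h, Set.ncard_eq_toFinset_card', Set.toFinset_card]
  let e := Fintype.equivOfCardEq hc
  refine ⟨fun t => Set.range (fun y : Fin (f t) => (e.symm ⟨t, y⟩).1), ?_, ?_, ?_⟩
  · intro t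
    beta_reduce
    rw [← Set.image_univ, Set.ncard_image_of_injective, Set.ncard_univ, Nat.card_fin]
    intro a b hab
    have := e.symm.injective (Subtype.ext hab)
    simpa using this
  · intro x
    constructor
    · intro hx
      refine ⟨(e ⟨x, hx⟩).1, (e ⟨x, hx⟩).2, ?_⟩
      simp
    · rintro ⟨t, y, rfl⟩
      exact (e.symm ⟨t, y⟩).2
  · rintro t t' x ⟨y, rfl⟩ ⟨y', h'⟩
    have := e.symm.injective (Subtype.ext h')
    exact (congrArg Sigma.fst this).symm

def starF {n m : ℕ} (role : Fin m → Role n) (Φ : Bool → Fm) (d : Bool) : Fm :=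
  EF.conj ((List.finRange m).map (fun j => match role j with
    | .free => .eq .var .var
    | .rig i => rigF d i j
    | .sum i => .and (sumF d i j) (rowF d j (Φ (!d)))))

theorem star_sound {n m : ℕ} {S : (Fin m → ℕ) → Prop} (role : Fin m → Role n) {Φ : Bool → Fm}
    (s1 : Sound S Φ) : Sound (StarSet role S) (starF role Φ) := by
  classical
  intro F hF 𝔪 hD hfin d w a h
  simp only [starF, eval_conj] at h
  have hrig : ∀ j i, role j = .rig i → ∀ v, F.R (md d) w v →
      𝔪.I v (ix (!d) j) = 𝔪.I w (ix d i) := by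
    intro j i hj
    have := h _ (List.mem_map.2 ⟨j, List.mem_finRange j, rfl⟩)
    rw [hj] at this
    simpa only [eval_rigF 𝔪 hD] using this
  have hsum : ∀ j i, role j = .sum i →
      ((∀ x, x ∈ 𝔪.I w (ix d i) ↔ ∃ v, F.R (md d) w v ∧ x ∈ 𝔪.I v (ix (!d) j)) ∧
      ∀ x v u, F.R (md d) w v → F.R (md d) v u → x ∈ 𝔪.I v (ix (!d) j) →
        x ∈ 𝔪.I u (ix (!d) j) → False) ∧ 
      ∀ x v, F.R (md d) w v → x ∈ 𝔪.I v (ix (!d) j) → 𝔪.eval (Φ (!d)) v x := by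
    intro j i hj
    have := h _ (List.mem_map.2 ⟨j, List.mem_finRange j, rfl⟩)
    rw [hj] at this
    simpa only [eval_and, eval_sumF 𝔪 hD, eval_rowF 𝔪 hD] using this
  have hdis : ∀ j i, role j = .sum i → ∀ x v u, F.R (md d) w v → F.R (md d) w u →
      x ∈ 𝔪.I v (ix (!d) j) → x ∈ 𝔪.I u (ix (!d) j) → v = u := by
    intro j i hj x v u hv hu h1 h2
    by_contra hne
    exact (hsum j i hj).1.2 x v u hv (fusion_R3 hF hv hu hne) h1 h2
  set s : Set F.W := {v | F.R (md d) w v ∧ ∃ j i, role j = .sum i ∧ (𝔪.I v (ix (!d) j)).Nonempty}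
    with hs
  have sfin : s.Finite := by
    refine Set.Finite.subset (s := ⋃ j : Fin m, ⋃ x : 𝔪.D,
      {v | F.R (md d) w v ∧ (∃ i, role j = .sum i) ∧ x ∈ 𝔪.I v (ix (!d) j)}) ?_ ?_
    · refine Set.finite_iUnion fun j => Set.finite_iUnion fun x => Set.Subsingleton.finite ?_
      rintro v ⟨hv, ⟨i, hi⟩, hx⟩ u ⟨hu, -, hx'⟩
      exact hdis j i hi x v u hv hu hx hx'
    · rintro v ⟨hv, j, i, hi, x, hx⟩
      exact Set.mem_iUnion.2 ⟨j, Set.mem_iUnion.2 ⟨x, hv, ⟨i, hi⟩, hx⟩⟩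
  have mem : ∀ v, v ∈ sfin.toFinset.toList ↔ v ∈ s := by simp
  refine ⟨sfin.toFinset.toList.map (fun v j => (𝔪.I v (ix (!d) j)).ncard), ?_, ?_, ?_⟩
  · intro u hu
    obtain ⟨v, hv, rfl⟩ := List.mem_map.1 hu
    obtain ⟨hv, j, i, hi, x, hx⟩ := (mem v).1 hv
    exact s1 F hF 𝔪 hD hfin _ _ _ ((hsum j i hi).2 x v hv hx)
  · intro j i hj u hu
    obtain ⟨v, hv, rfl⟩ := List.mem_map.1 hu
    have hv := ((mem v).1 hv).1
    change Set.ncard _ = _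
    rw [hrig j i hj v hv]
  · intro j i hj
    rw [List.map_map]
    change (List.map (fun v => (𝔪.I v (ix (!d) j)).ncard) sfin.toFinset.toList).sum = _
    rw [Finset.sum_map_toList]
    have : Fintype 𝔪.D := Fintype.ofFinite _
    have e : ∀ X : Set 𝔪.D, X.ncard = X.toFinset.card := fun X => Set.ncard_eq_toFinset_card' X
    simp only [e]
    rw [← Finset.card_biUnion]
    · congr 1
      ext x
      simp only [Finset.mem_biUnion, Set.mem_toFinset, Set.Finite.mem_toFinset]
      rw [(hsum j i hj).1.1 x]
      constructor
      · rintro ⟨v, hv, hx⟩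
        exact ⟨v, hv.1, hx⟩
      · rintro ⟨v, hv, hx⟩
        exact ⟨v, ⟨hv, j, i, hj, x, hx⟩, hx⟩
    · intro v hv u hu hne
      rw [Function.onFun, Finset.disjoint_left]
      intro x hx hx'
      simp only [Set.mem_toFinset] at hx hx'
      simp only [Finset.mem_coe, Set.Finite.mem_toFinset] at hv hu
      exact hne (hdis j i hj x v u hv.1 hu.1 hx hx')

theorem star_compl {n m : ℕ} {S : (Fin m → ℕ) → Prop} (role : Fin m → Role n) {Φ : Bool → Fm}
    (c1 : Compl S Φ) : Compl (StarSet role S) (starF role Φ) := by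
  rintro v ⟨l, hl, hrig, hsum⟩
  set N := l.length with hN
  let U : Fin N → Fin m → ℕ := fun t => l.get t
  have hU : ∀ t, U t ∈ l := fun t => List.get_mem _ _
  have hUs : ∀ j, (l.map (fun u => u j)).sum = ∑ t, U t j := by
    intro j
    rw [← List.sum_ofFn]
    congr 1
    apply List.ext_getElem <;> simp [U, hN]
  have := fun t => c1 (U t) (hl _ (hU t))
  choose M1 hM1 using this
  refine ⟨N + (1 + ∑ t, M1 t + ∑ t, ∑ j, U t j), fun M hM Q hQ d => ?_⟩
  obtain ⟨k, rfl⟩ : ∃ k, M = N + k := ⟨M - N, by omega⟩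
  have hB : ∀ j, ∃ B : Fin (N + k) → Set (Fin (N + k)),
      (∀ t, (B (Fin.castAdd k t)).ncard = U t j) ∧ (∀ i, role j = .rig i → ∀ c, B c = Q i) ∧
      (∀ i, role j = .sum i → (∀ x, x ∈ Q i ↔ ∃ c, x ∈ B c) ∧
        (∀ c c' x, x ∈ B c → x ∈ B c' → c = c') ∧ ∀ t, B (Fin.natAdd N t) = ∅) := by
    intro j
    rcases hj : role j with _ | i | i
    · have : ∀ t, ∃ A : Set (Fin (N + k)), A.ncard = U t j := by
        intro t
        apply exists_set
        have h1 : U t j ≤ ∑ j, U t j :=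
          Finset.single_le_sum (f := U t) (fun _ _ => Nat.zero_le _) (Finset.mem_univ j)
        have h2 : ∑ j, U t j ≤ ∑ t, ∑ j, U t j :=
          Finset.single_le_sum (f := fun t => ∑ j, U t j) (fun _ _ => Nat.zero_le _)
            (Finset.mem_univ t)
        omega
      choose A hA using this
      refine ⟨Fin.append A (fun _ => ∅), ?_, ?_, ?_⟩
      · intro t; rw [Fin.append_left]; exact hA t
      · intro i h; cases h
      · intro i h; cases h
    · refine ⟨fun _ => Q i, fun t => ?_, ?_, ?_⟩
      · rw [hQ, hrig j i hj _ (hU t)]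
      · rintro _ ⟨⟩ c; rfl
      · rintro _ ⟨⟩
    · obtain ⟨A, h1, h2, h3⟩ := exists_partition (Q i) (Fin.append (fun t => U t j) (fun _ : Fin k => 0))
        (by rw [Fin.sum_univ_add]; simp [Fin.append_left, Fin.append_right]; rw [hQ, ← hsum j i hj, hUs])
      refine ⟨A, fun t => by rw [h1, Fin.append_left], ?_, ?_⟩
      · rintro _ ⟨⟩
      · rintro _ ⟨⟩
        refine ⟨h2, h3, fun t => ?_⟩
        have := h1 (Fin.natAdd N t)
        rw [Fin.append_right, Set.ncard_eq_zero] at this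
        exact this
  choose B hB1 hB2 hB3 using hB
  have i0 : Fin (N + k) := ⟨0, by omega⟩
  have hL : ∀ c : Fin (N + k), ∃ L : List (Fin (N + k)) → Lab (N + k),
      (L []).P = rootP (!d) (fun j => B j c) ∧ (c.val < N → ∀ Λ p, lev p = (!d) →
        (∀ q, Λ (q ++ p) = L q) → ∀ a, (treeModel Λ).eval (Φ (!d)) p a) := by
    intro c
    induction c using Fin.addCases with
    | left t =>
      obtain ⟨L, g, f⟩ := hM1 t (N + k) (by
        have : M1 t ≤ ∑ t, M1 t :=
          Finset.single_le_sum (f := M1) (fun _ _ => Nat.zero_le _) (Finset.mem_univ t)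
        omega) (fun j => B j (Fin.castAdd k t)) (fun j => hB1 j t) (!d)
      exact ⟨L, g, fun _ => f⟩
    | right t =>
      exact ⟨fun _ => ⟨rootP (!d) (fun j => B j (Fin.natAdd N t)), fun _ => i0⟩, rfl,
        fun h => by simp at h⟩
  choose L hL1 hL2 using hL
  refine ⟨glue ⟨rootP d Q, fun _ => i0⟩ L, ?_, ?_⟩
  · rw [glue_nil]
  intro Λ p hp hq a
  have hr : (Λ p).P = rootP d Q := by rw [glue_root hq]
  have hc := glue_child hq
  have hcP : ∀ c, (Λ (c :: p)).P = rootP (!d) (fun j => B j c) := by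
    intro c
    have := hc c []
    rw [List.nil_append] at this
    rw [this, hL1]
  simp only [starF, eval_conj]
  intro φ hφ
  obtain ⟨j, -, rfl⟩ := List.mem_map.1 hφ
  rcases hj : role j with _ | i | i
  · rfl
  · simp only [eval_rigF _ (treeModel_isD Λ)]
    intro w hw
    obtain ⟨c, rfl⟩ := (tree_R hp _).1 hw
    rw [hcP, hr, rootP_same, rootP_same, hB2 j i hj]
  · simp only [eval_and, eval_sumF _ (treeModel_isD Λ), eval_rowF _ (treeModel_isD Λ)]
    obtain ⟨e1, e2, e3⟩ := hB3 j i hj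
    refine ⟨⟨?_, ?_⟩, ?_⟩
    · intro x
      rw [hr, rootP_same, e1 x]
      constructor
      · rintro ⟨c, hx⟩
        refine ⟨c :: p, (tree_R hp _).2 ⟨c, rfl⟩, ?_⟩
        rw [hcP, rootP_same]; exact hx
      · rintro ⟨w, hw, hx⟩
        obtain ⟨c, rfl⟩ := (tree_R hp _).1 hw
        rw [hcP, rootP_same] at hx
        exact ⟨c, hx⟩
    · intro x w u hw hu hx hx'
      obtain ⟨c, rfl⟩ := (tree_R hp _).1 hw
      rcases (tree_R2 hp c u).1 hu with rfl | ⟨c', hne, rfl⟩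
      · rw [hr, rootP_diff] at hx'
        exact hx'
      · rw [hcP, rootP_same] at hx hx'
        exact hne (e2 _ _ x hx' hx)
    · intro x w hw hx
      obtain ⟨c, rfl⟩ := (tree_R hp _).1 hw
      have hx0 := hx
      rw [hcP, rootP_same] at hx
      refine hL2 c ?_ Λ _ (by simp [lev, hp]) (fun q => hc c q) x
      by_contra hlt
      obtain ⟨t, rfl⟩ : ∃ t, c = Fin.natAdd N t := by
        refine ⟨⟨c.val - N, by omega⟩, ?_⟩
        ext; simp; omega
      rw [e3 t] at hx
      exact hx

theorem ex_star {n m : ℕ} {S : (Fin m → ℕ) → Prop} (role : Fin m → Role n) (hS : Ex S) :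
    Ex (StarSet role S) := by
  obtain ⟨Φ, s, c⟩ := hS
  exact ⟨starF role Φ, star_sound role s, star_compl role c⟩

end OneVarEq

namespace OneVarEq

theorem ex_congr {n : ℕ} {S T : (Fin n → ℕ) → Prop} (h : ∀ v, S v ↔ T v) (hS : Ex S) : Ex T := by
  have : S = T := funext fun v => propext (h v)
  exact this ▸ hS

theorem ex_proj {n m : ℕ} {S : (Fin m → ℕ) → Prop} (r : Fin m → Option (Fin n)) (hS : Ex S) :
    Ex (fun v : Fin n → ℕ => ∃ u, S u ∧ ∀ j i, r j = some i → u j = v i) :=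
  ex_congr (fun _ => and_self_iff) (ex_and2 r hS hS)

theorem ex_subst {n m : ℕ} {S : (Fin m → ℕ) → Prop} (s : Fin m → Fin n) (hS : Ex S) :
    Ex (fun v : Fin n → ℕ => S (fun j => v (s j))) := by
  refine ex_congr (fun v => ?_) (ex_proj (fun j => some (s j)) hS)
  constructor
  · rintro ⟨u, hu, h⟩
    have : u = fun j => v (s j) := funext fun j => h j _ rfl
    exact this ▸ hu
  · intro h
    exact ⟨_, h, by rintro j i ⟨⟩; rfl⟩

theorem ex_and {n : ℕ} {S T : (Fin n → ℕ) → Prop} (hS : Ex S) (hT : Ex T) :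
    Ex (fun v => S v ∧ T v) := by
  refine ex_congr (fun v => ?_) (ex_and2 (fun j : Fin n => some j) hS hT)
  have : ∀ u : Fin n → ℕ, (∀ j i, some j = some i → u j = v i) ↔ u = v := by
    intro u
    constructor
    · intro h; exact funext fun j => h j j rfl
    · rintro rfl j i ⟨⟩; rfl
  simp only [this, exists_eq_right]

def EX {α : Type} (S : (α → ℕ) → Prop) : Prop :=
  ∃ (n : ℕ) (e : Fin n → α) (T : (Fin n → ℕ) → Prop), Ex T ∧ ∀ v, S v ↔ T (fun j => v (e j))

theorem EX.congr {α : Type} {S T : (α → ℕ) → Prop} (hS : EX S) (h : ∀ v, S v ↔ T v) : EX T := by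
  have : S = T := funext fun v => propext (h v)
  exact this ▸ hS

theorem EX.toEx {n : ℕ} {S : (Fin n → ℕ) → Prop} (h : EX S) : Ex S := by
  obtain ⟨m, e, T, hT, h⟩ := h
  exact ex_congr (fun v => (h v).symm) (ex_subst e hT)

theorem EX.of {n : ℕ} {S : (Fin n → ℕ) → Prop} (h : Ex S) : EX S := ⟨n, id, S, h, fun _ => Iff.rfl⟩

theorem EX.subst {α β : Type} {S : (α → ℕ) → Prop} (h : EX S) (f : α → β) :
    EX (fun v => S (fun a => v (f a))) := by
  obtain ⟨n, e, T, hT, h⟩ := h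
  exact ⟨n, fun j => f (e j), T, hT, fun v => h _⟩

theorem EX.and {α : Type} {S T : (α → ℕ) → Prop} (h1 : EX S) (h2 : EX T) :
    EX (fun v => S v ∧ T v) := by
  obtain ⟨n, e, S', hS, h1⟩ := h1
  obtain ⟨m, f, T', hT, h2⟩ := h2
  refine ⟨n + m, Fin.append e f, _, ex_and (ex_subst (Fin.castAdd m) hS) (ex_subst (Fin.natAdd n) hT), ?_⟩
  intro v
  beta_reduce
  rw [h1, h2]
  simp

theorem EX.or {α : Type} {S T : (α → ℕ) → Prop} (h1 : EX S) (h2 : EX T) :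
    EX (fun v => S v ∨ T v) := by
  obtain ⟨n, e, S', hS, h1⟩ := h1
  obtain ⟨m, f, T', hT, h2⟩ := h2
  refine ⟨n + m, Fin.append e f, _, ex_or (ex_subst (Fin.castAdd m) hS) (ex_subst (Fin.natAdd n) hT), ?_⟩
  intro v
  beta_reduce
  rw [h1, h2]
  simp

theorem EX.inj {α : Type} {S : (α → ℕ) → Prop} (h : EX S) :
    ∃ (n : ℕ) (e : Fin n → α) (T : (Fin n → ℕ) → Prop), Function.Injective e ∧ Ex T ∧
      ∀ v, S v ↔ T (fun j => v (e j)) := by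
  classical
  obtain ⟨n, e, T, hT, h⟩ := h
  let s : Finset α := Finset.univ.image e
  let q := s.equivFin
  refine ⟨s.card, fun j => (q.symm j).1, _, ?_,
    ex_subst (fun j => q ⟨e j, Finset.mem_image_of_mem _ (Finset.mem_univ _)⟩) hT, ?_⟩
  · intro a b hab
    exact q.symm.injective (Subtype.ext hab)
  · intro v
    rw [h]
    simp

theorem EX.exi {α β : Type} {S : (α ⊕ β → ℕ) → Prop} (h : EX S) :
    EX (fun v : α → ℕ => ∃ u : β → ℕ, S (Sum.elim v u)) := by
  classical
  obtain ⟨n, e, T, he, hT, h⟩ := h.inj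
  let J := {j : Fin n // ∃ a, e j = Sum.inl a}
  let q := Fintype.equivFin J
  have : ∀ t : J, ∃ a, e t.1 = Sum.inl a := fun t => t.2
  choose g hg using this
  let r : Fin n → Option (Fin (Fintype.card J)) := fun j =>
    if hj : ∃ a, e j = Sum.inl a then some (q ⟨j, hj⟩) else none
  have hr : ∀ j i, r j = some i → e j = Sum.inl (g (q.symm i)) := by
    intro j i hji
    simp only [r] at hji
    split_ifs at hji with hj
    cases hji
    rw [Equiv.symm_apply_apply]
    exact hg ⟨j, hj⟩
  refine ⟨Fintype.card J, fun i => g (q.symm i), _, ex_proj r hT, ?_⟩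
  intro v
  constructor
  · rintro ⟨u, hu⟩
    rw [h] at hu
    refine ⟨_, hu, fun j i hji => ?_⟩
    rw [hr j i hji]; rfl
  · rintro ⟨u, hu, hui⟩
    refine ⟨fun b => if hb : ∃ j, e j = Sum.inr b then u hb.choose else 0, ?_⟩
    rw [h]
    convert hu using 1
    funext j
    rcases hj : e j with a | b
    · have : ∃ a, e j = Sum.inl a := ⟨a, hj⟩
      have hrj : r j = some (q ⟨j, this⟩) := by simp [r, this]
      have e2 := hr j _ hrj
      rw [hj] at e2
      rw [hui j _ hrj]
      simp only [Sum.elim_inl]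
      rw [Sum.inl.inj e2]
    · have hb : ∃ j, e j = Sum.inr b := ⟨j, hj⟩
      simp only [Sum.elim_inr, hb, dif_pos]
      congr 1
      exact he (hb.choose_spec.trans hj.symm)

theorem EX.ex1 {α : Type} {S : ℕ → (α → ℕ) → Prop}
    (h : EX (fun v : Option α → ℕ => S (v none) (fun a => v (some a)))) :
    EX (fun v => ∃ x, S x v) := by
  have := (h.subst (β := α ⊕ Unit) (fun o => o.elim (.inr ()) .inl)).exi
  refine this.congr fun v => ?_
  constructor
  · rintro ⟨u, hu⟩; exact ⟨_, hu⟩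
  · rintro ⟨x, hx⟩; exact ⟨fun _ => x, hx⟩

theorem EX.eq (α : Type) (a b : α) : EX (fun v : α → ℕ => v a = v b) := by
  have h1 : Ex (fun v : Fin 2 → ℕ => v 0 = 1 ∧ v 1 = 1) :=
    ex_and (ex_subst ![0] ex_one) (ex_subst ![1] ex_one)
  have h2 : Ex (fun v : Fin 2 → ℕ => v 0 = v 1) := by
    refine ex_congr (fun v => ?_) (ex_star ![Role.sum 0, Role.sum 1] h1)
    constructor
    · rintro ⟨l, hl, -, h⟩
      rw [← h 0 0 rfl, ← h 1 1 rfl]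
      congr 1
      refine List.map_congr_left fun u hu => ?_
      rw [(hl u hu).1, (hl u hu).2]
    · intro h
      refine ⟨List.replicate (v 0) (fun _ => 1), ?_, ?_, ?_⟩
      · intro u hu
        rw [List.eq_of_mem_replicate hu]; simp
      · intro j i hj; fin_cases j <;> simp at hj
      · intro j i hj
        fin_cases j <;> simp at hj <;> subst hj <;> simp [h]
  exact (EX.of h2).subst ![a, b]

def EXF {α : Type} (f : (α → ℕ) → ℕ) : Prop :=
  EX (fun v : Option α → ℕ => v none = f (fun a => v (some a)))

theorem EXF.proj {α : Type} (a : α) : EXF (fun v : α → ℕ => v a) := EX.eq _ _ _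

theorem EX.true (α : Type) : EX (fun _ : α → ℕ => True) := by
  have : EX (fun v : Option α → ℕ => v none = v none) := EX.eq _ _ _
  exact (EX.ex1 (S := fun x _ => x = x) this).congr (by simp)

theorem EX.fin {α : Type} {n : ℕ} {S : Fin n → (α → ℕ) → Prop} (h : ∀ i, EX (S i)) :
    EX (fun v => ∀ i, S i v) := by
  induction n with
  | zero => exact (EX.true α).congr (by simp)
  | succ n ih =>
    exact ((h 0).and (ih fun i => h i.succ)).congr fun v => by rw [Fin.forall_fin_succ]

theorem EX.comp {α : Type} {n : ℕ} {S : (Fin n → ℕ) → Prop} (hS : EX S) {f : Fin n → (α → ℕ) → ℕ}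
    (hf : ∀ i, EXF (f i)) : EX (fun v => S (fun i => f i v)) := by
  have h1 : EX (fun v : α ⊕ Fin n → ℕ => S (fun i => v (.inr i)) ∧
      ∀ i, v (.inr i) = f i (fun a => v (.inl a))) :=
    (hS.subst _).and (EX.fin fun i => EX.subst (hf i) (fun o => o.elim (Sum.inr i : α ⊕ Fin n) Sum.inl))
  refine h1.exi.congr fun v => ?_
  constructor
  · rintro ⟨u, hu, h⟩
    have : u = fun i => f i v := funext h
    exact this ▸ hu
  · intro h
    exact ⟨_, h, fun i => rfl⟩

theorem EX.comp1 {α : Type} {P : ℕ → Prop} (hP : EX (fun v : Fin 1 → ℕ => P (v 0)))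
    {f : (α → ℕ) → ℕ} (hf : EXF f) : EX (fun v => P (f v)) :=
  hP.comp (f := fun _ => f) (fun _ => hf)

theorem EX.comp2 {α : Type} {P : ℕ → ℕ → Prop} (hP : EX (fun v : Fin 2 → ℕ => P (v 0) (v 1)))
    {f g : (α → ℕ) → ℕ} (hf : EXF f) (hg : EXF g) : EX (fun v => P (f v) (g v)) :=
  hP.comp (f := ![f, g]) (fun i => by fin_cases i <;> assumption)

theorem EX.comp3 {α : Type} {P : ℕ → ℕ → ℕ → Prop}
    (hP : EX (fun v : Fin 3 → ℕ => P (v 0) (v 1) (v 2)))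
    {f g h : (α → ℕ) → ℕ} (hf : EXF f) (hg : EXF g) (hh : EXF h) :
    EX (fun v => P (f v) (g v) (h v)) :=
  hP.comp (f := ![f, g, h]) (fun i => by fin_cases i <;> assumption)

theorem EX.eqF {α : Type} {f g : (α → ℕ) → ℕ} (hf : EXF f) (hg : EXF g) :
    EX (fun v => f v = g v) :=
  EX.comp2 (P := fun x y => x = y) (EX.eq _ _ _) hf hg

theorem EXF.wk {α : Type} {f : (α → ℕ) → ℕ} (hf : EXF f) {β : Type} (g : α → β) :
    EXF (fun v : β → ℕ => f (fun a => v (g a))) :=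
  EX.subst hf (fun o => o.elim none (fun a => some (g a)))

/-- functions given by an expressible ternary graph -/
theorem EXF.comp2 {α : Type} {op : ℕ → ℕ → ℕ}
    (hop : EX (fun v : Fin 3 → ℕ => op (v 0) (v 1) = v 2))
    {f g : (α → ℕ) → ℕ} (hf : EXF f) (hg : EXF g) : EXF (fun v => op (f v) (g v)) :=
  (EX.comp3 (P := fun x y z => op x y = z) hop (hf.wk some) (hg.wk some) (EXF.proj none)).congr
    fun _ => eq_comm

theorem EXF.comp1 {α : Type} {op : ℕ → ℕ}
    (hop : EX (fun v : Fin 2 → ℕ => op (v 0) = v 1))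
    {f : (α → ℕ) → ℕ} (hf : EXF f) : EXF (fun v => op (f v)) :=
  (EX.comp2 (P := fun x z => op x = z) hop (hf.wk some) (EXF.proj none)).congr
    fun _ => eq_comm

theorem EX.zero {α : Type} (a : α) : EX (fun v : α → ℕ => v a = 0) := (EX.of ex_zero).subst ![a]
theorem EX.one {α : Type} (a : α) : EX (fun v : α → ℕ => v a = 1) := (EX.of ex_one).subst ![a]

theorem EX.add : EX (fun v : Fin 3 → ℕ => v 0 + v 1 = v 2) := by
  have h1 : EX (fun v : Fin 3 → ℕ => ((v 0 = 1 ∧ v 1 = 0) ∨ (v 0 = 0 ∧ v 1 = 1)) ∧ v 2 = 1) :=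
    ((((EX.one 0).and (EX.zero 1)).or ((EX.zero 0).and (EX.one 1))).and (EX.one 2))
  refine (EX.of (ex_star (n := 3) ![Role.sum 0, Role.sum 1, Role.sum 2] h1.toEx)).congr fun v => ?_
  constructor
  · rintro ⟨l, hl, -, h⟩
    have e0 := h 0 0 rfl
    have e1 := h 1 1 rfl
    have e2 := h 2 2 rfl
    rw [← e0, ← e1, ← e2, ← List.sum_map_add]
    congr 1
    refine List.map_congr_left fun u hu => ?_
    have := hl u hu
    omega
  · intro h
    refine ⟨List.replicate (v 0) ![1, 0, 1] ++ List.replicate (v 1) ![0, 1, 1], ?_, ?_, ?_⟩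
    · intro u hu
      rcases List.mem_append.1 hu with hu | hu <;> rw [List.eq_of_mem_replicate hu] <;> simp
    · intro j i hj; fin_cases j <;> simp at hj
    · intro j i hj
      fin_cases j <;> simp at hj <;> subst hj <;> simp [h]

theorem EX.mul : EX (fun v : Fin 3 → ℕ => v 0 * v 1 = v 2) := by
  have h1 : EX (fun v : Fin 3 → ℕ => v 1 = 1 ∧ v 2 = v 0) := (EX.one 1).and (EX.eq _ _ _)
  refine (EX.of (ex_star (n := 3) ![Role.rig 0, Role.sum 1, Role.sum 2] h1.toEx)).congr fun v => ?_
  constructor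
  · rintro ⟨l, hl, hr, h⟩
    have e0 := hr 0 0 rfl
    have e1 := h 1 1 rfl
    have e2 := h 2 2 rfl
    have e1' : l.map (fun u => u 1) = l.map (fun _ => 1) :=
      List.map_congr_left fun u hu => (hl u hu).1
    have e2' : l.map (fun u => u 2) = l.map (fun _ => v 0) :=
      List.map_congr_left fun u hu => (hl u hu).2.trans (e0 u hu)
    rw [← e1, ← e2, e1', e2']
    simp [mul_comm]
  · intro h
    refine ⟨List.replicate (v 1) ![v 0, 1, v 0], ?_, ?_, ?_⟩
    · intro u hu
      rw [List.eq_of_mem_replicate hu]; simp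
    · intro j i hj u hu
      rw [List.eq_of_mem_replicate hu]
      fin_cases j <;> simp at hj; subst hj; simp
    · intro j i hj
      fin_cases j <;> simp at hj <;> subst hj <;> simp [← h, mul_comm]

theorem EXF.add {α : Type} {f g : (α → ℕ) → ℕ} (hf : EXF f) (hg : EXF g) : EXF (fun v => f v + g v) :=
  EXF.comp2 EX.add hf hg
theorem EXF.mul {α : Type} {f g : (α → ℕ) → ℕ} (hf : EXF f) (hg : EXF g) : EXF (fun v => f v * g v) :=
  EXF.comp2 EX.mul hf hg

theorem EXF.const {α : Type} (n : ℕ) : EXF (fun _ : α → ℕ => n) := by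
  induction n with
  | zero => exact EX.zero _
  | succ n ih => exact EXF.add ih (EX.one none)

theorem EX.poly {α : Type} {p : (α → ℕ) → ℤ} (hp : IsPoly p) :
    ∃ f g, EXF f ∧ EXF g ∧ ∀ v, p v = f v - g v := by
  induction hp with
  | proj i => exact ⟨_, _, EXF.proj i, EXF.const 0, by simp⟩
  | const n =>
    exact ⟨_, _, EXF.const n.toNat, EXF.const (-n).toNat, fun v => (Int.toNat_sub_toNat_neg n).symm⟩
  | sub _ _ h1 h2 =>
    obtain ⟨f1, g1, a1, b1, e1⟩ := h1
    obtain ⟨f2, g2, a2, b2, e2⟩ := h2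
    refine ⟨_, _, a1.add b2, b1.add a2, fun v => ?_⟩
    beta_reduce
    rw [e1, e2]; push_cast; ring
  | mul _ _ h1 h2 =>
    obtain ⟨f1, g1, a1, b1, e1⟩ := h1
    obtain ⟨f2, g2, a2, b2, e2⟩ := h2
    refine ⟨_, _, (a1.mul a2).add (b1.mul b2), (a1.mul b2).add (b1.mul a2), fun v => ?_⟩
    beta_reduce
    rw [e1, e2]; push_cast; ring

theorem EX.dioph {α : Type} {S : Set (α → ℕ)} (h : Dioph S) : EX (fun v => v ∈ S) := by
  obtain ⟨β, p, hp⟩ := h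
  obtain ⟨f, g, hf, hg, e⟩ := EX.poly p.isPoly
  refine (EX.exi (EX.eqF hf hg)).congr fun v => ?_
  have h0 : ∀ u, p u = 0 ↔ f u = g u := by
    intro u
    rw [show p u = (f u : ℤ) - g u from e u]; omega
  rw [hp]
  exact exists_congr fun u => (h0 _).symm

theorem EXF.pow {α : Type} {f g : (α → ℕ) → ℕ} (hf : EXF f) (hg : EXF g) :
    EXF (fun v => f v ^ g v) := by
  refine EXF.comp2 (op := fun x y => x ^ y) ?_ hf hg
  exact EX.dioph (S := {v : Fin 3 → ℕ | v 0 ^ v 1 = v 2}) (Dioph.eq_dioph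
    (Dioph.pow_dioph (Dioph.proj_dioph 0) (Dioph.proj_dioph 1)) (Dioph.proj_dioph 2))

theorem EX.lt {α : Type} {f g : (α → ℕ) → ℕ} (hf : EXF f) (hg : EXF g) :
    EX (fun v => f v < g v) := by
  refine EX.comp2 (P := fun x y => x < y) ?_ hf hg
  exact EX.dioph (S := {v : Fin 2 → ℕ | v 0 < v 1}) (Dioph.lt_dioph
    (Dioph.proj_dioph 0) (Dioph.proj_dioph 1))

theorem EX.le {α : Type} {f g : (α → ℕ) → ℕ} (hf : EXF f) (hg : EXF g) :
    EX (fun v => f v ≤ g v) := by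
  refine EX.comp2 (P := fun x y => x ≤ y) ?_ hf hg
  exact EX.dioph (S := {v : Fin 2 → ℕ | v 0 ≤ v 1}) (Dioph.le_dioph
    (Dioph.proj_dioph 0) (Dioph.proj_dioph 1))

end OneVarEq

namespace OneVarEq

theorem pow_sum_lt {B m : ℕ} (A : Multiset ℕ) (h : ∀ a ∈ A, a ≤ m) (hc : A.card < B) :
    (A.map (fun a => B ^ a)).sum < B ^ (m + 1) := by
  have hB : 0 < B := by omega
  have : (A.map (fun a => B ^ a)).sum ≤ (A.map (fun a => B ^ a)).card • B ^ m := by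
    apply Multiset.sum_le_card_nsmul
    intro x hx
    obtain ⟨a, ha, rfl⟩ := Multiset.mem_map.1 hx
    exact Nat.pow_le_pow_right hB (h a ha)
  rw [Multiset.card_map, smul_eq_mul] at this
  refine this.trans_lt ?_
  rw [pow_succ, mul_comm]
  exact Nat.mul_lt_mul_of_pos_left hc (by positivity)

theorem pow_le_sum {B : ℕ} {A : Multiset ℕ} {m : ℕ} (h : m ∈ A) :
    B ^ m ≤ (A.map (fun a => B ^ a)).sum :=
  Multiset.le_sum_of_mem (Multiset.mem_map_of_mem _ h)

theorem exists_max (A : Multiset ℕ) (h : A ≠ 0) : ∃ m ∈ A, ∀ a ∈ A, a ≤ m := by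
  have hne : A.toFinset.Nonempty := by simpa using h
  refine ⟨A.toFinset.max' hne, ?_, ?_⟩
  · exact Multiset.mem_toFinset.1 (Finset.max'_mem _ hne)
  · intro a ha
    exact Finset.le_max' _ _ (Multiset.mem_toFinset.2 ha)

theorem digits_inj {B : ℕ} : ∀ (k : ℕ) (A A' : Multiset ℕ), A.card = k → A.card < B → A'.card < B →
    (A.map (fun a => B ^ a)).sum = (A'.map (fun a => B ^ a)).sum → A = A' := by
  intro k
  induction k with
  | zero =>
    intro A A' hk h1 h2 e
    rw [Multiset.card_eq_zero] at hk
    subst hk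
    symm
    by_contra hne
    obtain ⟨m, hm, -⟩ := exists_max A' hne
    have := pow_le_sum (B := B) hm
    have h3 : 0 < B ^ m := by apply Nat.pow_pos; omega
    simp at e
    omega
  | succ k ih =>
    intro A A' hk h1 h2 e
    have hA : A ≠ 0 := by rintro rfl; simp at hk
    obtain ⟨m, hm, hmax⟩ := exists_max A hA
    have hA' : A' ≠ 0 := by
      rintro rfl
      have := pow_le_sum (B := B) hm
      have h3 : 0 < B ^ m := by apply Nat.pow_pos; omega
      simp only [Multiset.map_zero, Multiset.sum_zero] at e
      omega
    obtain ⟨m', hm', hmax'⟩ := exists_max A' hA'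
    have l1 := pow_sum_lt A hmax h1
    have l2 := pow_sum_lt A' hmax' h2
    have g1 := pow_le_sum (B := B) hm
    have g2 := pow_le_sum (B := B) hm'
    have hB : 0 < B := by omega
    have emm : m = m' := by
      rcases lt_trichotomy m m' with h | h | h
      · have := Nat.pow_le_pow_right hB (show m + 1 ≤ m' from h)
        omega
      · exact h
      · have := Nat.pow_le_pow_right hB (show m' + 1 ≤ m from h)
        omega
    subst emm
    obtain ⟨C, rfl⟩ := Multiset.exists_cons_of_mem hm
    obtain ⟨C', rfl⟩ := Multiset.exists_cons_of_mem hm'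
    simp only [Multiset.map_cons, Multiset.sum_cons, Multiset.card_cons] at *
    rw [ih C C' (by omega) (by omega) (by omega) (by omega)]

theorem flow_path {R : ℕ → ℕ → Prop} {e : ℕ} : ∀ (k : ℕ) (X : Multiset (ℕ × ℕ)), X.card = k →
    (∀ p ∈ X, R p.1 p.2) → ∀ s, X.map Prod.fst + {e} = X.map Prod.snd + {s} →
    Relation.ReflTransGen R s e := by
  intro k
  induction k with
  | zero =>
    intro X hk _ s h
    rw [Multiset.card_eq_zero] at hk
    subst hk
    simp at h
    rw [h]
  | succ k ih =>
    intro X hk hR s h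
    have hs : s ∈ X.map Prod.fst + {e} := by rw [h]; simp
    rcases Multiset.mem_add.1 hs with hs | hs
    · obtain ⟨p, hp, rfl⟩ := Multiset.mem_map.1 hs
      obtain ⟨Y, rfl⟩ := Multiset.exists_cons_of_mem hp
      refine .head (hR p hp) (ih Y (by simpa using hk) (fun q hq => hR q (Multiset.mem_cons_of_mem hq)) _ ?_)
      simp only [Multiset.map_cons] at h
      rw [← Multiset.cons_inj_right p.1]
      rw [← Multiset.cons_add, h]
      simp only [← Multiset.singleton_add]
      ac_rfl
    · rw [Multiset.mem_singleton.1 hs]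

theorem path_flow {R : ℕ → ℕ → Prop} {s e : ℕ} (h : Relation.ReflTransGen R s e) :
    ∃ X : Multiset (ℕ × ℕ), (∀ p ∈ X, R p.1 p.2) ∧
      X.map Prod.fst + {e} = X.map Prod.snd + {s} := by
  induction h using Relation.ReflTransGen.head_induction_on with
  | refl => exact ⟨0, by simp, rfl⟩
  | head hac _ ih =>
    rename_i a c _
    obtain ⟨X, hX, h⟩ := ih
    refine ⟨(a, c) ::ₘ X, ?_, ?_⟩
    · intro p hp
      rcases Multiset.mem_cons.1 hp with rfl | hp
      · exact hac
      · exact hX p hp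
    · simp only [Multiset.map_cons, Multiset.cons_add, h]
      simp only [← Multiset.singleton_add]
      ac_rfl

theorem EX.tc {R : ℕ → ℕ → Prop} (hR : EX (fun v : Fin 2 → ℕ => R (v 0) (v 1))) :
    EX (fun v : Fin 2 → ℕ => Relation.ReflTransGen R (v 0) (v 1)) := by
  have hrow : EX (fun u : Fin 6 → ℕ => R (u 0) (u 1) ∧ u 3 = u 2 ^ u 0 ∧ u 4 = u 2 ^ u 1 ∧ u 5 = 1) :=
    (EX.comp2 hR (EXF.proj 0) (EXF.proj 1)).and
      ((EX.eqF (EXF.proj 3) ((EXF.proj 2).pow (EXF.proj 0))).and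
        ((EX.eqF (EXF.proj 4) ((EXF.proj 2).pow (EXF.proj 1))).and (EX.one 5)))
  have hst := EX.of (ex_star (n := 4)
    ![Role.free, Role.free, Role.rig 0, Role.sum 1, Role.sum 2, Role.sum 3] hrow.toEx)
  have hall : EX (fun v : Fin 2 ⊕ Fin 4 → ℕ => _ ∧ (v (.inr 1) + v (.inr 0) ^ v (.inl 1) =
      v (.inr 2) + v (.inr 0) ^ v (.inl 0) ∧ v (.inr 3) + 1 < v (.inr 0))) :=
    (hst.subst (fun i => (Sum.inr i : Fin 2 ⊕ Fin 4))).and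
      ((EX.eqF ((EXF.proj _).add ((EXF.proj _).pow (EXF.proj _)))
        ((EXF.proj _).add ((EXF.proj _).pow (EXF.proj _)))).and
        (EX.lt ((EXF.proj _).add (EXF.const 1)) (EXF.proj _)))
  refine hall.exi.congr fun v => ?_
  constructor
  · rintro ⟨w, ⟨l, hl, hrig, hsum⟩, hflow, hlt⟩
    simp only [Sum.elim_inl, Sum.elim_inr] at *
    have r0 := hrig 2 0 rfl
    have s1 := hsum 3 1 rfl
    have s2 := hsum 4 2 rfl
    have s3 := hsum 5 3 rfl
    let X : Multiset (ℕ × ℕ) := (l.map (fun u => (u 0, u 1)) : List (ℕ × ℕ))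
    have hcard : X.card = w 3 := by
      rw [← s3]
      have : l.map (fun u => u 5) = l.map (fun _ => 1) :=
        List.map_congr_left fun u hu => (hl u hu).2.2.2
      rw [this]
      simp [X]
    have e1 : ((X.map Prod.fst).map (fun a => w 0 ^ a)).sum = w 1 := by
      rw [← s1]
      have : l.map (fun u => u 3) = l.map (fun u => w 0 ^ u 0) :=
        List.map_congr_left fun u hu => by rw [(hl u hu).2.1, r0 u hu]
      rw [this]
      simp only [X, Multiset.map_coe, List.map_map, Multiset.sum_coe]
      rfl
    have e2 : ((X.map Prod.snd).map (fun a => w 0 ^ a)).sum = w 2 := by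
      rw [← s2]
      have : l.map (fun u => u 4) = l.map (fun u => w 0 ^ u 1) :=
        List.map_congr_left fun u hu => by rw [(hl u hu).2.2.1, r0 u hu]
      rw [this]
      simp only [X, Multiset.map_coe, List.map_map, Multiset.sum_coe]
      rfl
    refine flow_path _ X rfl ?_ _ (digits_inj (B := w 0) _ _ _ rfl ?_ ?_ ?_)
    · intro p hp
      obtain ⟨u, hu, rfl⟩ := List.mem_map.1 (Multiset.mem_coe.1 hp)
      exact (hl u hu).1
    · simp; omega
    · simp; omega
    · simp only [Multiset.map_add, Multiset.sum_add, e1, e2, Multiset.map_singleton,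
        Multiset.sum_singleton]
      exact hflow
  · intro h
    obtain ⟨X, hX, h⟩ := path_flow h
    let B := X.card + 2
    let l : List (Fin 6 → ℕ) := X.toList.map (fun p => ![p.1, p.2, B, B ^ p.1, B ^ p.2, 1])
    have hmem : ∀ u ∈ l, ∃ p ∈ X, u = ![p.1, p.2, B, B ^ p.1, B ^ p.2, 1] := by
      intro u hu
      obtain ⟨p, hp, rfl⟩ := List.mem_map.1 hu
      exact ⟨p, Multiset.mem_toList.1 hp, rfl⟩
    have hsums : ∀ f : ℕ × ℕ → ℕ, (X.toList.map f).sum = (X.map f).sum := by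
      intro f
      conv_rhs => rw [← Multiset.coe_toList X]
      rw [Multiset.map_coe, Multiset.sum_coe]
    refine ⟨![B, (X.map (fun p => B ^ p.1)).sum, (X.map (fun p => B ^ p.2)).sum, X.card],
      ⟨l, ?_, ?_, ?_⟩, ?_, ?_⟩
    · intro u hu
      obtain ⟨p, hp, rfl⟩ := hmem u hu
      refine ⟨hX p hp, ?_, ?_, ?_⟩ <;> simp
    · intro j i hj u hu
      obtain ⟨p, hp, rfl⟩ := hmem u hu
      fin_cases j <;> simp at hj
      subst hj; simp
    · intro j i hj
      fin_cases j <;> simp at hj <;> subst hj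
      · simp only [l, List.map_map]; exact hsums _
      · simp only [l, List.map_map]; exact hsums _
      · simp only [l, List.map_map]; refine (hsums (fun _ => 1)).trans ?_; simp
    · have := congrArg (fun Y => (Multiset.map (fun a => B ^ a) Y).sum) h
      simpa using this
    · simp [B]

end OneVarEq

namespace OneVarEq

theorem EXF.pair {α : Type} {f g : (α → ℕ) → ℕ} (hf : EXF f) (hg : EXF g) :
    EXF (fun v => Nat.pair (f v) (g v)) := by
  refine EXF.comp2 (op := Nat.pair) ?_ hf hg
  have h : EX (fun v : Fin 3 → ℕ => (v 0 < v 1 ∧ v 1 * v 1 + v 0 = v 2) ∨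
      (v 1 ≤ v 0 ∧ v 0 * v 0 + v 0 + v 1 = v 2)) :=
    ((EX.lt (EXF.proj _) (EXF.proj _)).and
      (EX.eqF (((EXF.proj _).mul (EXF.proj _)).add (EXF.proj _)) (EXF.proj _))).or
    ((EX.le (EXF.proj _) (EXF.proj _)).and
      (EX.eqF ((((EXF.proj _).mul (EXF.proj _)).add (EXF.proj _)).add (EXF.proj _)) (EXF.proj _)))
  refine h.congr fun v => ?_
  unfold Nat.pair
  split_ifs with h <;> omega

def Gr (f : ℕ →. ℕ) : Prop := EX (fun v : Fin 2 → ℕ => v 1 ∈ f (v 0))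

theorem Gr.mem {f : ℕ →. ℕ} (h : Gr f) {α : Type} {g k : (α → ℕ) → ℕ} (hg : EXF g) (hk : EXF k) :
    EX (fun v => k v ∈ f (g v)) :=
  EX.comp2 (P := fun x y => y ∈ f x) h hg hk

abbrev pr {α : Type} (a : α) : EXF (fun v : α → ℕ => v a) := EXF.proj a

theorem gr_prec {f g : ℕ →. ℕ} (hf : Gr f) (hg : Gr g) :
    Gr (Nat.unpaired fun a n =>
      n.rec (f a) fun y IH => do let i ← IH; g (Nat.pair a (Nat.pair y i))) := by
  let R : ℕ → ℕ → Prop := fun z z' => ∃ u : Fin 4 → ℕ, z = Nat.pair (u 0) (Nat.pair (u 1) (u 2)) ∧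
    z' = Nat.pair (u 0) (Nat.pair (u 1 + 1) (u 3)) ∧ u 3 ∈ g z
  have hR : EX (fun v : Fin 2 → ℕ => R (v 0) (v 1)) :=
    EX.exi (S := fun v : Fin 2 ⊕ Fin 4 → ℕ =>
      v (.inl 0) = Nat.pair (v (.inr 0)) (Nat.pair (v (.inr 1)) (v (.inr 2))) ∧
      v (.inl 1) = Nat.pair (v (.inr 0)) (Nat.pair (v (.inr 1) + 1) (v (.inr 3))) ∧
      v (.inr 3) ∈ g (v (.inl 0)))
      ((EX.eqF (pr _) ((pr _).pair ((pr _).pair (pr _)))).and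
      ((EX.eqF (pr _) ((pr _).pair (((pr _).add (EXF.const 1)).pair (pr _)))).and
      (hg.mem (pr _) (pr _))))
  have hall := EX.exi (S := fun v : Fin 2 ⊕ Fin 3 → ℕ =>
      v (.inl 0) = Nat.pair (v (.inr 0)) (v (.inr 1)) ∧
      v (.inr 2) ∈ f (v (.inr 0)) ∧
      Relation.ReflTransGen R (Nat.pair (v (.inr 0)) (Nat.pair 0 (v (.inr 2))))
        (Nat.pair (v (.inr 0)) (Nat.pair (v (.inr 1)) (v (.inl 1)))))
      ((EX.eqF (pr _) ((pr _).pair (pr _))).and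
      ((hf.mem (pr _) (pr _)).and
      (EX.comp2 (P := fun x y => Relation.ReflTransGen R x y) hR.tc
        ((pr _).pair ((EXF.const 0).pair (pr _))) ((pr _).pair ((pr _).pair (pr _))))))
  refine hall.congr fun v => ?_
  simp only [Sum.elim_inl, Sum.elim_inr, Nat.unpaired]
  generalize v 0 = x
  generalize v 1 = r
  constructor
  · rintro ⟨u, rfl, h0, h⟩
    rw [Nat.unpair_pair]
    have key : ∀ z, Relation.ReflTransGen R (Nat.pair (u 0) (Nat.pair 0 (u 2))) z →
        ∃ n r, z = Nat.pair (u 0) (Nat.pair n r) ∧ r ∈ (Nat.rec (f (u 0)) (fun y IH => do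
          let i ← IH; g (Nat.pair (u 0) (Nat.pair y i))) n : Part ℕ) := by
      intro z hz
      induction hz with
      | refl => exact ⟨0, u 2, rfl, h0⟩
      | tail _ hst ih =>
        obtain ⟨n, r, rfl, hr⟩ := ih
        obtain ⟨t, e, rfl, ht⟩ := hst
        simp only [Nat.pair_eq_pair] at e
        obtain ⟨e0, e1, e2⟩ := e
        refine ⟨n + 1, t 3, by rw [e0, e1], ?_⟩
        exact Part.mem_bind_iff.2 ⟨r, hr, ht⟩
    obtain ⟨n, r', e, hr⟩ := key _ h
    simp only [Nat.pair_eq_pair] at e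
    obtain ⟨-, e1, e2⟩ := e
    simp only [e1, e2]
    exact hr
  · intro h
    obtain ⟨a, n, rfl⟩ : ∃ a n, x = Nat.pair a n := ⟨_, _, (Nat.pair_unpair x).symm⟩
    rw [Nat.unpair_pair] at h
    simp only at h
    have key : ∀ n r, r ∈ (Nat.rec (f a) (fun y IH => do
          let i ← IH; g (Nat.pair a (Nat.pair y i))) n : Part ℕ) → ∃ i0 ∈ f a,
          Relation.ReflTransGen R (Nat.pair a (Nat.pair 0 i0)) (Nat.pair a (Nat.pair n r)) := by
      intro n
      induction n with
      | zero => exact fun r hr => ⟨r, hr, .refl⟩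
      | succ n ih =>
        intro r hr
        obtain ⟨i, hi, hr⟩ := Part.mem_bind_iff.1 hr
        obtain ⟨i0, h0, hp⟩ := ih i hi
        exact ⟨i0, h0, hp.tail ⟨![a, n, i, r], rfl, rfl, hr⟩⟩
    obtain ⟨i0, h0, hp⟩ := key n r h
    exact ⟨![a, n, i0], rfl, h0, hp⟩

theorem gr_rfind {f : ℕ →. ℕ} (hf : Gr f) :
    Gr (fun a => Nat.rfind fun n => (fun m => m = 0) <$> f (Nat.pair a n)) := by
  let R : ℕ → ℕ → Prop := fun z z' => ∃ u : Fin 3 → ℕ, z = Nat.pair (u 0) (u 1) ∧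
    z' = Nat.pair (u 0) (u 1 + 1) ∧ u 2 + 1 ∈ f z
  have hR : EX (fun v : Fin 2 → ℕ => R (v 0) (v 1)) :=
    EX.exi (S := fun v : Fin 2 ⊕ Fin 3 → ℕ =>
      v (.inl 0) = Nat.pair (v (.inr 0)) (v (.inr 1)) ∧
      v (.inl 1) = Nat.pair (v (.inr 0)) (v (.inr 1) + 1) ∧
      v (.inr 2) + 1 ∈ f (v (.inl 0)))
      ((EX.eqF (pr _) ((pr _).pair (pr _))).and
      ((EX.eqF (pr _) ((pr _).pair ((pr _).add (EXF.const 1)))).and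
      (hf.mem (pr _) ((pr _).add (EXF.const 1)))))
  have hall : EX (fun v : Fin 2 → ℕ => 0 ∈ f (Nat.pair (v 0) (v 1)) ∧
      Relation.ReflTransGen R (Nat.pair (v 0) 0) (Nat.pair (v 0) (v 1))) :=
    (hf.mem ((pr _).pair (pr _)) (EXF.const 0)).and
      (EX.comp2 (P := fun x y => Relation.ReflTransGen R x y) hR.tc
        ((pr _).pair (EXF.const 0)) ((pr _).pair (pr _)))
  refine hall.congr fun v => ?_
  generalize v 0 = a
  generalize v 1 = r
  refine Iff.trans ?_ Nat.mem_rfind.symm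
  have h1 : ∀ n, true ∈ ((fun m => decide (m = 0)) <$> f (Nat.pair a n) : Part Bool) ↔
      0 ∈ f (Nat.pair a n) := by
    intro n; simp
  have h2 : ∀ n, false ∈ ((fun m => decide (m = 0)) <$> f (Nat.pair a n) : Part Bool) ↔
      ∃ k, k + 1 ∈ f (Nat.pair a n) := by
    intro n
    simp only [Part.map_eq_map, Part.mem_map_iff, decide_eq_false_iff_not]
    constructor
    · rintro ⟨k, hk, hne⟩
      exact ⟨k - 1, by rwa [Nat.sub_add_cancel (Nat.pos_of_ne_zero hne)]⟩
    · rintro ⟨k, hk⟩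
      exact ⟨_, hk, by simp⟩
  rw [h1]
  refine and_congr_right fun _ => ?_
  simp only [h2]
  constructor
  · intro h
    have key : ∀ z, Relation.ReflTransGen R (Nat.pair a 0) z →
        ∃ n, z = Nat.pair a n ∧ ∀ m < n, ∃ k, k + 1 ∈ f (Nat.pair a m) := by
      intro z hz
      induction hz with
      | refl => exact ⟨0, rfl, by simp⟩
      | tail _ hst ih =>
        obtain ⟨n, rfl, hr⟩ := ih
        obtain ⟨t, e, rfl, ht⟩ := hst
        simp only [Nat.pair_eq_pair] at e
        obtain ⟨e0, e1⟩ := e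
        refine ⟨n + 1, by rw [e0, e1], ?_⟩
        intro m hm
        rcases Nat.lt_succ_iff_lt_or_eq.1 hm with hm | rfl
        · exact hr m hm
        · exact ⟨_, ht⟩
    obtain ⟨n, e, hr⟩ := key _ h
    simp only [Nat.pair_eq_pair] at e
    intro m hm
    exact hr m (by omega)
  · intro h
    have key : ∀ n ≤ r, Relation.ReflTransGen R (Nat.pair a 0) (Nat.pair a n) := by
      intro n
      induction n with
      | zero => exact fun _ => .refl
      | succ n ih =>
        intro hn
        obtain ⟨k, hk⟩ := h (show n < r by omega)
        exact (ih (by omega)).tail ⟨![a, n, k], rfl, rfl, hk⟩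
    exact key r le_rfl

theorem gr_all {f : ℕ →. ℕ} (hf : Nat.Partrec f) : Gr f := by
  induction hf with
  | zero =>
    refine (EX.zero (α := Fin 2) 1).congr fun v => ?_
    exact Part.mem_some_iff.symm
  | succ =>
    refine (EX.eqF (α := Fin 2) (pr 1) ((pr 0).add (EXF.const 1))).congr fun v => ?_
    exact Part.mem_some_iff.symm
  | left =>
    refine (EX.exi (S := fun v : Fin 2 ⊕ Fin 1 → ℕ => v (.inl 0) = Nat.pair (v (.inl 1)) (v (.inr 0)))
      (EX.eqF (pr _) ((pr _).pair (pr _)))).congr fun v => ?_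
    simp only [Sum.elim_inl, Sum.elim_inr, PFun.coe_val, Part.mem_some_iff]
    constructor
    · rintro ⟨u, h⟩; rw [h]; simp
    · intro h; exact ⟨fun _ => (v 0).unpair.2, by rw [h]; simp⟩
  | right =>
    refine (EX.exi (S := fun v : Fin 2 ⊕ Fin 1 → ℕ => v (.inl 0) = Nat.pair (v (.inr 0)) (v (.inl 1)))
      (EX.eqF (pr _) ((pr _).pair (pr _)))).congr fun v => ?_
    simp only [Sum.elim_inl, Sum.elim_inr, PFun.coe_val, Part.mem_some_iff]
    constructor
    · rintro ⟨u, h⟩; rw [h]; simp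
    · intro h; exact ⟨fun _ => (v 0).unpair.1, by rw [h]; simp⟩
  | pair _ _ hf hg =>
    rename_i f g _ _
    refine (EX.exi (S := fun v : Fin 2 ⊕ Fin 2 → ℕ => v (.inr 0) ∈ f (v (.inl 0)) ∧
      v (.inr 1) ∈ g (v (.inl 0)) ∧ v (.inl 1) = Nat.pair (v (.inr 0)) (v (.inr 1)))
      ((hf.mem (pr _) (pr _)).and ((hg.mem (pr _) (pr _)).and
        (EX.eqF (pr _) ((pr _).pair (pr _)))))).congr fun v => ?_
    simp only [Sum.elim_inl, Sum.elim_inr, Seq.seq, Part.map_eq_map, Part.mem_bind_iff,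
      Part.mem_map_iff]
    constructor
    · rintro ⟨u, h1, h2, h3⟩
      exact ⟨_, ⟨_, h1, rfl⟩, _, h2, h3.symm⟩
    · rintro ⟨_, ⟨a, h1, rfl⟩, b, h2, h3⟩
      exact ⟨![a, b], h1, h2, h3.symm⟩
  | comp _ _ hf hg =>
    rename_i f g _ _
    refine (EX.exi (S := fun v : Fin 2 ⊕ Fin 1 → ℕ => v (.inr 0) ∈ g (v (.inl 0)) ∧
      v (.inl 1) ∈ f (v (.inr 0)))
      ((hg.mem (pr _) (pr _)).and (hf.mem (pr _) (pr _)))).congr fun v => ?_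
    refine Iff.trans ?_ (Part.mem_bind_iff (f := g (v 0)) (g := f)).symm
    simp only [Sum.elim_inl, Sum.elim_inr]
    constructor
    · rintro ⟨u, h1, h2⟩; exact ⟨_, h1, h2⟩
    · rintro ⟨a, h1, h2⟩; exact ⟨fun _ => a, h1, h2⟩
  | prec _ _ hf hg => exact gr_prec hf hg
  | rfind _ hf => exact gr_rfind hf

end OneVarEq

namespace OneVarEq

theorem eUU_inj {a b : UU} (h : eUU a = eUU b) : a = b := by
  rcases a with a | a <;> rcases b with b | b <;> simp [eUU] at h ⊢

theorem code_inj {s t : ETm} (h : s.code = t.code) : s = t := by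
  cases s <;> cases t <;> simp [ETm.code] at h ⊢
  exact h

theorem encodeUU_inj {φ ψ : Fm} (h : EF.encode eUU φ = EF.encode eUU ψ) : φ = ψ := by
  induction φ generalizing ψ with
  | pred n t =>
    cases ψ <;> simp only [EF.encode, Nat.pair_eq_pair] at h <;> try omega
    obtain ⟨-, rfl, h⟩ := h
    rw [code_inj h]
  | eq s t =>
    cases ψ <;> simp only [EF.encode, Nat.pair_eq_pair] at h <;> try omega
    obtain ⟨-, h1, h⟩ := h
    rw [code_inj h, code_inj h1]
  | neg φ ih =>
    cases ψ <;> simp only [EF.encode, Nat.pair_eq_pair] at h <;> try omega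
    rw [ih h.2]
  | and φ φ' ih ih' =>
    cases ψ <;> simp only [EF.encode, Nat.pair_eq_pair] at h <;> try omega
    rw [ih h.2.1, ih' h.2.2]
  | ex φ ih =>
    cases ψ <;> simp only [EF.encode, Nat.pair_eq_pair] at h <;> try omega
    rw [ih h.2]
  | box m φ ih =>
    cases ψ <;> simp only [EF.encode, Nat.pair_eq_pair] at h <;> try omega
    rw [ih h.2.2, eUU_inj h.2.1]

/-- `f n` runs the `n`-th program on input `0` -/
def runF : ℕ →. ℕ := fun n => (Denumerable.ofNat Nat.Partrec.Code n).eval 0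

theorem runF_partrec : Nat.Partrec runF := by
  rw [← Partrec.nat_iff]
  exact Nat.Partrec.Code.eval_part.comp (Computable.ofNat _) (Computable.const 0)

theorem ex_halt : Ex (fun v : Fin 1 → ℕ => (runF (v 0)).Dom) := by
  have h : EX (fun v : Fin 1 ⊕ Fin 1 → ℕ => v (.inr 0) ∈ runF (v (.inl 0))) :=
    (gr_all runF_partrec).mem (pr _) (pr _)
  refine (h.exi.congr fun v => ?_).toEx
  rw [Part.dom_iff_mem]
  constructor
  · rintro ⟨u, hu⟩
    exact ⟨_, hu⟩
  · rintro ⟨y, hy⟩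
    exact ⟨fun _ => y, hy⟩

/-! ### the numeral formulas -/

def stepG (k : ℕ) : Fm :=
  .and (EF.all (EF.iff (.pred (k + 1) .var) (EF.or (.pred k .var) (.eq .var (.const (k + 1))))))
    (.neg (.pred k (.const (k + 1))))

def numG : ℕ → Fm
  | 0 => EF.all (.neg (.pred 0 .var))
  | k + 1 => .and (numG k) (stepG k)

theorem eval_stepG {F : KFrame UU} (𝔪 : EModel F) (hD : 𝔪.IsD .cd) (k w a) :
    𝔪.eval (stepG k) w a ↔
      (∀ x, x ∈ 𝔪.I w (k + 1) ↔ x ∈ 𝔪.I w k ∨ x = 𝔪.cst w (k + 1)) ∧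
        𝔪.cst w (k + 1) ∉ 𝔪.I w k := by
  simp only [stepG, eval_and, eval_all 𝔪 hD, eval_iff, eval_or, eval_neg]
  rfl

theorem numG_sound {F : KFrame UU} (𝔪 : EModel F) (hD : 𝔪.IsD .cd) [Finite 𝔪.D] (n w a)
    (h : 𝔪.eval (numG n) w a) : (𝔪.I w n).ncard = n := by
  induction n with
  | zero =>
    simp only [numG, eval_all 𝔪 hD, eval_neg, eval_pv] at h
    rw [Set.ncard_eq_zero]
    exact Set.eq_empty_of_forall_notMem h
  | succ k ih =>
    rw [numG, eval_and, eval_stepG 𝔪 hD] at h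
    obtain ⟨h0, h1, h2⟩ := h
    have e : 𝔪.I w (k + 1) = insert (𝔪.cst w (k + 1)) (𝔪.I w k) := by
      ext x
      rw [h1, Set.mem_insert_iff, or_comm]
    rw [e, Set.ncard_insert_of_notMem h2, ih h0]

def psi (F : Fm) (n : ℕ) : Fm :=
  .and (numG n)
    (.and (EF.all (EF.or (.eq .var (.const 0)) (EF.dia (md true) (.eq .var (.const 0)))))
    (.and (EF.all (EF.imp (.pred n .var) (.box (md true) (.pred 0 .var))))
    (.and (EF.all (EF.imp (.neg (.pred n .var)) (.box (md true) (.neg (.pred 0 .var)))))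
      (EF.dia (md true) F))))

theorem eval_psi {F : KFrame UU} (𝔪 : EModel F) (hD : 𝔪.IsD .cd) (Φ n w a) :
    𝔪.eval (psi Φ n) w a ↔ 𝔪.eval (numG n) w a ∧
      (∀ x, x = 𝔪.cst w 0 ∨ ∃ v, F.R (md true) w v ∧ x = 𝔪.cst v 0) ∧
      (∀ v, F.R (md true) w v → 𝔪.I v 0 = 𝔪.I w n) ∧
      ∃ v, F.R (md true) w v ∧ 𝔪.eval Φ v a := by
  simp only [psi, eval_and, eval_all 𝔪 hD, eval_or, eval_imp, eval_dia, eval_box, eval_neg, eval_pv]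
  refine and_congr_right fun _ => and_congr_right fun _ => ?_
  rw [← and_assoc]
  refine and_congr_left fun _ => ?_
  constructor
  · rintro ⟨h1, h2⟩ v hv
    ext x
    by_cases hx : x ∈ 𝔪.I w n
    · simp [hx, h1 x hx v hv]
    · simp [hx, h2 x hx v hv]
  · intro h
    exact ⟨fun x hx v hv => by rw [h v hv]; exact hx, fun x hx v hv => by rw [h v hv]; exact hx⟩

theorem psi_sound {A : ℕ → Prop} {Φ : Bool → Fm} (hs : Sound (fun v : Fin 1 → ℕ => A (v 0)) Φ)
    {F : KFrame UU} (hF : F ∈ frameFusion Dclass DfinClass) (𝔪 : EModel F) (hD : 𝔪.IsD .cd)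
    {n w a} (h : 𝔪.eval (psi (Φ false) n) w a) : A n := by
  rw [eval_psi 𝔪 hD] at h
  obtain ⟨h1, h2, h3, v, hv, h4⟩ := h
  have hfin : Finite 𝔪.D := by
    obtain ⟨ι, f, hf, hfi⟩ := hF.2
    have : (Set.univ : Set 𝔪.D) ⊆ Set.image (fun v => 𝔪.cst v 0) {v | f v = f w} := by
      intro x _
      rcases h2 x with rfl | ⟨u, hu, rfl⟩
      · exact ⟨w, rfl, rfl⟩
      · exact ⟨u, ((hf w u).1 hu).1.symm, rfl⟩
    exact Set.finite_univ_iff.1 (((hfi w).image _).subset this)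
  have := hs F hF 𝔪 hD hfin false v a h4
  have e : (𝔪.I v (ix false (0 : Fin 1))).ncard = n := by
    rw [← numG_sound 𝔪 hD n w a h1, ← h3 v hv]
    rfl
  rw [← e]; exact this

theorem ncard_lt {M n : ℕ} (h : n ≤ M) : {x : Fin M | x.val < n}.ncard = n := by
  have : {x : Fin M | x.val < n} = ((Finset.univ.filter fun x : Fin M => x.val < n) : Finset (Fin M)) := by
    ext; simp
  rw [this, Set.ncard_coe_finset, Fin.card_filter_val_lt]
  omega

theorem psi_complete {A : ℕ → Prop} {Φ : Bool → Fm} (hs : Compl (fun v : Fin 1 → ℕ => A (v 0)) Φ)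
    {n : ℕ} (hn : A n) : ∃ F ∈ frameFusion Dclass DfinClass, ∃ 𝔪 : EModel F, 𝔪.IsD .cd ∧
      ∃ w a, 𝔪.eval (psi (Φ false) n) w a := by
  obtain ⟨M0, h⟩ := hs (fun _ => n) hn
  let M := max M0 (n + 1)
  have hM : n + 1 ≤ M := le_max_right _ _
  let Q : Fin 1 → Set (Fin M) := fun _ => {x | x.val < n}
  obtain ⟨L, hL, hR⟩ := h M (le_max_left _ _) Q (fun _ => ncard_lt (by omega)) false
  have hpos : 0 < M := by omega
  let i0 : Fin M := ⟨0, hpos⟩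
  let r : Lab M := ⟨fun k => {x | x.val < k}, fun k => ⟨(k - 1) % M, Nat.mod_lt _ hpos⟩⟩
  let Λ : List (Fin M) → Lab M :=
    glue r (fun i => if i = i0 then L else fun _ => ⟨rootP false Q, fun _ => i⟩)
  have hq : ∀ q, Λ (q ++ []) = glue r
      (fun i => if i = i0 then L else fun _ => ⟨rootP false Q, fun _ => i⟩) q := by
    intro q; rw [List.append_nil]
  have hr : Λ [] = r := glue_root hq
  have hc := glue_child hq
  have hD := treeModel_isD Λ
  have hlev : lev ([] : List (Fin M)) = true := rfl
  refine ⟨treeFrame M, treeFrame_mem M, treeModel Λ, hD, [], i0, ?_⟩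
  have hI : ∀ k, (treeModel Λ).I [] k = {x : Fin M | x.val < k} := by
    intro k
    change (Λ []).P k = _
    rw [hr]
  have hcst : ∀ k, (treeModel Λ).cst [] k = ⟨(k - 1) % M, Nat.mod_lt _ hpos⟩ := by
    intro k
    change (Λ []).c k = _
    rw [hr]
  rw [eval_psi _ hD]
  refine ⟨?_, ?_, ?_, ?_⟩
  · have : ∀ k ≤ n, (treeModel Λ).eval (numG k) [] i0 := by
      intro k
      induction k with
      | zero =>
        intro _
        simp only [numG, eval_all _ hD, eval_neg, eval_pv]
        intro b
        rw [hr]; simp [r]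
      | succ k ih =>
        intro hk
        rw [numG, eval_and, eval_stepG _ hD]
        have e : k % M = k := Nat.mod_eq_of_lt (by omega)
        refine ⟨ih (by omega), ?_, ?_⟩
        · intro x
          rw [hI, hI, hcst]
          simp only [Set.mem_ofPred_eq, Fin.ext_iff, Nat.add_sub_cancel, e]
          omega
        · rw [hI, hcst]
          simp [e]
    exact this n le_rfl
  · intro x
    by_cases hx : x = i0
    · left
      rw [hx, hcst]
      simp [i0]
    · right
      refine ⟨[x], (tree_R hlev _).2 ⟨x, rfl⟩, ?_⟩
      have := hc x []
      rw [List.nil_append] at this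
      change x = (Λ [x]).c 0
      rw [this]; simp [hx]
  · intro v hv
    obtain ⟨i, rfl⟩ := (tree_R hlev _).1 hv
    rw [hI]
    have := hc i []
    rw [List.nil_append] at this
    change (Λ [i]).P 0 = _
    rw [this]
    have e : rootP false Q 0 = {x : Fin M | x.val < n} := rootP_same false Q 0
    split_ifs
    · rw [hL, e]
    · exact e
  · refine ⟨[i0], (tree_R hlev _).2 ⟨_, rfl⟩, hR Λ [i0] rfl (fun q => ?_) i0⟩
    rw [hc i0 q]; simp

/-! ### computability of the reduction -/

def stepC (p : ℕ × ℕ) : ℕ × ℕ :=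
  (p.1 + 1, Nat.pair 3 (Nat.pair p.2 (EF.encode eUU (stepG p.1))))

theorem stepC_pr : PR stepC := by
  unfold stepC
  simp only [stepG, EF.all, EF.iff, EF.imp, EF.or, EF.encode, ETm.code]
  fun_prop

theorem stepC_iter (n : ℕ) :
    stepC^[n] (0, EF.encode eUU (numG 0)) = (n, EF.encode eUU (numG n)) := by
  induction n with
  | zero => rfl
  | succ n ih =>
    rw [Function.iterate_succ_apply', ih]
    rfl

@[fun_prop] theorem PR.numG' : PR (fun n => EF.encode eUU (numG n)) := by
  have h : PR (fun n : ℕ => (stepC^[n] (0, EF.encode eUU (numG 0))).2) := by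
    have := PR.iter (α := ℕ) (f := fun n => n) (g := fun _ => (0, EF.encode eUU (numG 0)))
      (h := fun p => stepC p.2) (by fun_prop) (by fun_prop) (PR.comp' stepC_pr (by fun_prop))
    exact PR.snd' this
  simpa only [stepC_iter] using h

theorem psi_pr (F : Fm) : PR (fun n => EF.encode eUU (.neg (psi F n))) := by
  simp only [psi, EF.dia, EF.all, EF.imp, EF.or, EF.encode, ETm.code]
  fun_prop

theorem undec : ¬ DecidableELogic eUU (LogED DSem.cd (frameFusion Dclass DfinClass)) := by
  intro hdec
  obtain ⟨Φ, hs, hc⟩ := ex_halt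
  have key : ∀ n, (∃ φ ∈ LogED DSem.cd (frameFusion Dclass DfinClass),
      EF.encode eUU φ = EF.encode eUU (.neg (psi (Φ false) n))) ↔ ¬ (runF n).Dom := by
    intro n
    constructor
    · rintro ⟨φ, hφ, e⟩ hn
      obtain rfl := encodeUU_inj e
      obtain ⟨F, hF, 𝔪, hD, w, a, h⟩ :=
        psi_complete (A := fun n => (runF n).Dom) hc hn
      exact hφ F hF 𝔪 hD w a (by rw [hD rfl]; trivial) h
    · intro hn
      refine ⟨_, ?_, rfl⟩
      intro F hF 𝔪 hD w a _ h
      exact hn (psi_sound (A := fun n => (runF n).Dom) hs hF 𝔪 hD h)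
  have h1 : ComputablePred (fun n => ¬ (runF n).Dom) := by
    refine ComputablePred.computable_of_manyOneReducible
      (q := fun n => ∃ φ ∈ LogED DSem.cd (frameFusion Dclass DfinClass), EF.encode eUU φ = n)
      ⟨_, Primrec.to_comp (psi_pr (Φ false)), fun n => (key n).symm⟩ hdec
  have h2 : ComputablePred (fun n => (runF n).Dom) := h1.not.of_eq (by simp)
  refine ComputablePred.halting_problem 0 ?_
  refine ComputablePred.computable_of_manyOneReducible (q := fun n => (runF n).Dom)
    ⟨Encodable.encode, Computable.encode, fun c => ?_⟩ h2
  simp [runF]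
end OneVarEq

namespace OneVarEq

/-- `Log^=_cd 𝒟` and `Log^=_cd 𝒟_fin` are decidable, but the
logic `Log^=_cd (𝒟 ⊗ 𝒟_fin)` of the fusion of the two frame classes is
undecidable. -/
theorem diff_fusion_undecidable :
    DecidableELogic eU (LogED DSem.cd Dclass) ∧
    DecidableELogic eU (LogED DSem.cd DfinClass) ∧
    ¬ DecidableELogic eUU (LogED DSem.cd (frameFusion Dclass DfinClass)) := by
  exact ⟨decD, decF, undec⟩

end OneVarEq
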